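/- Let V=κ^r, Q=κ^{n−r}, and 𝓘=(I^1,…,I^s) an s-tuple of subsets of [n], each of cardinality r. Consider the properties: (α) ∏_{j=1}^{s} ω_{I^j} ≠ 0 in H*(Gr(r,n)); (β) there exists 𝓔 ∈ Fl(κ^n)^s and a point T ∈ ∩_{j=1}^{s} Ω°_{I^j}(E^j_•) at which the smooth varieties Ω°_{I^j}(E^j_•), j=1,…,s, meet transversally; (γ) for generic (𝓕,𝓖) ∈ Fl(V)^s × Fl(Q)^s, the vector space Hom_𝓘(V,Q,𝓕,𝓖) has dimension dim(Gr(r,n)) − Σ_{j=1}^{s} codim(ω_{I^j}). Then the implications (γ) ⇒ (β) ⇒ (α) hold in any characteristic, and in characteristic zero (α) ⇒ (γ). -/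

import Mathlib

noncomputable section

open Module Submodule

/-! ### Polynomial functions and the Zariski topology on a vector space -/

/-- Evaluation of a polynomial in linear functionals at a point of a vector space.
These are exactly the polynomial functions on a finite-dimensional vector space. -/
def mEval (k : Type*) {M : Type*} [Field k] [AddCommGroup M] [Module k M]
    (x : M) (p : MvPolynomial (Module.Dual k M) k) : k :=
  MvPolynomial.eval (fun l : Module.Dual k M => l x) p

/-- The Zariski topology on a (finite-dimensional) vector space, generated by the
complements of zero sets of polynomial functions. -/
def mZariski (k M : Type*) [Field k] [AddCommGroup M] [Module k M] :
    TopologicalSpace M :=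
  TopologicalSpace.generateFrom
    {U : Set M | ∃ p : MvPolynomial (Module.Dual k M) k, U = {x : M | mEval k x p ≠ 0}}

/-- The Zariski tangent space at a point `x` to a subset `A` of a vector space:
the common kernel of the differentials at `x` of all polynomial functions vanishing on `A`. -/
def mTangent (k : Type*) {M : Type*} [Field k] [AddCommGroup M] [Module k M]
    (A : Set M) (x : M) : Submodule k M :=
  letI := Classical.decEq (Module.Dual k M)
  ⨅ p ∈ {p : MvPolynomial (Module.Dual k M) k | ∀ a ∈ A, mEval k a p = 0},
    LinearMap.ker (∑ l ∈ p.vars, mEval k x (MvPolynomial.pderiv l p) • (l : Module.Dual k M))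

/-- `f : M → N` is a polynomial map on a subset `A ⊆ M`. -/
def IsPolyOn (k : Type*) {M N : Type*} [Field k] [AddCommGroup M] [Module k M]
    [AddCommGroup N] [Module k N] (A : Set M) (f : M → N) : Prop :=
  ∀ l : Module.Dual k N, ∃ p : MvPolynomial (Module.Dual k M) k, ∀ x ∈ A, l (f x) = mEval k x p

/-- Dimension (topological Krull dimension) of a subset of a topological space. -/
def subDim {α : Type*} (t : TopologicalSpace α) (C : Set α) : WithBot ℕ∞ :=
  @topologicalKrullDim C (TopologicalSpace.induced (Subtype.val : C → α) t)

/-- The irreducible components of a subset `A` of a topological space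
(for the subspace topology). -/
def subComponents {α : Type*} (t : TopologicalSpace α) (A : Set α) : Set (Set ↥A) :=
  @irreducibleComponents A (TopologicalSpace.induced (Subtype.val : A → α) t)

/-- Dimension of a subset `C` of a subspace `A` of a topological space. -/
def compDim {α : Type*} (t : TopologicalSpace α) (A : Set α) (C : Set ↥A) : WithBot ℕ∞ :=
  subDim (TopologicalSpace.induced (Subtype.val : A → α) t) C

/-! ### Flags, Schubert cells and Schubert varieties -/

/-- A complete flag on a finite-dimensional vector space, recorded as the increasing
function sending `m` to the `m`-th member (of dimension `m`) of the flag. -/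
def IsFlag {k M : Type*} [Field k] [AddCommGroup M] [Module k M]
    (E : ℕ → Submodule k M) : Prop :=
  Monotone E ∧ ∀ m : ℕ, finrank k ↥(E m) = min m (finrank k M)

/-- Membership of `V` in the (open) Schubert cell `Ω°_I(E_•) ⊆ Gr(r, M)` attached to the
subset `I ⊆ [n]` recorded by the strictly increasing tuple `i : Fin r → Fin n`
(`0`-indexed: the `1`-based subset is `{i a + 1}`): `dim (V ∩ E_u) = #{a | i_a ≤ u}`. -/
def cellMem {k M : Type*} [Field k] [AddCommGroup M] [Module k M] {n r : ℕ}
    (i : Fin r → Fin n) (E : ℕ → Submodule k M) (V : Submodule k M) : Prop :=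
  finrank k ↥V = r ∧
    ∀ u : ℕ, u ≤ n →
      finrank k ↥(V ⊓ E u) =
        (Finset.univ.filter (fun a : Fin r => (i a : ℕ) + 1 ≤ u)).card

/-- Membership of `V` in the (closed) Schubert variety `Ω_I(E_•) ⊆ Gr(r, M)`:
`dim (V ∩ E_{i_a}) ≥ a` for `a = 1, …, r`. -/
def varMem {k M : Type*} [Field k] [AddCommGroup M] [Module k M] {n r : ℕ}
    (i : Fin r → Fin n) (E : ℕ → Submodule k M) (V : Submodule k M) : Prop :=
  finrank k ↥V = r ∧ ∀ a : Fin r, (a : ℕ) + 1 ≤ finrank k ↥(V ⊓ E ((i a : ℕ) + 1))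

/-- The flag induced on a subspace `V` by a flag `E` on `M`: its `a`-th member is the
smallest subspace of the form `V ∩ E_u` of dimension `≥ a`. -/
def indSub {k M : Type*} [Field k] [AddCommGroup M] [Module k M]
    (E : ℕ → Submodule k M) (V : Submodule k M) : ℕ → Submodule k ↥V := fun a =>
  ⨅ u ∈ {u : ℕ | a ≤ finrank k ↥(Submodule.comap V.subtype (E u))},
    Submodule.comap V.subtype (E u)

/-- The flag induced on the quotient `M ⧸ V` by a flag `E` on `M`: its `b`-th member is
the smallest subspace of the form `(E_u + V)/V` of dimension `≥ b`. -/
def indQuot {k M : Type*} [Field k] [AddCommGroup M] [Module k M]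
    (E : ℕ → Submodule k M) (V : Submodule k M) : ℕ → Submodule k (M ⧸ V) := fun b =>
  ⨅ u ∈ {u : ℕ | b ≤ finrank k ↥(Submodule.map V.mkQ (E u))},
    Submodule.map V.mkQ (E u)

/-- The flag spanned by a tuple of vectors (a complete flag when the tuple is a basis). -/
def spanFlag (k : Type*) {M : Type*} [Field k] [AddCommGroup M] [Module k M] {r : ℕ}
    (b : Fin r → M) : ℕ → Submodule k M := fun m =>
  Submodule.span k (b '' {a : Fin r | (a : ℕ) < m})

/-- `P` holds for a generic point of `Fl(M)^s` (`r = dim M`): there is a nonempty Zariski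
open set of `s`-tuples of bases of `M` on which the associated tuples of complete flags
satisfy `P`. -/
def GenericFlags (k : Type*) {M : Type*} [Field k] [AddCommGroup M] [Module k M]
    (s r : ℕ) (P : (Fin s → ℕ → Submodule k M) → Prop) : Prop :=
  ∃ U : Set (Fin s → Fin r → M),
    @IsOpen _ (mZariski k (Fin s → Fin r → M)) U ∧
    (∃ b ∈ U, ∀ j, LinearIndependent k (b j)) ∧
    ∀ b ∈ U, (∀ j, LinearIndependent k (b j)) → P (fun j => spanFlag k (b j))

/-- `P` holds for a generic point of `Fl(M)^s × Fl(Q)^s` (`r = dim M`, `q = dim Q`). -/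
def GenericFlagPairs (k : Type*) {M Q : Type*} [Field k] [AddCommGroup M] [Module k M]
    [AddCommGroup Q] [Module k Q] (s r q : ℕ)
    (P : (Fin s → ℕ → Submodule k M) → (Fin s → ℕ → Submodule k Q) → Prop) : Prop :=
  ∃ U : Set ((Fin s → Fin r → M) × (Fin s → Fin q → Q)),
    @IsOpen _ (mZariski k ((Fin s → Fin r → M) × (Fin s → Fin q → Q))) U ∧
    (∃ b ∈ U, (∀ j, LinearIndependent k (b.1 j)) ∧ ∀ j, LinearIndependent k (b.2 j)) ∧
    ∀ b ∈ U, ((∀ j, LinearIndependent k (b.1 j)) ∧ ∀ j, LinearIndependent k (b.2 j)) →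
      P (fun j => spanFlag k (b.1 j)) (fun j => spanFlag k (b.2 j))

/-! ### The spaces `Hom_𝓘(V, Q, 𝓕, 𝓖)` -/

/-- The subspace `{φ : M →ₗ Q | φ(p) ⊆ q}` of `Hom(M, Q)`. -/
def homConstraint {k M Q : Type*} [Field k] [AddCommGroup M] [Module k M]
    [AddCommGroup Q] [Module k Q] (p : Submodule k M) (q : Submodule k Q) :
    Submodule k (M →ₗ[k] Q) :=
  LinearMap.ker ((LinearMap.llcomp k ↥p Q (Q ⧸ q) q.mkQ).comp (LinearMap.lcomp k Q p.subtype))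

/-- `Hom_𝓘(M, Q, F, G) = {φ | φ(F^j_a) ⊆ G^j_{i^j_a - a} for all a = 1, …, r, j = 1, …, s}`. -/
def homSpace {k M Q : Type*} [Field k] [AddCommGroup M] [Module k M]
    [AddCommGroup Q] [Module k Q] {n r s : ℕ} (I : Fin s → Fin r → Fin n)
    (F : Fin s → ℕ → Submodule k M) (G : Fin s → ℕ → Submodule k Q) :
    Submodule k (M →ₗ[k] Q) :=
  ⨅ j : Fin s, ⨅ a : Fin r,
    homConstraint (F j ((a : ℕ) + 1)) (G j ((I j a : ℕ) - (a : ℕ)))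

/-! ### Charts on the Grassmannian, tangent spaces to Schubert cells -/

/-- The graph of `ψ : V →ₗ C`, a point of the Grassmannian chart around `V`
determined by a complement `C` of `V`. -/
def graphMap {k M : Type*} [Field k] [AddCommGroup M] [Module k M]
    (V C : Submodule k M) (ψ : ↥V →ₗ[k] ↥C) : Submodule k M :=
  LinearMap.range (V.subtype + C.subtype ∘ₗ ψ)

/-- The canonical identification `Hom(V, C) ≃ Hom(V, M/V)` (derivative of the chart). -/
def conjMap {k M : Type*} [Field k] [AddCommGroup M] [Module k M]
    (V C : Submodule k M) : (↥V →ₗ[k] ↥C) →ₗ[k] (↥V →ₗ[k] M ⧸ V) :=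
  LinearMap.llcomp k ↥V ↥C (M ⧸ V) (V.mkQ ∘ₗ C.subtype)

/-- The tangent space at `V` to a set `S` of points of the Grassmannian `Gr(r, M)`,
computed in the chart determined by a complement `C` of `V` and viewed inside
`Hom(V, M/V)` via the canonical identification. -/
def grTangent {k M : Type*} [Field k] [AddCommGroup M] [Module k M]
    (S : Set (Submodule k M)) (V C : Submodule k M) :
    Submodule k (↥V →ₗ[k] (M ⧸ V)) :=
  Submodule.map (conjMap V C)
    (mTangent k {ψ : ↥V →ₗ[k] ↥C | graphMap V C ψ ∈ S} 0)

/-- The Zariski topology on the Grassmannian of `r`-dimensional subspaces of `M`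
(as a topology on `Submodule k M`), coinduced from the Stiefel parameterization by
spanning `r`-tuples. -/
def grTop (k : Type*) {M : Type*} [Field k] [AddCommGroup M] [Module k M] (r : ℕ) :
    TopologicalSpace (Submodule k M) :=
  TopologicalSpace.coinduced (fun b : Fin r → M => Submodule.span k (Set.range b))
    (mZariski k (Fin r → M))

/-! ### Numerical quantities -/

/-- `codim ω_I = ∑_{a=1}^r (n - r + a - i_a)` (as an integer). -/
def codimZ (n r : ℕ) (i : Fin r → Fin n) : ℤ :=
  ∑ a : Fin r, ((n : ℤ) - (r : ℤ) + ((a : ℕ) : ℤ) - ((i a : ℕ) : ℤ))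

/-- The quantity `∑_j ∑_{a ∈ K^j} (n - r + a - i^j_a) - d(n - r)` of Inequality `(†^𝓘_𝓚)`. -/
def daggerZ (n r d : ℕ) {s : ℕ} (I : Fin s → Fin r → Fin n)
    (K : Fin s → Fin d → Fin r) : ℤ :=
  (∑ j : Fin s, ∑ t : Fin d,
      ((n : ℤ) - (r : ℤ) + ((K j t : ℕ) : ℤ) - ((I j (K j t) : ℕ) : ℤ)))
    - (d : ℤ) * ((n : ℤ) - (r : ℤ))

/-- The expected dimension `dim(S, M, 𝓕) = d(m - d) - ∑_j ∑_{t=1}^d (m - d + t - k^j_t)`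
of an intersection of Schubert cells `Ω°_{K^j}` in `Gr(d, m)`. -/
def eDimZ {s : ℕ} (m d : ℕ) (K : Fin s → Fin d → Fin m) : ℤ :=
  (d : ℤ) * ((m : ℤ) - (d : ℤ)) -
    ∑ j : Fin s, ∑ t : Fin d,
      ((m : ℤ) - (d : ℤ) + ((t : ℕ) : ℤ) - ((K j t : ℕ) : ℤ))

/-- `codim ω_I` as a natural number. -/
def codimN (n r : ℕ) (i : Fin r → Fin n) : ℕ :=
  ∑ a : Fin r, ((n - r + (a : ℕ)) - (i a : ℕ))

/-! ### The cohomology ring of the Grassmannian, Schubert classes -/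

/-- The ideal `(h_{n-r+1}, …, h_n)` of the polynomial ring in `r` variables
(`h_m` the complete homogeneous symmetric polynomials). -/
def grassIdeal (r n : ℕ) : Ideal (MvPolynomial (Fin r) ℤ) :=
  Ideal.span ((fun m : ℕ => MvPolynomial.hsymm (Fin r) ℤ m) '' Set.Icc (n - r + 1) n)

/-- A presentation of the cohomology (Chow) ring `H^*(Gr(r,n))`: products of Schubert
classes vanish here exactly when they vanish in `H^*(Gr(r,n))`. -/
abbrev grassRing (r n : ℕ) : Type :=
  MvPolynomial (Fin r) ℤ ⧸ grassIdeal r n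

/-- `h_m` for an integer `m` (zero for negative `m`). -/
def hkZ (r : ℕ) (m : ℤ) : MvPolynomial (Fin r) ℤ :=
  if 0 ≤ m then MvPolynomial.hsymm (Fin r) ℤ m.toNat else 0

/-- The Schur polynomial (Jacobi–Trudi determinant) of the partition
`λ_a = n - r + a - i_a` attached to the subset `I ⊆ [n]` recorded by `i`. -/
def schurI {n r : ℕ} (i : Fin r → Fin n) : MvPolynomial (Fin r) ℤ :=
  Matrix.det (Matrix.of fun a b : Fin r =>
    hkZ r ((n : ℤ) - (r : ℤ) + ((b : ℕ) : ℤ) - ((i a : ℕ) : ℤ)))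

/-- The Schubert class `ω_I ∈ H^*(Gr(r,n))` of the subset `I ⊆ [n]` recorded by the
strictly increasing tuple `i : Fin r → Fin n`. -/
def omegaCls {n r : ℕ} (i : Fin r → Fin n) : grassRing r n :=
  Ideal.Quotient.mk (grassIdeal r n) (schurI i)

/-- The class of a point in `H^*(Gr(r,n))`: the Schubert class of `I = {1, …, r}`. -/
def pointCls (r n : ℕ) (h : r ≤ n) : grassRing r n :=
  omegaCls (fun a : Fin r => Fin.castLE h a)

/-! ### Schur polynomials of partitions, Littlewood–Richardson coefficients -/

/-- The Schur polynomial of a partition with at most `r` parts, via Jacobi–Trudi. -/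
def schurP {r : ℕ} (lam : Fin r → ℕ) : MvPolynomial (Fin r) ℤ :=
  Matrix.det (Matrix.of fun a b : Fin r =>
    hkZ r (((lam a : ℕ) : ℤ) - ((a : ℕ) : ℤ) + ((b : ℕ) : ℤ)))

/-- The Vandermonde alternant `a_δ = det(x_a^{r-1-b})`. -/
def alternant (r : ℕ) : MvPolynomial (Fin r) ℤ :=
  Matrix.det (Matrix.of fun a b : Fin r => (MvPolynomial.X a) ^ (r - 1 - (b : ℕ)))

/-- The coefficient of the Schur polynomial `s_δ` in a symmetric polynomial `f`
(in `r` variables): the coefficient of the monomial `x^{δ + (r-1, …, 1, 0)}` in `f ⬝ a_δ`. -/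
def schurCoeff (r : ℕ) (f : MvPolynomial (Fin r) ℤ) (δ : Fin r → ℕ) : ℤ :=
  MvPolynomial.coeff
    (Finsupp.equivFunOnFinite.symm (fun a : Fin r => δ a + (r - 1 - (a : ℕ))))
    (f * alternant r)

/-- The Littlewood–Richardson coefficient `c^λ_{μ,ν}` (partitions with at most `r` parts):
the multiplicity of `V_λ` in `V_μ ⊗ V_ν`, i.e. of `s_λ` in `s_μ s_ν`. -/
def lrCoeff (r : ℕ) (lam mu nu : Fin r → ℕ) : ℤ :=
  schurCoeff r (schurP mu * schurP nu) lam

/-- The multiplicity of `V_δ` in `V_{Λ 1} ⊗ ⋯ ⊗ V_{Λ t}` (as `GL(r)`-representations),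
i.e. of `s_δ` in `∏_j s_{Λ j}`. -/
def multiCoeff (r : ℕ) {t : ℕ} (Λ : Fin t → Fin r → ℕ) (δ : Fin r → ℕ) : ℤ :=
  schurCoeff r (∏ j : Fin t, schurP (Λ j)) δ


theorem hsymm_series (r : ℕ) :
    PowerSeries.mk (fun m => MvPolynomial.hsymm (Fin r) ℤ m)
      = ∏ i : Fin r, PowerSeries.mk (fun m => (MvPolynomial.X i : MvPolynomial (Fin r) ℤ) ^ m) := by
  ext1 m
  rw [PowerSeries.coeff_mk, PowerSeries.coeff_prod, ← Finset.sum_coe_sort, MvPolynomial.hsymm]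
  have hmem : ∀ P : Fin r →₀ ℕ, P.sum (fun _ => id) = m ↔ P ∈ Finset.univ.finsuppAntidiag m :=
    fun P => by simp [Finset.mem_finsuppAntidiag, Finsupp.sum_fintype]
  refine Fintype.sum_equiv ((Sym.equivNatSum (Fin r) m).trans
    (Equiv.subtypeEquivRight hmem)) _ _ fun s => ?_
  simp only [PowerSeries.coeff_mk]
  rw [Finset.prod_multiset_map_count, ← Finset.prod_subset (Finset.subset_univ s.1.toFinset)]
  · refine Finset.prod_congr rfl fun i _ => ?_
    congr 1
  · intro i _ hi
    have : s.1.count i = 0 := by simpa using hi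
    change _ ^ (s.1.count i) = 1
    rw [this, pow_zero]

theorem geom_series_mul {R : Type*} [CommRing R] (x : R) :
    PowerSeries.mk (fun m => x ^ m) * (1 - PowerSeries.C x * PowerSeries.X) = 1 := by
  ext1 m
  rw [mul_sub, mul_one, ← mul_assoc, mul_comm _ (PowerSeries.C x), map_sub]
  cases m with
  | zero => simp
  | succ m => simp [PowerSeries.coeff_succ_mul_X, pow_succ', PowerSeries.coeff_one]

/-- The generating function of the complete symmetric polynomials. -/
theorem hsymm_series_mul (r : ℕ) :
    PowerSeries.mk (fun m => MvPolynomial.hsymm (Fin r) ℤ m)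
      * ∏ i : Fin r, (1 - PowerSeries.C (MvPolynomial.X i) * PowerSeries.X) = 1 := by
  rw [hsymm_series, ← Finset.prod_mul_distrib]
  exact Finset.prod_eq_one fun i _ => geom_series_mul _

/-- The elementary symmetric polynomial of degree `j` in the variables indexed by `S`. -/
def esymmOn {r : ℕ} (S : Finset (Fin r)) (j : ℕ) : MvPolynomial (Fin r) ℤ :=
  ∑ t ∈ S.powersetCard j, ∏ i ∈ t, MvPolynomial.X i

theorem prod_one_sub_series {r : ℕ} (S : Finset (Fin r)) :
    ∏ i ∈ S, (1 - PowerSeries.C (MvPolynomial.X i : MvPolynomial (Fin r) ℤ) * PowerSeries.X)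
      = PowerSeries.mk (fun j => (-1) ^ j * esymmOn S j) := by
  simp only [sub_eq_add_neg]
  rw [Finset.prod_one_add]
  ext1 j
  rw [map_sum, PowerSeries.coeff_mk, esymmOn, Finset.mul_sum,
    ← Finset.sum_subset (s₁ := S.powersetCard j)
      fun t ht => Finset.mem_powerset.2 (Finset.mem_powersetCard.1 ht).1]
  · refine Finset.sum_congr rfl fun t ht => ?_
    rw [Finset.mem_powersetCard] at ht
    rw [Finset.prod_neg, Finset.prod_mul_distrib, Finset.prod_const, ← map_prod, ht.2]
    have : ((-1 : PowerSeries (MvPolynomial (Fin r) ℤ)) ^ j) = PowerSeries.C ((-1) ^ j) := by simp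
    rw [this, ← mul_assoc, ← map_mul, PowerSeries.coeff_C_mul]
    simp [PowerSeries.coeff_X_pow]
  · intro t ht hj
    rw [Finset.mem_powersetCard] at hj
    have hc : j ≠ t.card := fun h => hj ⟨Finset.mem_powerset.1 ht, h.symm⟩
    rw [Finset.prod_neg, Finset.prod_mul_distrib, Finset.prod_const, ← map_prod]
    have : ((-1 : PowerSeries (MvPolynomial (Fin r) ℤ)) ^ t.card)
        = PowerSeries.C ((-1) ^ t.card) := by simp
    rw [this, ← mul_assoc, ← map_mul, PowerSeries.coeff_C_mul]
    simp [PowerSeries.coeff_X_pow, hc]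

theorem esymmOn_eq_zero {r : ℕ} {S : Finset (Fin r)} {j : ℕ} (h : S.card < j) :
    esymmOn S j = 0 := by
  rw [esymmOn, Finset.powersetCard_eq_empty.2 h, Finset.sum_empty]

/-- A convolution with the complete symmetric polynomials as a finite sum of fixed length. -/
theorem antidiagonal_hsymm_eq {r : ℕ} (N m : ℕ) (e : ℕ → MvPolynomial (Fin r) ℤ)
    (he : ∀ j, N ≤ j → e j = 0) :
    ∑ p ∈ Finset.HasAntidiagonal.antidiagonal m, MvPolynomial.hsymm (Fin r) ℤ p.1 * e p.2
      = ∑ j ∈ Finset.range N, hkZ r ((m : ℤ) - j) * e j := by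
  have h1 : ∑ p ∈ Finset.HasAntidiagonal.antidiagonal m, MvPolynomial.hsymm (Fin r) ℤ p.1 * e p.2
      = ∑ j ∈ Finset.range (m + 1), hkZ r ((m : ℤ) - j) * e j := by
    rw [Finset.Nat.sum_antidiagonal_eq_sum_range_succ
      (fun i j => MvPolynomial.hsymm (Fin r) ℤ i * e j), ← Finset.sum_range_reflect]
    refine Finset.sum_congr rfl fun j hj => ?_
    have hj' : j ≤ m := Nat.lt_succ_iff.1 (Finset.mem_range.1 hj)
    have h2 : m + 1 - 1 - j = m - j := by omega
    have h3 : m - (m - j) = j := by omega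
    rw [h2, h3, hkZ, if_pos (by omega)]
    congr 2
    omega
  rw [h1]
  have key : ∀ A : ℕ, (∀ j, A ≤ j → hkZ r ((m : ℤ) - j) * e j = 0) →
      ∑ j ∈ Finset.range A, hkZ r ((m : ℤ) - j) * e j
        = ∑ j ∈ Finset.range (max N (m + 1)), hkZ r ((m : ℤ) - j) * e j := by
    intro A hA
    rcases le_total A (max N (m + 1)) with h | h
    · refine Finset.sum_subset (Finset.range_mono h) fun j _ hj => hA j (by simpa using hj)
    · refine (Finset.sum_subset (Finset.range_mono h) fun j _ hj => ?_).symm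
      rw [Finset.mem_range, not_lt] at hj
      rw [he j (le_trans (le_max_left _ _) hj), mul_zero]
  rw [key (m + 1) fun j hj => ?_, key N fun j hj => by rw [he j hj, mul_zero]]
  rw [hkZ, if_neg (by omega), zero_mul]

theorem sum_hkZ_esymmOn_erase {r : ℕ} (c : Fin r) (m : ℕ) :
    ∑ j ∈ Finset.range r, hkZ r ((m : ℤ) - j) * ((-1) ^ j * esymmOn (Finset.univ.erase c) j)
      = MvPolynomial.X c ^ m := by
  have h := hsymm_series_mul r
  rw [← Finset.mul_prod_erase _ _ (Finset.mem_univ c)] at h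
  have h2 : PowerSeries.mk (fun m => MvPolynomial.hsymm (Fin r) ℤ m)
      * ∏ i ∈ Finset.univ.erase c, (1 - PowerSeries.C (MvPolynomial.X i) * PowerSeries.X)
      = PowerSeries.mk (fun m => (MvPolynomial.X c : MvPolynomial (Fin r) ℤ) ^ m) := by
    have h3 := geom_series_mul (MvPolynomial.X c : MvPolynomial (Fin r) ℤ)
    linear_combination (PowerSeries.mk (fun m =>
      (MvPolynomial.X c : MvPolynomial (Fin r) ℤ) ^ m)) * h
      - (PowerSeries.mk (fun m => MvPolynomial.hsymm (Fin r) ℤ m)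
      * ∏ i ∈ Finset.univ.erase c, (1 - PowerSeries.C (MvPolynomial.X i) * PowerSeries.X)) * h3
  have h4 := congrArg (PowerSeries.coeff m) h2
  rw [prod_one_sub_series, PowerSeries.coeff_mul, PowerSeries.coeff_mk] at h4
  simp only [PowerSeries.coeff_mk] at h4
  rw [← h4, antidiagonal_hsymm_eq r m
    (fun j => (-1) ^ j * esymmOn (Finset.univ.erase c) j)]
  intro j hj
  rw [esymmOn_eq_zero, mul_zero]
  rw [Finset.card_erase_of_mem (Finset.mem_univ c), Finset.card_univ, Fintype.card_fin]
  have := c.2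
  omega

theorem sum_hkZ_esymm {r : ℕ} (m : ℕ) (hm : 0 < m) :
    ∑ j ∈ Finset.range (r + 1), hkZ r ((m : ℤ) - j) * ((-1) ^ j * MvPolynomial.esymm (Fin r) ℤ j)
      = 0 := by
  have h4 := congrArg (PowerSeries.coeff m) (hsymm_series_mul r)
  rw [prod_one_sub_series, PowerSeries.coeff_mul] at h4
  simp only [PowerSeries.coeff_mk] at h4
  rw [PowerSeries.coeff_one, if_neg hm.ne', antidiagonal_hsymm_eq (r + 1) m
    (fun j => (-1) ^ j * esymmOn Finset.univ j)] at h4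
  · exact h4
  intro j hj
  rw [esymmOn_eq_zero, mul_zero]
  rw [Finset.card_univ, Fintype.card_fin]
  omega

/-- The alternant `det (x_c ^ β_a)`. -/
def altDet {r : ℕ} (β : Fin r → ℕ) : MvPolynomial (Fin r) ℤ :=
  Matrix.det (Matrix.of fun c a : Fin r => (MvPolynomial.X c : MvPolynomial (Fin r) ℤ) ^ β a)

/-- The Jacobi-Trudi determinant with row shifts `β`. -/
def hDet {r : ℕ} (β : Fin r → ℕ) : MvPolynomial (Fin r) ℤ :=
  Matrix.det (Matrix.of fun a b : Fin r => hkZ r ((β a : ℤ) - ((r : ℤ) - 1) + (b : ℕ)))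

theorem hDet_staircase (r : ℕ) : hDet (fun a : Fin r => r - 1 - (a : ℕ)) = 1 := by
  rw [hDet, Matrix.det_of_isUpperTriangular]
  · refine Finset.prod_eq_one fun a _ => ?_
    rw [Matrix.of_apply]
    have ha := a.2
    have : ((r - 1 - (a : ℕ) : ℕ) : ℤ) - ((r : ℤ) - 1) + (a : ℕ) = 0 := by omega
    rw [this]; simp [hkZ]
  · intro a b hab
    rw [Matrix.of_apply, hkZ, if_neg]
    have ha := a.2
    have : (b : ℕ) < a := hab
    omega

theorem altDet_eq_aux {r : ℕ} (β : Fin r → ℕ) :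
    altDet β = hDet β * Matrix.det (Matrix.of fun k c : Fin r =>
      (-1) ^ (r - 1 - (k : ℕ)) * esymmOn (Finset.univ.erase c) (r - 1 - (k : ℕ))) := by
  rw [altDet, hDet, ← Matrix.det_mul, ← Matrix.det_transpose]
  congr 1
  ext1 a c
  rw [Matrix.transpose_apply, Matrix.of_apply, Matrix.mul_apply, ← sum_hkZ_esymmOn_erase c (β a),
    Finset.sum_range, ← Equiv.sum_comp Fin.revPerm]
  refine Finset.sum_congr rfl fun k _ => ?_
  have hk := k.2
  have h1 : ((Fin.revPerm k : Fin r) : ℕ) = r - 1 - (k : ℕ) := by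
    simp [Fin.val_rev]; omega
  rw [Matrix.of_apply, Matrix.of_apply, h1]
  congr 2
  omega

/-- The bialternant formula. -/
theorem altDet_eq {r : ℕ} (β : Fin r → ℕ) : altDet β = hDet β * alternant r := by
  have h := altDet_eq_aux (fun a : Fin r => r - 1 - (a : ℕ))
  rw [hDet_staircase, one_mul] at h
  rw [altDet_eq_aux, ← h]
  rfl

theorem schurP_eq_hDet {r : ℕ} (lam : Fin r → ℕ) :
    schurP lam = hDet (fun a => lam a + (r - 1 - (a : ℕ))) := by
  rw [schurP, hDet]
  congr 1
  ext1 a b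
  rw [Matrix.of_apply, Matrix.of_apply]
  congr 1
  have := a.2
  omega

theorem alternant_ne_zero (r : ℕ) : alternant r ≠ 0 := by
  intro h0
  have h2 := altDet_eq (fun a : Fin r => (a : ℕ))
  rw [h0, mul_zero] at h2
  have h3 : altDet (fun a : Fin r => (a : ℕ)) = Matrix.det (Matrix.vandermonde
    (fun c : Fin r => (MvPolynomial.X c : MvPolynomial (Fin r) ℤ))) := rfl
  rw [h3, Matrix.det_vandermonde_eq_zero_iff] at h2
  obtain ⟨i, j, hij, hne⟩ := h2
  exact hne (MvPolynomial.X_injective hij)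

theorem hsymm_mem_grassIdeal {r n : ℕ} (hrn : r ≤ n) (m : ℕ) (hm : n - r < m) :
    MvPolynomial.hsymm (Fin r) ℤ m ∈ grassIdeal r n := by
  induction m using Nat.strong_induction_on with
  | _ m ih =>
    by_cases hmn : m ≤ n
    · exact Ideal.subset_span ⟨m, ⟨hm, hmn⟩, rfl⟩
    · have h := sum_hkZ_esymm (r := r) m (by omega)
      rw [Finset.sum_range_succ'] at h
      have h0 : hkZ r ((m : ℤ) - (0 : ℕ)) = MvPolynomial.hsymm (Fin r) ℤ m := by
        rw [hkZ, if_pos (by omega)]; simp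
      rw [h0, pow_zero, one_mul, MvPolynomial.esymm_zero, mul_one, add_comm] at h
      rw [eq_neg_of_add_eq_zero_left h]
      refine neg_mem (Ideal.sum_mem _ fun j hj => Ideal.mul_mem_right _ _ ?_)
      rw [Finset.mem_range] at hj
      rw [hkZ, if_pos (by omega)]
      refine ih _ ?_ ?_ <;> omega

theorem schurP_mem_grassIdeal {r n : ℕ} (hrn : r ≤ n) (lam : Fin r → ℕ) (a : Fin r)
    (ha : (a : ℕ) = 0) (h : n - r < lam a) : schurP lam ∈ grassIdeal r n := by
  rw [← Ideal.Quotient.eq_zero_iff_mem, schurP, RingHom.map_det]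
  refine Matrix.det_eq_zero_of_row_eq_zero a fun b => ?_
  rw [RingHom.mapMatrix_apply, Matrix.map_apply, Matrix.of_apply, Ideal.Quotient.eq_zero_iff_mem,
    hkZ, if_pos (by omega)]
  exact hsymm_mem_grassIdeal hrn _ (by omega)

/-- The exponent vector `β` as a finitely supported function. -/
def expo {r : ℕ} (β : Fin r → ℕ) : Fin r →₀ ℕ := Finsupp.equivFunOnFinite.symm β

theorem expo_injective {r : ℕ} : Function.Injective (expo (r := r)) :=
  Finsupp.equivFunOnFinite.symm.injective

theorem monomial_expo {r : ℕ} (β : Fin r → ℕ) (c : ℤ) :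
    MvPolynomial.monomial (expo β) c = MvPolynomial.C c * ∏ a, MvPolynomial.X a ^ β a := by
  rw [MvPolynomial.monomial_eq, Finsupp.prod_fintype _ _ (by simp)]
  rfl

theorem altDet_eq_sum {r : ℕ} (β : Fin r → ℕ) :
    altDet β = ∑ w : Equiv.Perm (Fin r),
      MvPolynomial.monomial (expo (β ∘ w)) (Equiv.Perm.sign w : ℤ) := by
  rw [altDet, ← Matrix.det_transpose, Matrix.det_apply]
  refine Finset.sum_congr rfl fun w _ => ?_
  rw [monomial_expo]
  simp only [Matrix.transpose_apply, Matrix.of_apply, Function.comp_apply]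
  rw [Units.smul_def, zsmul_eq_mul]
  simp

theorem rename_alternant {r : ℕ} (w : Equiv.Perm (Fin r)) :
    MvPolynomial.rename w (alternant r) = MvPolynomial.C (Equiv.Perm.sign w : ℤ) * alternant r := by
  have h := Matrix.det_permute w (Matrix.of fun a b : Fin r =>
    (MvPolynomial.X a : MvPolynomial (Fin r) ℤ) ^ (r - 1 - (b : ℕ)))
  rw [alternant, AlgHom.map_det]
  convert h using 1
  · congr 1
    ext1 a b
    simp
  · simp

theorem coeff_antisymm {r : ℕ} {g : MvPolynomial (Fin r) ℤ}
    (hg : ∀ w : Equiv.Perm (Fin r),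
      MvPolynomial.rename w g = MvPolynomial.C (Equiv.Perm.sign w : ℤ) * g)
    (β : Fin r → ℕ) (w : Equiv.Perm (Fin r)) :
    MvPolynomial.coeff (expo (β ∘ w)) g
      = (Equiv.Perm.sign w : ℤ) * MvPolynomial.coeff (expo β) g := by
  have h := MvPolynomial.coeff_rename_mapDomain w w.injective g (expo (β ∘ w))
  have h2 : Finsupp.mapDomain w (expo (β ∘ w)) = expo β := by
    ext a
    obtain ⟨b, rfl⟩ := w.surjective a
    rw [Finsupp.mapDomain_apply w.injective]
    rfl
  rw [h2, hg, MvPolynomial.coeff_C_mul] at h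
  exact h.symm

theorem coeff_antisymm_eq_zero {r : ℕ} {g : MvPolynomial (Fin r) ℤ}
    (hg : ∀ w : Equiv.Perm (Fin r),
      MvPolynomial.rename w g = MvPolynomial.C (Equiv.Perm.sign w : ℤ) * g)
    (β : Fin r → ℕ) (hβ : ¬ Function.Injective β) : MvPolynomial.coeff (expo β) g = 0 := by
  rw [Function.Injective] at hβ
  push Not at hβ
  obtain ⟨a, b, hab, hne⟩ := hβ
  have h := coeff_antisymm hg β (Equiv.swap a b)
  have h2 : β ∘ Equiv.swap a b = β := by
    ext c
    rw [Function.comp_apply, Equiv.swap_apply_def]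
    split_ifs with h1 h2
    · rw [h1, hab]
    · rw [h2, hab]
    · rfl
  rw [h2, Equiv.Perm.sign_swap hne] at h
  simp at h
  omega

theorem exists_perm_strictAnti {r : ℕ} (β : Fin r → ℕ) (hβ : Function.Injective β) :
    ∃ w : Equiv.Perm (Fin r), StrictAnti (β ∘ w) := by
  refine ⟨Fin.revPerm.trans (Tuple.sort β), ?_⟩
  have h := Tuple.monotone_sort β
  have h2 : StrictMono (β ∘ Tuple.sort β) :=
    h.strictMono_of_injective (hβ.comp (Tuple.sort β).injective)
  intro a b hab
  exact h2 (Fin.rev_lt_rev.2 hab)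

theorem strictAnti_perm_unique {r : ℕ} {β β' : Fin r → ℕ} (hβ : StrictAnti β)
    (hβ' : StrictAnti β') {w w' : Equiv.Perm (Fin r)} (h : β ∘ w = β' ∘ w') :
    β = β' ∧ w = w' := by
  have h1 : β = β' ∘ (w' * w⁻¹ : Equiv.Perm (Fin r)) := by
    ext a
    have := congrFun h (w⁻¹ a)
    simpa using this
  have h2 : StrictMono (w' * w⁻¹ : Equiv.Perm (Fin r)) := by
    intro a b hab
    have := hβ hab
    rw [h1] at this
    exact hβ'.lt_iff_gt.1 this
  have h3 : (w' * w⁻¹ : Equiv.Perm (Fin r)) = 1 := by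
    have h5 := h2.range_inj (g := id) strictMono_id
    ext1 a
    refine congrFun (h5.1 ?_) a
    rw [Set.range_id]
    exact (w' * w⁻¹ : Equiv.Perm (Fin r)).surjective.range_eq
  refine ⟨by rw [h1, h3]; rfl, ?_⟩
  exact (mul_inv_eq_one.1 h3).symm

theorem eq_sum_altDet {r : ℕ} {g : MvPolynomial (Fin r) ℤ}
    (hg : ∀ w : Equiv.Perm (Fin r),
      MvPolynomial.rename w g = MvPolynomial.C (Equiv.Perm.sign w : ℤ) * g) :
    ∃ S : Finset (Fin r → ℕ), (∀ β ∈ S, StrictAnti β) ∧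
      (∀ β, StrictAnti β → MvPolynomial.coeff (expo β) g ≠ 0 → β ∈ S) ∧
      g = ∑ β ∈ S, MvPolynomial.C (MvPolynomial.coeff (expo β) g) * altDet β := by
  classical
  refine ⟨(g.support.image Finsupp.equivFunOnFinite).filter StrictAnti, fun β hβ =>
    (Finset.mem_filter.1 hβ).2, fun β hβ h0 => ?_, ?_⟩
  · rw [Finset.mem_filter]
    refine ⟨Finset.mem_image.2 ⟨expo β, MvPolynomial.mem_support_iff.2 h0, ?_⟩, hβ⟩
    simp [expo]
  · conv_lhs => rw [g.as_sum]
    symm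
    have h1 : ∀ β, MvPolynomial.C (MvPolynomial.coeff (expo β) g) * altDet β
        = ∑ w : Equiv.Perm (Fin r), MvPolynomial.monomial (expo (β ∘ w))
          (MvPolynomial.coeff (expo (β ∘ w)) g) := by
      intro β
      rw [altDet_eq_sum, Finset.mul_sum]
      refine Finset.sum_congr rfl fun w _ => ?_
      rw [MvPolynomial.C_mul_monomial, coeff_antisymm hg, mul_comm]
    simp only [h1]
    rw [← Finset.sum_product']
    refine Finset.sum_bij (fun p _ => expo (p.1 ∘ p.2)) ?_ ?_ ?_ ?_
    · rintro ⟨β, w⟩ hp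
      simp only [Finset.mem_product, Finset.mem_filter, Finset.mem_image] at hp
      obtain ⟨⟨⟨e, he, rfl⟩, _⟩, _⟩ := hp
      rw [MvPolynomial.mem_support_iff] at he ⊢
      rw [coeff_antisymm hg]
      refine mul_ne_zero (by simp) ?_
      simpa [expo] using he
    · rintro ⟨β, w⟩ hp ⟨β', w'⟩ hp' h
      simp only [Finset.mem_product, Finset.mem_filter] at hp hp'
      obtain ⟨h2, h3⟩ := strictAnti_perm_unique hp.1.2 hp'.1.2 (expo_injective h)
      exact Prod.ext h2 h3
    · intro e he
      have hinj : Function.Injective (e : Fin r → ℕ) := by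
        by_contra hcon
        rw [MvPolynomial.mem_support_iff] at he
        refine he ?_
        rw [← coeff_antisymm_eq_zero hg _ hcon]
        congr 1
        ext; rfl
      obtain ⟨w, hw⟩ := exists_perm_strictAnti _ hinj
      refine ⟨⟨e ∘ w, w⁻¹⟩, ?_, ?_⟩
      · simp only [Finset.mem_product, Finset.mem_filter, Finset.mem_image, Finset.mem_univ,
          and_true]
        refine ⟨⟨expo (e ∘ w), ?_, by simp [expo]⟩, hw⟩
        rw [MvPolynomial.mem_support_iff, coeff_antisymm hg] at *
        refine mul_ne_zero (by simp) ?_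
        convert he
        ext; rfl
      · ext a
        simp [expo]
    · rintro ⟨β, w⟩ _
      rfl

theorem symmetric_eq_sum_schurP {r : ℕ} (f : MvPolynomial (Fin r) ℤ) (hf : f.IsSymmetric) :
    ∃ S : Finset (Fin r → ℕ), (∀ ν ∈ S, Antitone ν) ∧
      f = ∑ ν ∈ S, MvPolynomial.C (schurCoeff r f ν) * schurP ν := by
  classical
  have hg : ∀ w : Equiv.Perm (Fin r), MvPolynomial.rename w (f * alternant r)
      = MvPolynomial.C (Equiv.Perm.sign w : ℤ) * (f * alternant r) := by
    intro w
    rw [map_mul, hf w, rename_alternant]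
    ring
  obtain ⟨S, hS, -, hsum⟩ := eq_sum_altDet hg
  have hback : ∀ β ∈ S, (fun a : Fin r => (β a - (r - 1 - (a : ℕ))) + (r - 1 - (a : ℕ))) = β := by
    intro β hβ
    ext a
    have key : ∀ m : ℕ, ∀ a : Fin r, r - 1 - (a : ℕ) = m → m ≤ β a := by
      intro m
      induction m with
      | zero => intro a _; exact Nat.zero_le _
      | succ m ih =>
        intro a ha
        have h1 : (a : ℕ) + 1 < r := by omega
        have h2 := ih ⟨a + 1, h1⟩ (by simp; omega)
        have h3 : β ⟨a + 1, h1⟩ < β a := hS β hβ (by simp [Fin.lt_def])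
        omega
    have := key _ a rfl
    omega
  refine ⟨S.image (fun β a => β a - (r - 1 - (a : ℕ))), ?_, ?_⟩
  · intro ν hν
    obtain ⟨β, hβ, rfl⟩ := Finset.mem_image.1 hν
    have hb := hback β hβ
    have hstep : ∀ a b : Fin r, a ≤ b → β b + (b - a : ℕ) ≤ β a := by
      intro a b
      obtain ⟨b, hb⟩ := b
      induction b with
      | zero => intro hab; have : a = ⟨0, hb⟩ := le_antisymm hab (by simp [Fin.le_def])
                rw [this]; simp
      | succ b ih =>
        intro hab
        rcases eq_or_lt_of_le hab with h | h
        · rw [h]; simp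
        · have h1 := ih (by omega) (by rw [Fin.lt_def] at h; rw [Fin.le_def]; simp at *; omega)
          have h2 : β ⟨b + 1, hb⟩ < β ⟨b, by omega⟩ := hS β hβ (by simp [Fin.lt_def])
          have h3 : (a : ℕ) ≤ b := by rw [Fin.lt_def] at h; simp at h; omega
          simp at *
          omega
    intro a b hab
    have h1 := congrFun hb a
    have h2 := congrFun hb b
    have h3 := hstep a b hab
    have h4 := a.2
    have h5 := b.2
    have h6 : (a : ℕ) ≤ b := hab
    change β b - (r - 1 - (b : ℕ)) ≤ β a - (r - 1 - (a : ℕ))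
    omega
  · refine mul_right_cancel₀ (alternant_ne_zero r) ?_
    rw [Finset.sum_image, Finset.sum_mul]
    · conv_lhs => rw [hsum]
      refine Finset.sum_congr rfl fun β hβ => ?_
      rw [schurP_eq_hDet, hback β hβ, altDet_eq, ← mul_assoc, schurCoeff, hback β hβ]
      rfl
    · intro β hβ β' hβ' h
      have h' : (fun a : Fin r => β a - (r - 1 - (a : ℕ))) = fun a => β' a - (r - 1 - (a : ℕ)) := h
      rw [← hback β hβ, ← hback β' hβ']
      ext a
      exact congrArg (· + (r - 1 - (a : ℕ))) (congrFun h' a)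

/-- The sum of the first `m` parts. -/
def partialSum {r : ℕ} (m : ℕ) (ν : Fin r → ℕ) : ℕ :=
  ∑ a ∈ Finset.univ.filter (fun a : Fin r => (a : ℕ) < m), ν a

/-- The dominance order, comparing all partial sums. -/
def DomLE {r : ℕ} (μ ν : Fin r → ℕ) : Prop := ∀ m, partialSum m μ ≤ partialSum m ν

theorem partialSum_succ {r : ℕ} (a : Fin r) (ν : Fin r → ℕ) :
    partialSum (a + 1) ν = partialSum a ν + ν a := by
  have : Finset.univ.filter (fun c : Fin r => (c : ℕ) < a + 1)
      = insert a (Finset.univ.filter (fun c : Fin r => (c : ℕ) < a)) := by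
    ext c; simp [Fin.ext_iff]; omega
  rw [partialSum, this, Finset.sum_insert (by simp), add_comm]
  rfl

theorem eq_of_partialSum_eq {r : ℕ} {μ ν : Fin r → ℕ}
    (h : ∀ m, partialSum m μ = partialSum m ν) : μ = ν := by
  ext a
  have h1 := h (a + 1)
  rw [partialSum_succ, partialSum_succ, h a] at h1
  omega

theorem DomLE.antisymm {r : ℕ} {μ ν : Fin r → ℕ} (h : DomLE μ ν) (h' : DomLE ν μ) : μ = ν :=
  eq_of_partialSum_eq fun m => le_antisymm (h m) (h' m)

theorem DomLE.trans {r : ℕ} {μ ν κ : Fin r → ℕ} (h : DomLE μ ν) (h' : DomLE ν κ) : DomLE μ κ :=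
  fun m => (h m).trans (h' m)

/-- The sum of all partial sums, a rank function for the dominance order. -/
def domRank {r : ℕ} (ν : Fin r → ℕ) : ℕ := ∑ m ∈ Finset.range (r + 1), partialSum m ν

theorem partialSum_of_le {r m : ℕ} (ν : Fin r → ℕ) (h : r ≤ m) :
    partialSum m ν = partialSum r ν := by
  unfold partialSum
  congr 1
  ext c
  simp
  omega

theorem DomLE.domRank_lt {r : ℕ} {μ ν : Fin r → ℕ} (h : DomLE μ ν) (hne : μ ≠ ν) :
    domRank μ < domRank ν := by
  refine lt_of_le_of_ne (Finset.sum_le_sum fun m _ => h m) fun heq => hne ?_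
  have h1 := (Finset.sum_eq_sum_iff_of_le (fun m _ => h m)).1 heq
  refine eq_of_partialSum_eq fun m => ?_
  rcases lt_or_ge m (r + 1) with h2 | h2
  · exact h1 m (Finset.mem_range.2 h2)
  · rw [partialSum_of_le μ (by omega), partialSum_of_le ν (by omega)]
    exact h1 r (by simp)

/-- The `b`-th column length of the diagram of `ν`. -/
def colLen {r : ℕ} (ν : Fin r → ℕ) (b : ℕ) : ℕ :=
  (Finset.univ.filter (fun a : Fin r => b < ν a)).card

theorem card_filter_val_lt {r : ℕ} (m : ℕ) :
    (Finset.univ.filter (fun a : Fin r => (a : ℕ) < m)).card = min m r := by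
  rw [← Finset.card_map Fin.valEmbedding, ← Finset.card_range (min m r)]
  congr 1
  ext x
  simp only [Finset.mem_map, Finset.mem_filter, Finset.mem_univ, true_and, Finset.mem_range,
    Fin.valEmbedding_apply]
  constructor
  · rintro ⟨a, ha, rfl⟩
    have := a.2
    omega
  · intro h
    exact ⟨⟨x, by omega⟩, by simp; omega, rfl⟩

theorem mem_diagram_iff {r : ℕ} {ν : Fin r → ℕ} (hν : Antitone ν) (a : Fin r) (b : ℕ) :
    b < ν a ↔ (a : ℕ) < colLen ν b := by
  have key : ∃ m, m ≤ r ∧ ∀ a : Fin r, b < ν a ↔ (a : ℕ) < m := by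
    by_cases h : ∃ m, ∃ hm : m < r, ν ⟨m, hm⟩ ≤ b
    · classical
      obtain ⟨hm, h2⟩ := Nat.find_spec h
      refine ⟨Nat.find h, hm.le, fun a => ⟨fun ha => ?_, fun ha => ?_⟩⟩
      · by_contra hcon
        have := hν (show (⟨Nat.find h, hm⟩ : Fin r) ≤ a by rw [Fin.le_def]; simpa using hcon)
        omega
      · by_contra hcon
        exact Nat.find_min h ha ⟨a.2, by simpa using hcon⟩
    · push Not at h
      exact ⟨r, le_rfl, fun a => ⟨fun _ => a.2, fun _ => h a a.2⟩⟩
  obtain ⟨m, hm, h⟩ := key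
  rw [h]
  have : colLen ν b = m := by
    simp only [colLen, h]
    rw [card_filter_val_lt]
    omega
  rw [this]

theorem colLen_le {r : ℕ} (ν : Fin r → ℕ) (b : ℕ) : colLen ν b ≤ r :=
  (Finset.card_le_univ _).trans (by simp)

theorem sum_min_colLen {r q : ℕ} {ν : Fin r → ℕ} (hν : Antitone ν) (hq : ∀ a, ν a ≤ q) (m : ℕ) :
    ∑ b : Fin q, min m (colLen ν b) = partialSum m ν := by
  have h1 : ∀ b : Fin q, min m (colLen ν b)
      = ∑ a ∈ Finset.univ.filter (fun a : Fin r => (a : ℕ) < m),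
          if (b : ℕ) < ν a then 1 else 0 := by
    intro b
    rw [Finset.sum_boole]
    simp only [Finset.filter_filter, mem_diagram_iff hν, ← lt_min_iff, Nat.cast_id]
    rw [card_filter_val_lt]
    have := colLen_le ν b
    omega
  simp only [h1]
  rw [Finset.sum_comm, partialSum]
  refine Finset.sum_congr rfl fun a _ => ?_
  rw [Finset.sum_boole, Nat.cast_id, card_filter_val_lt]
  exact min_eq_left (hq a)

/-- All monomials of `f` have degree at most `d` in the variables from `K`. -/
def DegOnLE {r : ℕ} (K : Finset (Fin r)) (f : MvPolynomial (Fin r) ℤ) (d : ℕ) : Prop :=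
  ∀ e ∈ f.support, ∑ a ∈ K, e a ≤ d

theorem DegOnLE.mul {r : ℕ} {K : Finset (Fin r)} {f g : MvPolynomial (Fin r) ℤ} {d e : ℕ}
    (hf : DegOnLE K f d) (hg : DegOnLE K g e) : DegOnLE K (f * g) (d + e) := by
  classical
  intro m hm
  obtain ⟨x, hx, y, hy, rfl⟩ := Finset.mem_add.1 (MvPolynomial.support_mul f g hm)
  simp only [Finsupp.add_apply, Finset.sum_add_distrib]
  exact add_le_add (hf x hx) (hg y hy)

theorem DegOnLE.sum {r : ℕ} {K : Finset (Fin r)} {ι : Type*} {S : Finset ι}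
    {f : ι → MvPolynomial (Fin r) ℤ} {d : ℕ} (hf : ∀ i ∈ S, DegOnLE K (f i) d) :
    DegOnLE K (∑ i ∈ S, f i) d := by
  classical
  intro m hm
  have := MvPolynomial.support_sum hm
  obtain ⟨i, hi, hm⟩ := Finset.mem_biUnion.1 this
  exact hf i hi m hm

theorem DegOnLE.prod {r : ℕ} {K : Finset (Fin r)} {ι : Type*} {S : Finset ι}
    {f : ι → MvPolynomial (Fin r) ℤ} {d : ι → ℕ} (hf : ∀ i ∈ S, DegOnLE K (f i) (d i)) :
    DegOnLE K (∏ i ∈ S, f i) (∑ i ∈ S, d i) := by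
  classical
  induction S using Finset.induction_on with
  | empty =>
    intro m hm
    have : m = 0 := by simpa using hm
    simp [this]
  | insert i S hi ih =>
    rw [Finset.prod_insert hi, Finset.sum_insert hi]
    exact (hf i (by simp)).mul (ih fun j hj => hf j (by simp [hj]))

theorem DegOnLE.monomial {r : ℕ} {K : Finset (Fin r)} (e : Fin r →₀ ℕ) (c : ℤ) {d : ℕ}
    (h : ∑ a ∈ K, e a ≤ d) : DegOnLE K (MvPolynomial.monomial e c) d := by
  intro m hm
  have := MvPolynomial.support_monomial_subset hm
  rw [Finset.mem_singleton] at this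
  rwa [this]

theorem degOnLE_esymm {r : ℕ} (K : Finset (Fin r)) (m : ℕ) :
    DegOnLE K (MvPolynomial.esymm (Fin r) ℤ m) (min K.card m) := by
  rw [MvPolynomial.esymm_eq_sum_monomial]
  refine DegOnLE.sum fun S hS => DegOnLE.monomial _ _ ?_
  have : ∀ a, (∑ i ∈ S, Finsupp.single i 1 : Fin r →₀ ℕ) a = if a ∈ S then 1 else 0 := by
    intro a
    simp [Finsupp.finsetSum_apply, Finsupp.single_apply]
  simp only [this]
  rw [Finset.sum_boole, Nat.cast_id]
  refine le_min (Finset.card_filter_le _ _) ?_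
  rw [← (Finset.mem_powersetCard.1 hS).2]
  exact Finset.card_le_card fun x hx => (Finset.mem_filter.1 hx).2

theorem degOnLE_alternant {r : ℕ} (m : ℕ) :
    DegOnLE (Finset.univ.filter (fun a : Fin r => (a : ℕ) < m)) (alternant r)
      (partialSum m (fun a : Fin r => r - 1 - (a : ℕ))) := by
  have : alternant r = altDet fun a : Fin r => r - 1 - (a : ℕ) := rfl
  rw [this, altDet_eq_sum]
  refine DegOnLE.sum fun w _ => DegOnLE.monomial _ _ ?_
  change ∑ a ∈ Finset.univ.filter (fun a : Fin r => (a : ℕ) < m), (r - 1 - (w a : ℕ)) ≤ _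
  have hA : Antitone fun a : Fin r => r - 1 - (a : ℕ) := by
    intro a b h
    have : (a : ℕ) ≤ b := h
    dsimp only
    omega
  have hB : Antitone fun a : Fin r => if (a : ℕ) < m then 1 else 0 := by
    intro a b h
    have : (a : ℕ) ≤ b := h
    dsimp only
    split_ifs <;> omega
  have h := (hA.monovary hB).sum_comp_perm_mul_le_sum_mul (σ := w)
  simp only [mul_ite, mul_one, mul_zero, ← Finset.sum_filter] at h
  exact h

/-- The product of the elementary symmetric polynomials of the column lengths of `ν`. -/
def esymmProd {r : ℕ} (q : ℕ) (ν : Fin r → ℕ) : MvPolynomial (Fin r) ℤ :=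
  ∏ b : Fin q, MvPolynomial.esymm (Fin r) ℤ (colLen ν b)

theorem domLE_of_schurCoeff_esymmProd {r q : ℕ} {ν : Fin r → ℕ} (hν : Antitone ν)
    (hq : ∀ a, ν a ≤ q) (κ : Fin r → ℕ) (h : schurCoeff r (esymmProd q ν) κ ≠ 0) : DomLE κ ν := by
  intro m
  have h1 := (DegOnLE.prod (K := Finset.univ.filter (fun a : Fin r => (a : ℕ) < m))
    (S := (Finset.univ : Finset (Fin q))) (fun b _ => degOnLE_esymm _ (colLen ν b))).mul
    (degOnLE_alternant m)
  have h2 := h1 _ (MvPolynomial.mem_support_iff.2 h)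
  have h3 : ∑ b : Fin q, min (Finset.univ.filter (fun a : Fin r => (a : ℕ) < m)).card (colLen ν b)
      = partialSum m ν := by
    rw [← sum_min_colLen hν hq]
    refine Finset.sum_congr rfl fun b _ => ?_
    rw [card_filter_val_lt]
    have := colLen_le ν b
    omega
  rw [h3] at h2
  simp only [Finsupp.equivFunOnFinite_symm_apply_apply, Finset.sum_add_distrib] at h2
  exact Nat.le_of_add_le_add_right h2

section PermTrace
variable {R : Type*} [CommRing R] {r : ℕ} {X Y : Type*} [Fintype X] [DecidableEq X]
  [Fintype Y] [DecidableEq Y]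

/-- The product over the cycles of `τ` of traces of products of the matrices `M x`. -/
def permTrace (τ : Equiv.Perm X) (M : X → Matrix (Fin r) (Fin r) R) : R :=
  ∑ c : X → Fin r, ∏ x, M x (c x) (c (τ x))

theorem permTrace_equiv (e : X ≃ Y) (τ : Equiv.Perm Y) (M : Y → Matrix (Fin r) (Fin r) R) :
    permTrace ((e.trans τ).trans e.symm) (M ∘ e) = permTrace τ M := by
  refine Fintype.sum_equiv (Equiv.arrowCongr e (Equiv.refl _)) _ _ fun c => ?_
  refine Fintype.prod_equiv e _ _ fun x => ?_
  simp [Equiv.arrowCongr]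

theorem permTrace_option_none (σ : Equiv.Perm X) (M : Option X → Matrix (Fin r) (Fin r) R) :
    permTrace (Equiv.Perm.decomposeOption.symm (none, σ)) M
      = (M none).trace * permTrace σ (fun x => M (some x)) := by
  rw [permTrace, permTrace, Matrix.trace, Finset.sum_mul_sum, ← Finset.sum_product',
    Finset.univ_product_univ]
  refine Fintype.sum_equiv Equiv.piOptionEquivProd _ _ fun c => ?_
  rw [Fintype.prod_option]
  simp [Equiv.piOptionEquivProd]

theorem permTrace_option_some (σ : Equiv.Perm X) (x₀ : X)
    (M : Option X → Matrix (Fin r) (Fin r) R) :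
    permTrace (Equiv.Perm.decomposeOption.symm (some (σ x₀), σ)) M
      = permTrace σ (Function.update (fun x => M (some x)) x₀ (M (some x₀) * M none)) := by
  have h : ∀ x ∈ Finset.univ.erase x₀,
      Equiv.Perm.decomposeOption.symm (some (σ x₀), σ) (some x) = some (σ x) := by
    intro x hx
    simp only [Equiv.Perm.decomposeOption_symm_apply, Equiv.Perm.coe_mul, Function.comp_apply]
    simp only [Equiv.optionCongr_apply, Option.map_some]
    rw [Equiv.swap_apply_of_ne_of_ne (by simp)]
    simpa using (Finset.mem_erase.1 hx).1
  have h0 : Equiv.Perm.decomposeOption.symm (some (σ x₀), σ) (some x₀) = none := by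
    simp
  have hn : Equiv.Perm.decomposeOption.symm (some (σ x₀), σ) none = some (σ x₀) := by
    simp
  rw [permTrace, permTrace]
  rw [Fintype.sum_equiv Equiv.piOptionEquivProd _ (fun p : Fin r × (X → Fin r) =>
    (M none p.1 (p.2 (σ x₀)) * M (some x₀) (p.2 x₀) p.1) *
      ∏ x ∈ Finset.univ.erase x₀, M (some x) (p.2 x) (p.2 (σ x)))]
  · rw [← Finset.univ_product_univ, Finset.sum_product_right]
    refine Finset.sum_congr rfl fun c _ => ?_
    dsimp only
    rw [← Finset.mul_prod_erase Finset.univ _ (Finset.mem_univ x₀), ← Finset.sum_mul,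
      Function.update_self, Matrix.mul_apply]
    congr 1
    · exact Finset.sum_congr rfl fun i _ => mul_comm _ _
    · refine Finset.prod_congr rfl fun x hx => ?_
      rw [Function.update_of_ne (Finset.mem_erase.1 hx).1]
  · intro c
    rw [Fintype.prod_option, ← Finset.mul_prod_erase Finset.univ _ (Finset.mem_univ x₀), h0, hn,
      ← mul_assoc]
    congr 1
    refine Finset.prod_congr rfl fun x hx => ?_
    rw [h x hx]
    rfl

theorem permTrace_empty [IsEmpty X] (σ : Equiv.Perm X) (M : X → Matrix (Fin r) (Fin r) R) :
    permTrace σ M = 1 := by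
  simp [permTrace]

/-- The signed or unsigned sum of all `permTrace`s. -/
def permTraceSum (χ : ℤˣ →* ℤˣ) (M : X → Matrix (Fin r) (Fin r) R) : R :=
  ∑ τ : Equiv.Perm X, (χ (Equiv.Perm.sign τ) : ℤ) • permTrace τ M

theorem permTraceSum_equiv (χ : ℤˣ →* ℤˣ) (e : X ≃ Y) (M : Y → Matrix (Fin r) (Fin r) R) :
    permTraceSum χ (M ∘ e) = permTraceSum χ M := by
  symm
  refine Fintype.sum_equiv e.permCongr.symm _ _ fun τ => ?_
  change _ = (χ (Equiv.Perm.sign ((e.trans τ).trans e.symm)) : ℤ) •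
    permTrace ((e.trans τ).trans e.symm) (M ∘ e)
  rw [permTrace_equiv, Equiv.Perm.sign_trans_trans_symm]

theorem permTraceSum_option (χ : ℤˣ →* ℤˣ) (M : Option X → Matrix (Fin r) (Fin r) R) :
    permTraceSum χ M = (M none).trace * permTraceSum χ (fun x => M (some x))
      + (χ (-1) : ℤ) • ∑ x, permTraceSum χ
        (Function.update (fun x => M (some x)) x (M (some x) * M none)) := by
  rw [permTraceSum, ← Equiv.sum_comp Equiv.Perm.decomposeOption.symm, ← Finset.univ_product_univ,
    Finset.sum_product, Fintype.sum_option]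
  congr 1
  · simp only [permTrace_option_none, permTraceSum, Finset.mul_sum, mul_smul_comm]
    simp
  · rw [Finset.sum_comm]
    simp only [permTraceSum]
    conv_rhs => rw [Finset.sum_comm, Finset.smul_sum]
    refine Finset.sum_congr rfl fun σ _ => ?_
    rw [Finset.smul_sum]
    rw [← Equiv.sum_comp σ]
    refine Finset.sum_congr rfl fun x _ => ?_
    rw [permTrace_option_some, smul_smul]
    congr 1
    have h : Equiv.Perm.sign (Equiv.Perm.decomposeOption.symm (some (σ x), σ))
        = (-1) * Equiv.Perm.sign σ := by simp
    rw [h, map_mul]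
    simp

end PermTrace

section Newton
variable {R : Type*} [CommRing R] {r : ℕ} (χ : ℤˣ →* ℤˣ) (A : Matrix (Fin r) (Fin r) R)

theorem permTraceSum_step (m i : ℕ) :
    permTraceSum χ (fun o : Option (Fin (m + 1)) => o.elim (A ^ (i + 1)) fun _ => A)
      = (A ^ (i + 1)).trace * permTraceSum χ (fun _ : Fin (m + 1) => A)
        + (χ (-1) : ℤ) • (((m + 1 : ℕ) : R) *
          permTraceSum χ (fun o : Option (Fin m) => o.elim (A ^ (i + 2)) fun _ => A)) := by
  rw [permTraceSum_option]
  congr 2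
  rw [Finset.sum_congr rfl (g := fun _ =>
    permTraceSum χ (fun o : Option (Fin m) => o.elim (A ^ (i + 2)) fun _ => A))]
  · simp
  · intro x _
    rw [← permTraceSum_equiv χ (finSuccEquiv' x)]
    congr 1
    ext1 y
    rcases eq_or_ne y x with rfl | h
    · simp [pow_succ']
    · rw [Function.update_of_ne h]
      obtain ⟨z, rfl⟩ := Fin.exists_succAbove_eq h
      simp

theorem permTraceSum_zero (i : ℕ) :
    permTraceSum χ (fun o : Option (Fin 0) => o.elim (A ^ (i + 1)) fun _ => A)
      = (A ^ (i + 1)).trace := by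
  rw [permTraceSum_option]
  simp [permTraceSum, permTrace_empty]

theorem permTraceSum_succ (m : ℕ) :
    permTraceSum χ (fun _ : Fin (m + 1) => A)
      = permTraceSum χ (fun o : Option (Fin m) => o.elim (A ^ (0 + 1)) fun _ => A) := by
  rw [← permTraceSum_equiv χ (finSuccEquiv' (0 : Fin (m + 1)))]
  congr 1
  ext1 y
  cases h : finSuccEquiv' 0 y <;> simp [h]

variable [Algebra ℝ R]

/-- The normalized sum of the `permTrace`s of `m` copies of a matrix: its `m`-th elementary
(signed sum) or complete homogeneous (unsigned sum) function. -/
def normTrace (m : ℕ) : R :=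
  ((m.factorial : ℝ)⁻¹) • permTraceSum χ (fun _ : Fin m => A)

theorem normTrace_zero : normTrace χ A 0 = 1 := by
  simp [normTrace, permTraceSum, permTrace_empty]

theorem normTrace_aux (m i : ℕ) :
    ((m.factorial : ℝ)⁻¹) • permTraceSum χ
        (fun o : Option (Fin m) => o.elim (A ^ (i + 1)) fun _ => A)
      = ∑ j ∈ Finset.range (m + 1),
        ((χ (-1) : ℤ) : R) ^ j * (A ^ (i + j + 1)).trace * normTrace χ A (m - j) := by
  induction m generalizing i with
  | zero => simp [permTraceSum_zero, normTrace_zero]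
  | succ m ih =>
    rw [permTraceSum_step, smul_add, Finset.sum_range_succ', add_comm (_ • _)]
    congr 1
    · have h := ih (i + 1)
      have h2 : (((m + 1).factorial : ℝ)⁻¹) • ((χ (-1) : ℤ) • (((m + 1 : ℕ) : R) *
          permTraceSum χ (fun o : Option (Fin m) => o.elim (A ^ (i + 2)) fun _ => A)))
          = ((χ (-1) : ℤ) : R) * (((m.factorial : ℝ)⁻¹) •
            permTraceSum χ (fun o : Option (Fin m) => o.elim (A ^ (i + 1 + 1)) fun _ => A)) := by
        have h3 : ((m + 1 : ℕ) : R) = algebraMap ℝ R ((m + 1 : ℕ) : ℝ) := by simp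
        rw [h3, ← Algebra.smul_def, zsmul_eq_mul, mul_smul_comm, smul_smul, ← mul_smul_comm]
        congr 2
        rw [Nat.factorial_succ]
        push_cast
        have : (m : ℝ) + 1 ≠ 0 := by positivity
        field_simp
      rw [h2, h, Finset.mul_sum]
      refine Finset.sum_congr rfl fun j _ => ?_
      rw [pow_succ' ((χ (-1) : ℤ) : R) j, show i + 1 + j + 1 = i + (j + 1) + 1 by ring,
        show m + 1 - (j + 1) = m - j by omega]
      ring
    · simp [normTrace]

/-- Newton's identities. -/
theorem normTrace_succ (m : ℕ) :
    ((m + 1 : ℕ) : R) * normTrace χ A (m + 1) = ∑ j ∈ Finset.range (m + 1),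
      ((χ (-1) : ℤ) : R) ^ j * (A ^ (j + 1)).trace * normTrace χ A (m - j) := by
  have h := normTrace_aux χ A m 0
  simp only [Nat.zero_add] at h
  rw [← h, normTrace, permTraceSum_succ, mul_smul_comm]
  have h3 : ((m + 1 : ℕ) : R) = algebraMap ℝ R ((m + 1 : ℕ) : ℝ) := by simp
  rw [h3, ← Algebra.smul_def, smul_smul]
  congr 1
  rw [Nat.factorial_succ]
  push_cast
  have : (m : ℝ) + 1 ≠ 0 := by positivity
  field_simp

end Newton

theorem isAddTorsionFree_of_real (M : Type*) [AddCommGroup M] [Module ℝ M] :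
    IsAddTorsionFree M where
  nsmul_right_injective n hn x y h := by
    have h2 : (n : ℝ) • x = (n : ℝ) • y := by
      rw [Nat.cast_smul_eq_nsmul, Nat.cast_smul_eq_nsmul]
      exact h
    exact smul_right_injective M (Nat.cast_ne_zero.2 hn) h2

section EH
variable {R : Type*} [CommRing R] [Algebra ℝ R] {r : ℕ} (A : Matrix (Fin r) (Fin r) R)

/-- The elementary functions `e_m` of a matrix. -/
def matE (m : ℕ) : R := normTrace (MonoidHom.id _) A m
/-- The complete homogeneous functions `h_m` of a matrix. -/
def matH (m : ℕ) : R := normTrace 1 A m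

theorem series_matH_matE :
    PowerSeries.mk (matH A) * PowerSeries.mk (fun m => (-1) ^ m * matE A m) = 1 := by
  have : IsAddTorsionFree R := isAddTorsionFree_of_real R
  set p : PowerSeries R := PowerSeries.mk fun i => (A ^ (i + 1)).trace
  have hH : PowerSeries.derivative R (PowerSeries.mk (matH A)) = p * PowerSeries.mk (matH A) := by
    ext m
    rw [PowerSeries.coeff_derivative, PowerSeries.coeff_mul,
      Finset.Nat.sum_antidiagonal_eq_sum_range_succ_mk]
    have := normTrace_succ 1 A m
    simp only [PowerSeries.coeff_mk, p, matH]
    rw [mul_comm]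
    push_cast at this
    simpa using this
  have hE : PowerSeries.derivative R (PowerSeries.mk (fun m => (-1) ^ m * matE A m))
      = - (p * PowerSeries.mk (fun m => (-1) ^ m * matE A m)) := by
    ext m
    rw [PowerSeries.coeff_derivative, map_neg,
      PowerSeries.coeff_mul, Finset.Nat.sum_antidiagonal_eq_sum_range_succ_mk]
    have := normTrace_succ (MonoidHom.id _) A m
    simp only [PowerSeries.coeff_mk, p, matE]
    push_cast at this
    rw [mul_assoc, mul_comm (normTrace _ A _), this, Finset.mul_sum, ← Finset.sum_neg_distrib]
    refine Finset.sum_congr rfl fun j hj => ?_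
    have hj' : j ≤ m := by simpa [Nat.lt_succ_iff] using hj
    obtain ⟨l, rfl⟩ := Nat.exists_eq_add_of_le hj'
    simp only [MonoidHom.id_apply, Units.val_neg, Units.val_one, Int.cast_neg, Int.cast_one,
      Nat.add_sub_cancel_left]
    rw [pow_succ, pow_add]
    have : ((-1 : R) ^ j) * (-1) ^ j = 1 := by rw [← mul_pow]; simp
    linear_combination (-(-1) ^ l * (A ^ (j + 1)).trace *
      normTrace (MonoidHom.id ℤˣ) A l) * this
  refine PowerSeries.derivative.ext ?_ ?_
  · rw [Derivation.leibniz, hH, hE]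
    simp
    ring
  · simp [matH, matE, normTrace_zero]

/-- The relation between the elementary and complete homogeneous functions of a matrix. -/
theorem sum_matH_matE (m : ℕ) (hm : 0 < m) :
    ∑ j ∈ Finset.range (m + 1), matH A (m - j) * ((-1) ^ j * matE A j) = 0 := by
  have := congrArg (PowerSeries.coeff m) (series_matH_matE A)
  rw [PowerSeries.coeff_mul, PowerSeries.coeff_one, if_neg hm.ne',
    Finset.Nat.sum_antidiagonal_eq_sum_range_succ_mk, ← Finset.sum_range_reflect] at this
  rw [← this]
  refine Finset.sum_congr rfl fun j hj => ?_
  have hj' : j ≤ m := by simpa [Nat.lt_succ_iff] using hj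
  simp only [PowerSeries.coeff_mk, show m + 1 - 1 - j = m - j by omega,
    show m - (m - j) = j by omega]

theorem trace_pow_mem_of_matE_mem (S : Subalgebra ℝ R) (hS : ∀ m, matE A m ∈ S) (i : ℕ) :
    (A ^ (i + 1)).trace ∈ S := by
  induction i using Nat.strong_induction_on with
  | _ m ih =>
    have h := normTrace_succ (MonoidHom.id _) A m
    rw [Finset.sum_range_succ, Nat.sub_self, normTrace_zero] at h
    have h1 : (-1 : R) ^ m * (A ^ (m + 1)).trace ∈ S := by
      have : (-1 : R) ^ m * (A ^ (m + 1)).trace = ((m + 1 : ℕ) : R) * matE A (m + 1)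
          - ∑ j ∈ Finset.range m, ((-1) : R) ^ j * (A ^ (j + 1)).trace * matE A (m - j) := by
        rw [matE, h]
        simp [matE]
      rw [this]
      refine sub_mem (mul_mem (natCast_mem _ _) (hS _)) (sum_mem fun j hj => ?_)
      exact mul_mem (mul_mem (pow_mem (neg_mem (one_mem _)) _) (ih j (Finset.mem_range.1 hj)))
        (hS _)
    have h2 : (A ^ (m + 1)).trace = (-1 : R) ^ m * ((-1 : R) ^ m * (A ^ (m + 1)).trace) := by
      rw [← mul_assoc, ← mul_pow]; simp
    rw [h2]
    exact mul_mem (pow_mem (neg_mem (one_mem _)) _) h1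

theorem permTrace_pow_mem (S : Subalgebra ℝ R) (hS : ∀ i, (A ^ (i + 1)).trace ∈ S)
    (X : Type) [Fintype X] [DecidableEq X] (τ : Equiv.Perm X) (e : X → ℕ) :
    permTrace τ (fun x => A ^ (e x + 1)) ∈ S := by
  revert τ e
  rename_i hX
  revert hX
  refine Fintype.induction_empty_option (P := fun X _ => ∀ [DecidableEq X] (τ : Equiv.Perm X)
    (e : X → ℕ), permTrace τ (fun x => A ^ (e x + 1)) ∈ S) ?_ ?_ ?_ X
  · intro X Y _ f h _ τ e
    classical
    let _ := Fintype.ofEquiv Y f.symm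
    rw [← permTrace_equiv f]
    convert h _ (e ∘ f)
    rfl
  · intro _ τ e
    rw [permTrace_empty]
    exact one_mem _
  · intro X _ h inst τ e
    classical
    obtain rfl : inst = fun a b => Option.instDecidableEq a b := Subsingleton.elim _ _
    obtain ⟨⟨o, σ⟩, rfl⟩ := Equiv.Perm.decomposeOption.symm.surjective τ
    cases o with
    | none =>
      rw [permTrace_option_none]
      exact mul_mem (hS _) (h _ _)
    | some y =>
      obtain ⟨x₀, rfl⟩ := σ.surjective y
      rw [permTrace_option_some]
      convert h σ (Function.update (fun x => e (some x)) x₀ (e (some x₀) + e none + 1)) using 2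
      ext1 x
      rcases eq_or_ne x x₀ with rfl | hx
      · simp only [Function.update_self]
        rw [← pow_add]
        congr 1
        ring
      · simp only [Function.update_of_ne hx]


end EH

section
open scoped TensorProduct

/-- The space of real `r × q` matrices. -/
abbrev MatV (r q : ℕ) : Type := Fin r × Fin q → ℝ
/-- Its exterior algebra. -/
abbrev ExtA (r q : ℕ) : Type := ExteriorAlgebra ℝ (MatV r q)

/-- The tensors `ι u ⊗ ι v`, which commute with one another. -/
def extGens (r q : ℕ) : Set (ExtA r q ⊗[ℝ] ExtA r q) :=
  {x | ∃ u v : MatV r q, x = ExteriorAlgebra.ι ℝ u ⊗ₜ[ℝ] ExteriorAlgebra.ι ℝ v}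

theorem extGens_comm (r q : ℕ) : ∀ x ∈ extGens r q, ∀ y ∈ extGens r q, x * y = y * x := by
  rintro _ ⟨u, v, rfl⟩ _ ⟨u', v', rfl⟩
  rw [Algebra.TensorProduct.tmul_mul_tmul, Algebra.TensorProduct.tmul_mul_tmul,
    eq_neg_of_add_eq_zero_left (ExteriorAlgebra.ι_add_mul_swap u u'),
    eq_neg_of_add_eq_zero_left (ExteriorAlgebra.ι_add_mul_swap v v'),
    TensorProduct.neg_tmul, TensorProduct.tmul_neg, neg_neg]

/-- The commutative subalgebra generated by the tensors `ι u ⊗ ι v`. -/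
def ExtC (r q : ℕ) : Type := Algebra.adjoin ℝ (extGens r q)

open scoped IsMulCommutative in
instance (r q : ℕ) : CommRing (ExtC r q) :=
  have := Algebra.isMulCommutative_adjoin ℝ (extGens_comm r q)
  inferInstanceAs (CommRing (Algebra.adjoin ℝ (extGens r q)))

instance (r q : ℕ) : Algebra ℝ (ExtC r q) :=
  inferInstanceAs (Algebra ℝ (Algebra.adjoin ℝ (extGens r q)))

/-- The inclusion of `ExtC` into the tensor square of the exterior algebra. -/
def ExtC.val (r q : ℕ) : ExtC r q →ₐ[ℝ] ExtA r q ⊗[ℝ] ExtA r q :=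
  (Algebra.adjoin ℝ (extGens r q)).val

/-- The generator `ι u ⊗ ι v`. -/
def extGen {r q : ℕ} (u v : MatV r q) : ExtC r q :=
  ⟨ExteriorAlgebra.ι ℝ u ⊗ₜ[ℝ] ExteriorAlgebra.ι ℝ v, Algebra.subset_adjoin ⟨u, v, rfl⟩⟩

section Wedge
variable {r q : ℕ} {X : Type} [Fintype X] [DecidableEq X]

/-- The wedge product of a family of vectors, as an alternating map. -/
def wedge (X : Type) [Fintype X] (r q : ℕ) : MatV r q [⋀^X]→ₗ[ℝ] ExtA r q :=
  (ExteriorAlgebra.ιMulti ℝ (Fintype.card X)).domDomCongr (Fintype.equivFin X).symm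

omit [DecidableEq X] in
theorem wedge_apply (v : X → MatV r q) : wedge X r q v
    = (List.ofFn fun i => ExteriorAlgebra.ι ℝ (v ((Fintype.equivFin X).symm i))).prod :=
  ExteriorAlgebra.ιMulti_apply _

theorem List.prod_ofFn_tmul {A : Type*} [Ring A] [Algebra ℝ A] {m : ℕ} (f g : Fin m → A) :
    (List.ofFn fun i => f i ⊗ₜ[ℝ] g i).prod = (List.ofFn f).prod ⊗ₜ[ℝ] (List.ofFn g).prod := by
  induction m with
  | zero => simp [Algebra.TensorProduct.one_def]
  | succ m ih =>
    simp only [List.ofFn_succ, List.prod_cons]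
    rw [ih, Algebra.TensorProduct.tmul_mul_tmul]

theorem val_prod_fin {m : ℕ} (z : Fin m → ExtC r q) :
    ExtC.val r q (∏ i, z i) = (List.ofFn fun i => ExtC.val r q (z i)).prod := by
  rw [← List.prod_ofFn, map_list_prod, List.map_ofFn]
  rfl

omit [DecidableEq X] in
theorem val_prod_extGen (u v : X → MatV r q) :
    ExtC.val r q (∏ x, extGen (u x) (v x)) = wedge X r q u ⊗ₜ[ℝ] wedge X r q v := by
  rw [wedge_apply, wedge_apply, ← List.prod_ofFn_tmul,
    ← Equiv.prod_comp (Fintype.equivFin X).symm, val_prod_fin]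
  rfl

/-- The standard basis vectors of the space of matrices. -/
def matUnit (p : Fin r × Fin q) : MatV r q := Pi.single p 1

/-- The wedge product of the basis vectors with row indices `c` and column indices `d`. -/
def theta (c : X → Fin r) (d : X → Fin q) : ExtA r q :=
  wedge X r q fun x => matUnit (c x, d x)

theorem theta_comp (c : X → Fin r) (d : X → Fin q) (τ : Equiv.Perm X) :
    theta (c ∘ τ) (d ∘ τ) = (Equiv.Perm.sign τ : ℤ) • theta c d := by
  have := (wedge X r q).map_perm (fun x => matUnit (c x, d x)) τ
  rw [Units.smul_def] at this
  exact this

/-- The matrix of two-forms `∑_b θ_{ab} ⊗ θ_{a'b}`. -/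
def omegaMat (r q : ℕ) : Matrix (Fin r) (Fin r) (ExtC r q) :=
  Matrix.of fun a a' => ∑ b : Fin q, extGen (matUnit (a, b)) (matUnit (a', b))

theorem val_permTrace (τ : Equiv.Perm X) :
    ExtC.val r q (permTrace τ fun _ => omegaMat r q)
      = ∑ c : X → Fin r, ∑ d : X → Fin q, theta c d ⊗ₜ[ℝ] theta (c ∘ τ) d := by
  rw [permTrace, map_sum]
  refine Finset.sum_congr rfl fun c _ => ?_
  simp only [omegaMat, Matrix.of_apply]
  rw [Finset.prod_univ_sum, map_sum, Fintype.piFinset_univ]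
  refine Finset.sum_congr rfl fun d _ => ?_
  rw [val_prod_extGen]
  rfl

open Classical in
/-- The symmetrizer element attached to two subgroups of the symmetric group. -/
def symElt (r q : ℕ) (H K : Subgroup (Equiv.Perm X)) : ExtC r q :=
  ∑ π : H, ∑ σ : K, (Equiv.Perm.sign (σ : Equiv.Perm X) : ℤ) •
    permTrace ((π : Equiv.Perm X) * (σ : Equiv.Perm X)⁻¹) fun _ => omegaMat r q

open Classical in
/-- The symmetrization of a wedge of basis vectors. -/
def symWedge (H K : Subgroup (Equiv.Perm X)) (c : X → Fin r) (d : X → Fin q) : ExtA r q :=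
  ∑ π : H, ∑ σ : K, theta (c ∘ (π : Equiv.Perm X)) (d ∘ (σ : Equiv.Perm X))

open Classical in
theorem val_symElt (H K : Subgroup (Equiv.Perm X)) :
    ExtC.val r q (symElt r q H K) = ∑ π : H, ∑ σ : K, ∑ c : X → Fin r, ∑ d : X → Fin q,
      theta c d ⊗ₜ[ℝ] theta (c ∘ (π : Equiv.Perm X)) (d ∘ (σ : Equiv.Perm X)) := by
  rw [symElt, map_sum]
  refine Finset.sum_congr rfl fun π _ => ?_
  rw [map_sum]
  refine Finset.sum_congr rfl fun σ _ => ?_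
  rw [map_zsmul, val_permTrace, Finset.smul_sum]
  refine Finset.sum_congr rfl fun c _ => ?_
  rw [Finset.smul_sum]
  refine Finset.sum_congr rfl fun d _ => ?_
  have h := theta_comp (c ∘ ((π : Equiv.Perm X) * (σ : Equiv.Perm X)⁻¹ : Equiv.Perm X)) d
    (σ : Equiv.Perm X)
  have h2 : (c ∘ ((π : Equiv.Perm X) * (σ : Equiv.Perm X)⁻¹ : Equiv.Perm X)) ∘ (σ : Equiv.Perm X)
      = c ∘ (π : Equiv.Perm X) := by
    ext x; simp
  rw [h2] at h
  rw [h, TensorProduct.tmul_smul]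

open Classical in
theorem card_smul_val_symElt (H K : Subgroup (Equiv.Perm X)) :
    ((Fintype.card H * Fintype.card K : ℕ) : ℝ) • ExtC.val r q (symElt r q H K)
      = ∑ p : (X → Fin r) × (X → Fin q), symWedge H K p.1 p.2 ⊗ₜ[ℝ] symWedge H K p.1 p.2 := by
  have h1 : ∀ p : (X → Fin r) × (X → Fin q),
      symWedge H K p.1 p.2 ⊗ₜ[ℝ] symWedge H K p.1 p.2
      = ∑ π : H, ∑ σ : K, ∑ π' : H, ∑ σ' : K,
        theta (p.1 ∘ (π : Equiv.Perm X)) (p.2 ∘ (σ : Equiv.Perm X)) ⊗ₜ[ℝ]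
        theta (p.1 ∘ (π' : Equiv.Perm X)) (p.2 ∘ (σ' : Equiv.Perm X)) := by
    intro p
    simp only [symWedge, TensorProduct.sum_tmul]
    simp only [TensorProduct.tmul_sum]
  simp only [h1]
  rw [Finset.sum_comm]
  have h2 : ∀ π : H, ∑ p : (X → Fin r) × (X → Fin q), ∑ σ : K, ∑ π' : H, ∑ σ' : K,
        theta (p.1 ∘ (π : Equiv.Perm X)) (p.2 ∘ (σ : Equiv.Perm X)) ⊗ₜ[ℝ]
        theta (p.1 ∘ (π' : Equiv.Perm X)) (p.2 ∘ (σ' : Equiv.Perm X))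
      = ∑ σ : K, ExtC.val r q (symElt r q H K) := by
    intro π
    rw [Finset.sum_comm]
    refine Finset.sum_congr rfl fun σ _ => ?_
    rw [val_symElt, Finset.sum_comm, ← Equiv.sum_comp (Equiv.mulLeft π)]
    refine Finset.sum_congr rfl fun π' _ => ?_
    rw [Finset.sum_comm, ← Equiv.sum_comp (Equiv.mulLeft σ)]
    refine Finset.sum_congr rfl fun σ' _ => ?_
    rw [← Finset.sum_product', Finset.univ_product_univ]
    refine Fintype.sum_equiv (Equiv.prodCongr
      (Equiv.arrowCongr (π : Equiv.Perm X).symm (Equiv.refl _))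
      (Equiv.arrowCongr (σ : Equiv.Perm X).symm (Equiv.refl _))) _ _ fun p => ?_
    rfl
  simp only [h2, Finset.sum_const, Finset.card_univ]
  rw [← mul_smul, Nat.cast_smul_eq_nsmul]

omit [Fintype X] in
theorem sum_theta_eq_zero_of_swap {K : Subgroup (Equiv.Perm X)} {x y : X}
    (h : Equiv.swap x y ∈ K) [Fintype K] (f : Equiv.Perm X → ExtA r q)
    (hf : ∀ σ, f (σ * Equiv.swap x y) = - f σ) : ∑ σ : K, f σ = 0 := by
  have h1 : ∑ σ : K, f σ = ∑ σ : K, f (σ * Equiv.swap x y) :=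
    (Equiv.sum_comp (Equiv.mulRight (⟨_, h⟩ : K)) fun σ : K => f σ).symm
  simp only [hf, Finset.sum_neg_distrib] at h1
  have := isAddTorsionFree_of_real (ExtA r q)
  exact self_eq_neg.1 h1

theorem theta_swap (c : X → Fin r) (d : X → Fin q) {x y : X} (hxy : x ≠ y) :
    theta (c ∘ Equiv.swap x y) (d ∘ Equiv.swap x y) = - theta c d := by
  rw [theta_comp, Equiv.Perm.sign_swap hxy]
  simp

omit [Fintype X] in
theorem comp_swap_of_eq {ι : Type*} (c : X → ι) {x y : X} (h : c x = c y) :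
    c ∘ Equiv.swap x y = c := by
  ext z
  rw [Function.comp_apply, Equiv.swap_apply_def]
  split_ifs with h1 h2
  · rw [h1, h]
  · rw [h2, h]
  · rfl

theorem exists_separating_of_symWedge_ne_zero {H K : Subgroup (Equiv.Perm X)} {c : X → Fin r}
    {d : X → Fin q} (h : symWedge H K c d ≠ 0) :
    ∃ π ∈ H, ∀ x y, x ≠ y → Equiv.swap x y ∈ K → c (π x) ≠ c (π y) := by
  classical
  obtain ⟨π, -, hπ⟩ := Finset.exists_ne_zero_of_sum_ne_zero h
  refine ⟨π, π.2, fun x y hxy hs hc => hπ ?_⟩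
  refine sum_theta_eq_zero_of_swap hs (fun σ => theta (c ∘ (π : Equiv.Perm X)) (d ∘ σ))
    fun σ => ?_
  have := theta_swap (c ∘ (π : Equiv.Perm X)) (d ∘ σ) hxy
  rw [comp_swap_of_eq (c ∘ (π : Equiv.Perm X)) hc] at this
  exact this

theorem exists_separating_of_symWedge_ne_zero' {H K : Subgroup (Equiv.Perm X)} {c : X → Fin r}
    {d : X → Fin q} (h : symWedge H K c d ≠ 0) :
    ∃ σ ∈ K, ∀ x y, x ≠ y → Equiv.swap x y ∈ H → d (σ x) ≠ d (σ y) := by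
  classical
  rw [symWedge, Finset.sum_comm] at h
  obtain ⟨σ, -, hσ⟩ := Finset.exists_ne_zero_of_sum_ne_zero h
  refine ⟨σ, σ.2, fun x y hxy hs hc => hσ ?_⟩
  refine sum_theta_eq_zero_of_swap hs (fun π => theta (c ∘ π) (d ∘ (σ : Equiv.Perm X)))
    fun π => ?_
  have := theta_swap (c ∘ π) (d ∘ (σ : Equiv.Perm X)) hxy
  rw [comp_swap_of_eq (d ∘ (σ : Equiv.Perm X)) hc] at this
  exact this

theorem sum_bot {G M : Type*} [Group G] [AddCommMonoid M] {_ : Fintype (⊥ : Subgroup G)}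
    (f : (⊥ : Subgroup G) → M) : ∑ x, f x = f 1 :=
  Fintype.sum_subsingleton f 1

theorem symElt_bot_top (m : ℕ) : symElt r q (X := Fin m) ⊥ ⊤
    = (m.factorial : ℝ) • matE (omegaMat r q) m := by
  classical
  have h0 : (m.factorial : ℝ) ≠ 0 := by positivity
  rw [matE, normTrace, smul_smul, mul_inv_cancel₀ h0, one_smul, symElt, permTraceSum]
  rw [sum_bot]
  refine Fintype.sum_equiv (Subgroup.topEquiv.toEquiv.trans (Equiv.inv _)) _ _ fun σ => ?_
  simp

theorem symElt_top_bot (m : ℕ) : symElt r q (X := Fin m) ⊤ ⊥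
    = (m.factorial : ℝ) • matH (omegaMat r q) m := by
  classical
  have h0 : (m.factorial : ℝ) ≠ 0 := by positivity
  rw [matH, normTrace, smul_smul, mul_inv_cancel₀ h0, one_smul, symElt, permTraceSum]
  refine Fintype.sum_equiv Subgroup.topEquiv.toEquiv _ _ fun π => ?_
  rw [sum_bot]
  simp

end Wedge

/-- The elementary symmetric polynomials in the algebra of symmetric polynomials. -/
def sE (r m : ℕ) : MvPolynomial.symmetricSubalgebra (Fin r) ℤ :=
  ⟨MvPolynomial.esymm (Fin r) ℤ m, MvPolynomial.esymm_isSymmetric _ _ _⟩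

/-- The complete symmetric polynomials in the algebra of symmetric polynomials. -/
def sH (r m : ℕ) : MvPolynomial.symmetricSubalgebra (Fin r) ℤ :=
  ⟨MvPolynomial.hsymm (Fin r) ℤ m, MvPolynomial.hsymm_isSymmetric _ _ _⟩

/-- `h_m` for an integer `m`. -/
def sHZ (r : ℕ) (m : ℤ) : MvPolynomial.symmetricSubalgebra (Fin r) ℤ :=
  if 0 ≤ m then sH r m.toNat else 0

theorem coe_sHZ (r : ℕ) (m : ℤ) : (sHZ r m : MvPolynomial (Fin r) ℤ) = hkZ r m := by
  unfold sHZ hkZ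
  split_ifs <;> rfl

/-- The Schur polynomials in the algebra of symmetric polynomials. -/
def sSchur {r : ℕ} (lam : Fin r → ℕ) : MvPolynomial.symmetricSubalgebra (Fin r) ℤ :=
  Matrix.det (Matrix.of fun a b : Fin r => sHZ r ((lam a : ℤ) - (a : ℕ) + (b : ℕ)))

theorem coe_sSchur {r : ℕ} (lam : Fin r → ℕ) :
    (sSchur lam : MvPolynomial (Fin r) ℤ) = schurP lam := by
  have := (MvPolynomial.symmetricSubalgebra (Fin r) ℤ).val.map_det
    (Matrix.of fun a b : Fin r => sHZ r ((lam a : ℤ) - (a : ℕ) + (b : ℕ)))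
  refine this.trans ?_
  rw [schurP]
  congr 1
  ext1 a b
  exact coe_sHZ r _

theorem sum_sH_sE (r m : ℕ) (hm : 0 < m) :
    ∑ j ∈ Finset.range (m + 1), sH r (m - j) * ((-1) ^ j * sE r j) = 0 := by
  apply Subtype.ext
  have h := sum_hkZ_esymm (r := r) m hm
  have h1 : ∑ j ∈ Finset.range (r + m + 1), hkZ r ((m : ℤ) - j) *
      ((-1) ^ j * MvPolynomial.esymm (Fin r) ℤ j) = 0 := by
    rw [← h]
    symm
    refine Finset.sum_subset (Finset.range_subset_range.2 (by omega)) fun j _ hj => ?_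
    rw [MvPolynomial.esymm, Finset.powersetCard_eq_empty.2, Finset.sum_empty, mul_zero, mul_zero]
    rw [Finset.card_univ, Fintype.card_fin]
    simpa using hj
  rw [AddSubmonoidClass.coe_finsetSum, ZeroMemClass.coe_zero, ← h1]
  refine (Finset.sum_congr rfl fun j hj => ?_).trans
    (Finset.sum_subset (Finset.range_subset_range.2 (by omega)) fun j _ hj => ?_)
  · have : j ≤ m := by simpa [Nat.lt_succ_iff] using hj
    rw [hkZ, if_pos (by omega), show ((m : ℤ) - j).toNat = m - j by omega]
    push_cast
    rfl
  · have : m < j := by simpa using hj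
    rw [hkZ, if_neg (by omega), zero_mul]

section Eval
variable {R : Type*} [CommRing R] [Algebra ℝ R] {r : ℕ} (A : Matrix (Fin r) (Fin r) R)

omit [Algebra ℝ R] in
theorem permTraceSum_id_eq (X : Type) [Fintype X] [DecidableEq X] :
    permTraceSum (MonoidHom.id _) (fun _ : X => A) = ∑ c : X → Fin r, (A.submatrix c c).det := by
  simp only [permTraceSum, permTrace, Finset.smul_sum]
  rw [Finset.sum_comm]
  refine Finset.sum_congr rfl fun c _ => ?_
  rw [← Matrix.det_transpose, Matrix.det_apply]
  refine Finset.sum_congr rfl fun τ _ => ?_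
  rw [Units.smul_def]
  rfl

theorem matE_eq_zero {m : ℕ} (hm : r < m) : matE A m = 0 := by
  rw [matE, normTrace, permTraceSum_id_eq, Finset.sum_eq_zero, smul_zero]
  intro c _
  obtain ⟨x, y, hxy, hc⟩ := Fintype.exists_ne_map_eq_of_card_lt c (by simpa)
  refine Matrix.det_zero_of_row_eq hxy ?_
  ext z
  simp [hc]

/-- Evaluation of symmetric polynomials at a matrix, sending `e_m` to the `m`-th elementary
function of the matrix. -/
def symEval : MvPolynomial.symmetricSubalgebra (Fin r) ℤ →ₐ[ℤ] R :=
  (MvPolynomial.aeval fun i : Fin r => matE A (i + 1)).comp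
    (MvPolynomial.esymmAlgEquiv (Fin r) ℤ (Fintype.card_fin r)).symm.toAlgHom

theorem symEval_sE (m : ℕ) : symEval A (sE r m) = matE A m := by
  rcases Nat.eq_zero_or_pos m with rfl | hm
  · have : sE r 0 = 1 := Subtype.ext <| by
      change MvPolynomial.esymm (Fin r) ℤ 0 = 1
      exact MvPolynomial.esymm_zero _ _
    rw [this, map_one, matE, normTrace_zero]
  rcases le_or_gt m r with h | h
  · have : sE r m = MvPolynomial.esymmAlgEquiv (Fin r) ℤ (Fintype.card_fin r)
        (MvPolynomial.X ⟨m - 1, by omega⟩) := by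
      apply Subtype.ext
      rw [MvPolynomial.esymmAlgEquiv_apply, MvPolynomial.esymmAlgHom_apply, MvPolynomial.aeval_X]
      simp only [show m - 1 + 1 = m by omega]
      rfl
    rw [this, symEval, AlgHom.comp_apply]
    simp only [AlgEquiv.coe_toAlgHom, AlgEquiv.symm_apply_apply, MvPolynomial.aeval_X,
      show m - 1 + 1 = m by omega]
  · have : sE r m = 0 := by
      apply Subtype.ext
      change MvPolynomial.esymm (Fin r) ℤ m = 0
      rw [MvPolynomial.esymm, Finset.powersetCard_eq_empty.2, Finset.sum_empty]
      rwa [Finset.card_univ, Fintype.card_fin]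
    rw [this, map_zero, matE_eq_zero A h]

theorem symEval_sH (m : ℕ) : symEval A (sH r m) = matH A m := by
  induction m using Nat.strong_induction_on with
  | _ m ih =>
    rcases Nat.eq_zero_or_pos m with rfl | hm
    · have : sH r 0 = 1 := Subtype.ext (MvPolynomial.hsymm_zero _ _)
      rw [this, map_one, matH, normTrace_zero]
    have h1 := congrArg (symEval A) (sum_sH_sE r m hm)
    have h2 := sum_matH_matE A m hm
    rw [map_sum, map_zero, Finset.sum_range_succ'] at h1
    rw [Finset.sum_range_succ'] at h2
    have h3 : ∑ j ∈ Finset.range m, symEval A (sH r (m - (j + 1)) * ((-1) ^ (j + 1) * sE r (j + 1)))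
        = ∑ j ∈ Finset.range m, matH A (m - (j + 1)) * ((-1) ^ (j + 1) * matE A (j + 1)) := by
      refine Finset.sum_congr rfl fun j hj => ?_
      rw [map_mul, map_mul, map_pow, map_neg, map_one, symEval_sE, ih _ (by omega)]
    rw [h3, ← h2] at h1
    have h4 := add_left_cancel h1
    rw [map_mul, map_mul, symEval_sE] at h4
    simpa [matE, normTrace_zero] using h4

/-- The sum of the permutations of a polynomial. -/
def symmetrize (f : MvPolynomial (Fin r) ℤ) : MvPolynomial.symmetricSubalgebra (Fin r) ℤ :=
  ⟨∑ w : Equiv.Perm (Fin r), MvPolynomial.rename w f, by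
    intro e
    rw [map_sum]
    refine Fintype.sum_equiv (Equiv.mulLeft e) _ _ fun w => ?_
    rw [MvPolynomial.rename_rename]
    rfl⟩

theorem symEval_eq_zero_of_mem {n : ℕ} (hH : ∀ m, n - r < m → matH A m = 0)
    (f : MvPolynomial.symmetricSubalgebra (Fin r) ℤ)
    (hf : (f : MvPolynomial (Fin r) ℤ) ∈ grassIdeal r n) : symEval A f = 0 := by
  rw [grassIdeal, Ideal.span, Submodule.mem_span_image_iff_exists_fun] at hf
  obtain ⟨t, ht, c, hc⟩ := hf
  have h1 : (Nat.factorial r : ℤ) • f = ∑ i : t, symmetrize (c i) * sH r i := by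
    apply Subtype.ext
    rw [AddSubmonoidClass.coe_finsetSum]
    have h2 : ((Nat.factorial r : ℤ) • f : MvPolynomial (Fin r) ℤ)
        = ∑ w : Equiv.Perm (Fin r), MvPolynomial.rename w (f : MvPolynomial (Fin r) ℤ) := by
      simp only [f.2 _, Finset.sum_const, Finset.card_univ, Fintype.card_perm, Fintype.card_fin]
      simp
    refine h2.trans ?_
    rw [← hc]
    simp only [map_sum]
    rw [Finset.sum_comm]
    refine Finset.sum_congr rfl fun i _ => ?_
    rw [MulMemClass.coe_mul, symmetrize, Finset.sum_mul]
    refine Finset.sum_congr rfl fun w _ => ?_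
    rw [smul_eq_mul, map_mul]
    congr 1
    exact MvPolynomial.hsymm_isSymmetric _ _ _ w
  have h3 := congrArg (symEval A) h1
  rw [map_zsmul, map_sum, Finset.sum_eq_zero] at h3
  · have := isAddTorsionFree_of_real R
    exact (smul_eq_zero_iff_right (by exact_mod_cast Nat.factorial_ne_zero r)).1 h3
  · intro i _
    have := (ht i.2).1
    rw [map_mul, symEval_sH, hH _ (by omega), mul_zero]

theorem symEval_sSchur_eq_zero {n : ℕ} (hrn : r ≤ n) (hH : ∀ m, n - r < m → matH A m = 0)
    {ν : Fin r → ℕ} (hν : Antitone ν) (a : Fin r) (ha : n - r < ν a) :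
    symEval A (sSchur ν) = 0 := by
  refine symEval_eq_zero_of_mem A hH _ ?_
  rw [coe_sSchur]
  have : 0 < r := a.pos
  exact schurP_mem_grassIdeal hrn ν ⟨0, this⟩ rfl (ha.trans_le (hν (Fin.mk_le_of_le_val (by simp))))

theorem symmetric_eq_sum_sSchur (f : MvPolynomial.symmetricSubalgebra (Fin r) ℤ) :
    ∃ S : Finset (Fin r → ℕ), (∀ ν ∈ S, Antitone ν) ∧
      f = ∑ ν ∈ S, schurCoeff r f ν • sSchur ν := by
  obtain ⟨S, hS, h⟩ := symmetric_eq_sum_schurP (f : MvPolynomial (Fin r) ℤ) f.2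
  refine ⟨S, hS, Subtype.ext (h.trans ?_)⟩
  rw [AddSubmonoidClass.coe_finsetSum]
  refine Finset.sum_congr rfl fun ν _ => ?_
  rw [SetLike.val_smul, coe_sSchur, MvPolynomial.smul_eq_C_mul]

/-- The values of the Schur polynomials of the partitions in the `r × q` box. -/
def boxSchurSpan (q : ℕ) : Submodule ℝ R :=
  Submodule.span ℝ {x | ∃ ν : Fin r → ℕ, Antitone ν ∧ (∀ a, ν a ≤ q) ∧ x = symEval A (sSchur ν)}

theorem symEval_mem_boxSchurSpan {n : ℕ} (hrn : r ≤ n) (hH : ∀ m, n - r < m → matH A m = 0)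
    (f : MvPolynomial.symmetricSubalgebra (Fin r) ℤ) : symEval A f ∈ boxSchurSpan A (n - r) := by
  obtain ⟨S, hS, h⟩ := symmetric_eq_sum_sSchur f
  rw [h, map_sum]
  refine sum_mem fun ν hν => ?_
  rw [map_zsmul]
  refine zsmul_mem ?_ _
  by_cases hb : ∀ a, ν a ≤ n - r
  · exact Submodule.subset_span ⟨ν, hS ν hν, hb, rfl⟩
  · push Not at hb
    obtain ⟨a, ha⟩ := hb
    rw [symEval_sSchur_eq_zero A hrn hH (hS ν hν) a ha]
    exact zero_mem _

theorem permTrace_mem_boxSchurSpan {n : ℕ} (hrn : r ≤ n) (hH : ∀ m, n - r < m → matH A m = 0)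
    (X : Type) [Fintype X] [DecidableEq X] (τ : Equiv.Perm X) :
    permTrace τ (fun _ => A) ∈ boxSchurSpan A (n - r) := by
  have h1 : permTrace τ (fun _ => A) ∈
      Algebra.adjoin ℝ ((symEval A).range : Set R) := by
    have := permTrace_pow_mem A (Algebra.adjoin ℝ ((symEval A).range : Set R))
      (trace_pow_mem_of_matE_mem A _ fun m => Algebra.subset_adjoin ⟨sE r m, symEval_sE A m⟩)
      X τ (fun _ => 0)
    simpa using this
  rw [← Subalgebra.mem_toSubmodule, Algebra.adjoin_eq_span] at h1
  refine (Submodule.span_le.2 ?_) h1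
  intro x hx
  have : Submonoid.closure ((symEval A).range : Set R) ≤ (symEval A).range.toSubmonoid :=
    Submonoid.closure_le.2 fun y hy => hy
  obtain ⟨f, rfl⟩ := this hx
  exact symEval_mem_boxSchurSpan A hrn hH f

end Eval

theorem matH_omegaMat_eq_zero {r q m : ℕ} (hm : q < m) : matH (omegaMat r q) m = 0 := by
  classical
  have h0 : (m.factorial : ℝ) ≠ 0 := by positivity
  have h1 : symElt r q (X := Fin m) ⊤ ⊥ = 0 := by
    apply Subtype.val_injective
    change ExtC.val r q _ = 0
    have h := card_smul_val_symElt (r := r) (q := q) (⊤ : Subgroup (Equiv.Perm (Fin m))) ⊥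
    rw [Finset.sum_eq_zero, smul_eq_zero] at h
    · refine h.resolve_left ?_
      have hp : ∀ (G : Type) [Group G] {_ : Fintype G}, Fintype.card G ≠ 0 :=
        fun G _ _ => Fintype.card_ne_zero
      exact_mod_cast mul_ne_zero (hp _) (hp _)
    · rintro ⟨c, d⟩ -
      by_contra hne
      have hne2 : symWedge (⊤ : Subgroup (Equiv.Perm (Fin m))) ⊥ c d ≠ 0 := by
        intro h
        simp [h] at hne
      obtain ⟨σ, -, hσ⟩ := exists_separating_of_symWedge_ne_zero' hne2
      obtain ⟨x, y, hxy, hc⟩ := Fintype.exists_ne_map_eq_of_card_lt (d ∘ σ) (by simpa)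
      exact hσ x y hxy trivial hc
  rw [symElt_top_bot] at h1
  exact (smul_eq_zero.1 h1).resolve_left h0

section Stab
variable {X P : Type}

/-- The permutations preserving the fibres of a map. -/
def fiberPerm (ρ : X → P) : Subgroup (Equiv.Perm X) where
  carrier := {π | ∀ x, ρ (π x) = ρ x}
  one_mem' _ := rfl
  mul_mem' ha hb x := (ha _).trans (hb x)
  inv_mem' {a} ha x := by
    have := ha (a⁻¹ x)
    rw [← Equiv.Perm.mul_apply, mul_inv_cancel] at this
    exact this.symm

theorem swap_mem_fiberPerm [DecidableEq X] {ρ : X → P} {x y : X} (h : ρ x = ρ y) :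
    Equiv.swap x y ∈ fiberPerm ρ := by
  intro z
  exact congrFun (comp_swap_of_eq ρ h) z

theorem fiberPerm_of_injective {ρ : X → P} (h : Function.Injective ρ) : fiberPerm ρ = ⊥ :=
  (Subgroup.eq_bot_iff_forall _).2 fun _ hπ => Equiv.ext fun x => h (hπ x)

theorem fiberPerm_const (p : P) : fiberPerm (fun _ : X => p) = ⊤ :=
  (Subgroup.eq_top_iff' _).2 fun _ _ => rfl

end Stab

section Sigma
variable {J : Type} [Fintype J] [DecidableEq J] {X : J → Type} [∀ j, Fintype (X j)]
  [∀ j, DecidableEq (X j)] {P : J → Type}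

omit [Fintype J] [DecidableEq J] [∀ j, Fintype (X j)] [∀ j, DecidableEq (X j)] in
theorem sigmaCongrRight_mem_fiberPerm (ρ : ∀ j, X j → P j) (π : ∀ j, fiberPerm (ρ j)) :
    Equiv.Perm.sigmaCongrRight (fun j => (π j : Equiv.Perm (X j)))
      ∈ fiberPerm (Sigma.map id ρ) := by
  rintro ⟨j, x⟩
  exact congrArg (Sigma.mk j) ((π j).2 x)

omit [Fintype J] [DecidableEq J] [∀ j, DecidableEq (X j)] in
theorem sigmaCongrRight_fiberPerm_bijective (ρ : ∀ j, X j → P j) :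
    Function.Bijective fun π : (∀ j, fiberPerm (ρ j)) =>
      (⟨_, sigmaCongrRight_mem_fiberPerm ρ π⟩ : fiberPerm (Sigma.map id ρ)) := by
  constructor
  · intro π π' h
    have h2 := Equiv.Perm.sigmaCongrRightHom_injective (β := X)
      (a₁ := fun j => (π j : Equiv.Perm (X j))) (a₂ := fun j => (π' j : Equiv.Perm (X j)))
      (Subtype.ext_iff.1 h)
    ext1 j
    exact Subtype.ext (congrFun h2 j)
  · rintro ⟨π, hπ⟩
    have h1 : ∀ j (x : X j), ∃ y : X j, π ⟨j, x⟩ = ⟨j, y⟩ ∧ ρ j y = ρ j x := by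
      intro j x
      have h := hπ ⟨j, x⟩
      rcases hy : π ⟨j, x⟩ with ⟨j', y⟩
      rw [hy] at h
      simp only [Sigma.map, id, Sigma.mk.injEq] at h
      obtain ⟨rfl, h⟩ := h
      exact ⟨y, rfl, eq_of_heq h⟩
    choose f hf hf' using h1
    have hinj : ∀ j, Function.Injective (f j) := by
      intro j x y h
      have : π ⟨j, x⟩ = π ⟨j, y⟩ := by rw [hf, hf, h]
      simpa using π.injective this
    refine ⟨fun j => ⟨Equiv.ofBijective (f j) ((Finite.injective_iff_bijective).1 (hinj j)),
      hf' j⟩, ?_⟩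
    ext ⟨j, x⟩ : 2
    exact (hf j x).symm

theorem sign_sigmaCongrRight (τ : ∀ j, Equiv.Perm (X j)) :
    Equiv.Perm.sign (Equiv.Perm.sigmaCongrRight τ) = ∏ j, Equiv.Perm.sign (τ j) := by
  have h : Equiv.Perm.sign.comp (Equiv.Perm.sigmaCongrRightHom X)
      = ∏ j, Equiv.Perm.sign.comp (Pi.evalMonoidHom (fun j => Equiv.Perm (X j)) j) := by
    refine MonoidHom.pi_ext fun j σ => ?_
    rw [MonoidHom.finsetProd_apply, Finset.prod_eq_single j]
    · induction σ using Equiv.Perm.swap_induction_on with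
      | one => simp
      | swap_mul σ x y hxy ih =>
        rw [Pi.mulSingle_mul, map_mul, map_mul, ih]
        congr 1
        have h1 : Equiv.Perm.sigmaCongrRightHom X (Pi.mulSingle j (Equiv.swap x y))
            = Equiv.swap ⟨j, x⟩ ⟨j, y⟩ := by
          ext1 ⟨j', z⟩
          change Sigma.mk j'
            (Pi.mulSingle (M := fun j => Equiv.Perm (X j)) j (Equiv.swap x y) j' z) = _
          by_cases hj : j' = j
          · subst hj
            simp only [Pi.mulSingle_eq_same, Equiv.swap_apply_def, Sigma.mk.injEq, true_and,
              heq_eq_eq]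
            split_ifs <;> rfl
          · simp [Equiv.swap_apply_def, hj]
        rw [MonoidHom.comp_apply, h1, Equiv.Perm.sign_swap (by simpa using hxy)]
        simp [Equiv.Perm.sign_swap hxy]
    · intro j' _ hj
      simp [Pi.mulSingle_eq_of_ne hj]
    · simp
  have h2 := DFunLike.congr_fun h τ
  rw [MonoidHom.finsetProd_apply] at h2
  exact h2

theorem prod_permTrace {R : Type*} [CommRing R] {r : ℕ} (A : Matrix (Fin r) (Fin r) R)
    (τ : ∀ j, Equiv.Perm (X j)) :
    ∏ j, permTrace (τ j) (fun _ => A) = permTrace (Equiv.Perm.sigmaCongrRight τ) fun _ => A := by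
  simp only [permTrace]
  rw [Finset.prod_univ_sum, Fintype.piFinset_univ]
  refine Fintype.sum_equiv (Equiv.piCurry fun _ _ => Fin r).symm _ _ fun c => ?_
  rw [Fintype.prod_sigma]
  rfl

theorem prod_symElt {r q : ℕ} {P' : J → Type} (ρ : ∀ j, X j → P j) (γ : ∀ j, X j → P' j) :
    ∏ j, symElt r q (fiberPerm (ρ j)) (fiberPerm (γ j))
      = symElt r q (fiberPerm (Sigma.map id ρ)) (fiberPerm (Sigma.map id γ)) := by
  classical
  simp only [symElt]
  rw [Finset.prod_univ_sum, Fintype.piFinset_univ]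
  refine Fintype.sum_equiv (Equiv.ofBijective _ (sigmaCongrRight_fiberPerm_bijective ρ)) _ _
    fun π => ?_
  rw [Finset.prod_univ_sum, Fintype.piFinset_univ]
  refine Fintype.sum_equiv (Equiv.ofBijective _ (sigmaCongrRight_fiberPerm_bijective γ)) _ _
    fun σ => ?_
  have h1 : ∀ j, (Equiv.Perm.sign (σ j : Equiv.Perm (X j)) : ℤ) •
      permTrace ((π j : Equiv.Perm (X j)) * (σ j : Equiv.Perm (X j))⁻¹) (fun _ => omegaMat r q)
      = ((Equiv.Perm.sign (σ j : Equiv.Perm (X j)) : ℤ) : ExtC r q) *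
      permTrace ((π j : Equiv.Perm (X j)) * (σ j : Equiv.Perm (X j))⁻¹)
        (fun _ => omegaMat r q) := fun j => zsmul_eq_mul _ _
  simp only [h1]
  rw [Finset.prod_mul_distrib, prod_permTrace, zsmul_eq_mul]
  congr 1
  change _ = ((Equiv.Perm.sign (Equiv.Perm.sigmaCongrRight
    fun j => (σ j : Equiv.Perm (X j))) : ℤ) : ExtC r q)
  rw [sign_sigmaCongrRight]
  push_cast
  rfl

end Sigma

section Ell
variable {r q : ℕ}

/-- The coordinate functional on the exterior algebra given by a set of basis vectors. -/
def ell (D : Finset (Fin r × Fin q)) : ExtA r q →ₗ[ℝ] ℝ :=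
  ExteriorAlgebra.liftAlternating fun i =>
    if h : i = D.card then
      (Matrix.detRowAlternating (n := Fin i) (R := ℝ)).compLinearMap
        (LinearMap.funLeft ℝ ℝ fun x : Fin i => (D.equivFin.symm (Fin.cast h x) : Fin r × Fin q))
    else 0

theorem ell_ιMulti (D : Finset (Fin r × Fin q)) (v : Fin D.card → MatV r q) :
    ell D (ExteriorAlgebra.ιMulti ℝ _ v)
      = Matrix.det (Matrix.of fun x y => v x (D.equivFin.symm y)) := by
  rw [ell, ExteriorAlgebra.liftAlternating_apply_ιMulti, dif_pos rfl]
  rfl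

theorem ell_ιMulti_of_ne (D : Finset (Fin r × Fin q)) {m : ℕ} (h : m ≠ D.card)
    (v : Fin m → MatV r q) : ell D (ExteriorAlgebra.ιMulti ℝ _ v) = 0 := by
  rw [ell, ExteriorAlgebra.liftAlternating_apply_ιMulti, dif_neg h]
  rfl

variable {X : Type} [Fintype X] [DecidableEq X]

omit [DecidableEq X] in
theorem wedge_eq_ιMulti (v : X → MatV r q) : wedge X r q v
    = ExteriorAlgebra.ιMulti ℝ (Fintype.card X) (v ∘ (Fintype.equivFin X).symm) := rfl

omit [DecidableEq X] in
theorem exists_equiv_of_ell_theta_ne_zero {D : Finset (Fin r × Fin q)} {c : X → Fin r}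
    {d : X → Fin q} (h : ell D (theta c d) ≠ 0) : ∃ e : X ≃ D, ∀ x, (c x, d x) = e x := by
  rw [theta, wedge_eq_ιMulti] at h
  have hc : Fintype.card X = D.card := by
    by_contra hne
    exact h (ell_ιMulti_of_ne D hne _)
  obtain ⟨e₀, he₀⟩ : ∃ e₀ : X ≃ Fin D.card, ell D (ExteriorAlgebra.ιMulti ℝ D.card
      ((fun x => matUnit (c x, d x)) ∘ e₀.symm)) ≠ 0 := by
    obtain ⟨e₀, he₀⟩ : ∃ e₀ : X ≃ Fin (Fintype.card X), ell D (ExteriorAlgebra.ιMulti ℝ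
        (Fintype.card X) ((fun x => matUnit (c x, d x)) ∘ e₀.symm)) ≠ 0 := ⟨_, h⟩
    revert e₀
    rw [hc]
    exact fun e₀ he₀ => ⟨e₀, he₀⟩
  rw [ell_ιMulti, Matrix.det_apply] at he₀
  obtain ⟨σ, -, hσ⟩ := Finset.exists_ne_zero_of_sum_ne_zero he₀
  refine ⟨e₀.trans (σ⁻¹.trans D.equivFin.symm), fun x => ?_⟩
  by_contra hx
  refine hσ ?_
  rw [Finset.prod_eq_zero (i := σ⁻¹ (e₀ x)) (Finset.mem_univ _), smul_zero]
  have h1 : σ (σ⁻¹ (e₀ x)) = e₀ x := by rw [← Equiv.Perm.mul_apply, mul_inv_cancel]; rfl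
  simp only [Matrix.of_apply, Function.comp_apply, h1, Equiv.symm_apply_apply, matUnit]
  exact Pi.single_eq_of_ne (fun h => hx h.symm) _

omit [DecidableEq X] in
theorem ell_theta_ne_zero {D : Finset (Fin r × Fin q)} {c : X → Fin r}
    {d : X → Fin q} (e : X ≃ D) (he : ∀ x, (c x, d x) = e x) : ell D (theta c d) ≠ 0 := by
  have hc : Fintype.card X = D.card := by
    rw [Fintype.card_congr e, Fintype.card_coe]
  rw [theta, wedge_eq_ιMulti]
  have key : ∀ (e₀ : X ≃ Fin D.card), ell D (ExteriorAlgebra.ιMulti ℝ D.card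
      ((fun x => matUnit (c x, d x)) ∘ e₀.symm)) ≠ 0 := by
    intro e₀
    rw [ell_ιMulti]
    set τ : Equiv.Perm (Fin D.card) := (e₀.symm.trans e).trans D.equivFin with hτ
    have : (Matrix.of fun x y => ((fun x => matUnit (c x, d x)) ∘ e₀.symm) x
        (D.equivFin.symm y : Fin r × Fin q)) = (1 : Matrix _ _ ℝ).submatrix τ id := by
      ext x y
      simp only [Matrix.of_apply, Function.comp_apply, matUnit, Matrix.submatrix_apply, id,
        Matrix.one_apply, Pi.single_apply, he]
      refine if_congr ?_ rfl rfl
      rw [← Subtype.ext_iff, Equiv.symm_apply_eq, eq_comm, hτ]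
      rfl
    rw [this, Matrix.det_permute, Matrix.det_one, mul_one]
    exact_mod_cast Int.isUnit_iff.1 (Equiv.Perm.sign τ).isUnit |>.elim
      (by simp +contextual) (by simp +contextual)
  revert key
  rw [← hc]
  exact fun key => key _

/-- The functional `ℓ ⊗ ℓ` on `ExtC`. -/
def ellSq (D : Finset (Fin r × Fin q)) : ExtC r q →ₗ[ℝ] ℝ :=
  (LinearMap.mul' ℝ ℝ ∘ₗ TensorProduct.map (ell D) (ell D)) ∘ₗ (ExtC.val r q).toLinearMap

theorem ellSq_symElt (D : Finset (Fin r × Fin q)) (H K : Subgroup (Equiv.Perm X)) :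
    ∃ C : ℝ, 0 < C ∧ C * ellSq D (symElt r q H K)
      = ∑ p : (X → Fin r) × (X → Fin q), ell D (symWedge H K p.1 p.2) ^ 2 := by
  classical
  have hp : ∀ (G : Type) [Group G] {_ : Fintype G}, Fintype.card G ≠ 0 :=
    fun G _ _ => Fintype.card_ne_zero
  have h := congrArg (LinearMap.mul' ℝ ℝ ∘ₗ TensorProduct.map (ell D) (ell D))
    (card_smul_val_symElt (r := r) (q := q) H K)
  rw [map_smul, map_sum] at h
  refine ⟨_, ?_, h.trans ?_⟩
  · exact_mod_cast Nat.pos_of_ne_zero (mul_ne_zero (hp _) (hp _))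
  · refine Finset.sum_congr rfl fun p _ => ?_
    rw [LinearMap.comp_apply, TensorProduct.map_tmul, LinearMap.mul'_apply, sq]

theorem ellSq_symElt_ne_zero_iff {D : Finset (Fin r × Fin q)} {H K : Subgroup (Equiv.Perm X)} :
    ellSq D (symElt r q H K) ≠ 0 ↔ ∃ c d, ell D (symWedge H K c d) ≠ 0 := by
  obtain ⟨C, hC, h⟩ := ellSq_symElt (r := r) (q := q) D H K
  have h1 : ellSq D (symElt r q H K) = 0 ↔
      ∑ p : (X → Fin r) × (X → Fin q), ell D (symWedge H K p.1 p.2) ^ 2 = 0 := by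
    rw [← h]
    simp [hC.ne']
  rw [Ne, h1, Finset.sum_eq_zero_iff_of_nonneg fun _ _ => sq_nonneg _]
  simp

theorem exists_ell_theta_ne_zero {D : Finset (Fin r × Fin q)} {H K : Subgroup (Equiv.Perm X)}
    {c : X → Fin r} {d : X → Fin q} (h : ell D (symWedge H K c d) ≠ 0) :
    ∃ π ∈ H, ∃ σ ∈ K, ∃ e : X ≃ D, ∀ x, (c (π x), d (σ x)) = e x := by
  classical
  rw [symWedge, map_sum] at h
  obtain ⟨π, -, h⟩ := Finset.exists_ne_zero_of_sum_ne_zero h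
  rw [map_sum] at h
  obtain ⟨σ, -, h⟩ := Finset.exists_ne_zero_of_sum_ne_zero h
  exact ⟨π, π.2, σ, σ.2, exists_equiv_of_ell_theta_ne_zero h⟩

theorem ellSq_symElt_ne_zero {D : Finset (Fin r × Fin q)} {H K : Subgroup (Equiv.Perm X)}
    {c : X → Fin r} {d : X → Fin q} (hc : ∀ π ∈ H, ∀ x, c (π x) = c x)
    (hd : ∀ σ ∈ K, ∀ x, d (σ x) = d x) (e : X ≃ D) (he : ∀ x, (c x, d x) = e x) :
    ellSq D (symElt r q H K) ≠ 0 := by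
  classical
  have hp : ∀ (G : Type) [Group G] {_ : Fintype G}, Fintype.card G ≠ 0 :=
    fun G _ _ => Fintype.card_ne_zero
  refine ellSq_symElt_ne_zero_iff.2 ⟨c, d, ?_⟩
  have h1 : ∀ (π : H) (σ : K), theta (c ∘ (π : Equiv.Perm X)) (d ∘ (σ : Equiv.Perm X))
      = theta c d := fun π σ => by
    rw [show c ∘ (π : Equiv.Perm X) = c from funext (hc π π.2),
      show d ∘ (σ : Equiv.Perm X) = d from funext (hd σ σ.2)]
  simp only [symWedge, h1, Finset.sum_const, map_nsmul, Finset.card_univ]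
  exact smul_ne_zero (hp _) (smul_ne_zero (hp _) (ell_theta_ne_zero e he))

end Ell

/-- The diagram of a partition in the `r × q` box. -/
def diagram {r : ℕ} (q : ℕ) (ν : Fin r → ℕ) : Finset (Fin r × Fin q) :=
  Finset.univ.filter fun p => (p.2 : ℕ) < ν p.1

theorem mem_diagram {r q : ℕ} {ν : Fin r → ℕ} {p : Fin r × Fin q} :
    p ∈ diagram q ν ↔ (p.2 : ℕ) < ν p.1 := by simp [diagram]

theorem card_diagram_row_lt {r q : ℕ} {ν : Fin r → ℕ} (hν : ∀ a, ν a ≤ q) (k : ℕ) :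
    ((diagram q ν).filter fun p => (p.1 : ℕ) < k).card = partialSum k ν := by
  rw [Finset.card_eq_sum_card_fiberwise (f := Prod.fst)
    (t := Finset.univ.filter fun a : Fin r => (a : ℕ) < k) (by
      intro p hp
      simpa using (Finset.mem_filter.1 hp).2), partialSum]
  refine Finset.sum_congr rfl fun a ha => ?_
  have h1 := card_filter_val_lt (r := q) (ν a)
  rw [min_eq_left (hν a)] at h1
  rw [← h1]
  refine Finset.card_bij' (fun p _ => p.2) (fun b _ => (a, b)) ?_ ?_ ?_ ?_
  · intro p hp
    simp only [Finset.mem_filter, mem_diagram, Finset.mem_univ, true_and] at hp ⊢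
    rw [← hp.2]
    exact hp.1.1
  · intro b hb
    simp only [Finset.mem_filter, mem_diagram, Finset.mem_univ, true_and] at hb ha ⊢
    exact ⟨⟨hb, ha⟩, trivial⟩
  · intro p hp
    simp only [Finset.mem_filter] at hp
    rw [← hp.2]
  · intro b _
    rfl

theorem card_diagram_col {r q : ℕ} (ν : Fin r → ℕ) (b : Fin q) :
    ((diagram q ν).filter fun p => p.2 = b).card = colLen ν b := by
  refine Finset.card_bij' (fun p _ => p.1) (fun a _ => (a, b)) ?_ ?_ ?_ ?_
  · intro p hp
    simp only [Finset.mem_filter, mem_diagram, Finset.mem_univ, true_and] at hp ⊢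
    rw [← hp.2]
    exact hp.1
  · intro a ha
    simp only [Finset.mem_filter, mem_diagram, Finset.mem_univ, true_and] at ha ⊢
    exact ⟨ha, trivial⟩
  · intro p hp
    simp only [Finset.mem_filter] at hp
    rw [← hp.2]
  · intro a _
    rfl

section Count
variable {X : Type} [Fintype X] {r q : ℕ}

theorem card_lt_le_sum_min (f : X → ℕ) (g : X → Fin q)
    (h : ∀ x y, f x = f y → g x = g y → x = y) (k : ℕ) :
    (Finset.univ.filter fun x => f x < k).card
      ≤ ∑ b, min k (Finset.univ.filter fun x => g x = b).card := by
  rw [Finset.card_eq_sum_card_fiberwise (f := g) (t := Finset.univ) (by simp)]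
  refine Finset.sum_le_sum fun b _ => le_min ?_ ?_
  · refine (Finset.card_le_card_of_injOn f (t := Finset.range k) ?_ ?_).trans_eq
      (Finset.card_range k)
    · intro x hx
      simp only [Finset.coe_filter, Finset.mem_filter, Finset.mem_univ, true_and,
        Set.mem_ofPred_eq] at hx
      simpa using hx.1
    · intro x hx y hy hxy
      simp only [Finset.coe_filter, Finset.mem_filter, Finset.mem_univ, true_and,
        Set.mem_ofPred_eq] at hx hy
      exact h x y hxy (hx.2.trans hy.2.symm)
  · refine Finset.card_le_card fun x hx => ?_
    simp only [Finset.mem_filter, Finset.mem_univ, true_and] at hx ⊢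
    exact hx.2

theorem card_filter_comp_perm (π : Equiv.Perm X) (p : X → Prop) [DecidablePred p] :
    (Finset.univ.filter fun x => p (π x)).card = (Finset.univ.filter p).card :=
  Finset.card_equiv π fun x => by simp

theorem card_filter_equiv {D : Finset (Fin r × Fin q)} (e : X ≃ D) (p : Fin r × Fin q → Prop)
    [DecidablePred p] : (Finset.univ.filter fun x => p (e x)).card = (D.filter p).card := by
  refine Finset.card_bij (fun x _ => (e x : Fin r × Fin q)) ?_ ?_ ?_
  · intro x hx
    simp only [Finset.mem_filter, Finset.mem_univ, true_and] at hx ⊢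
    exact ⟨(e x).2, hx⟩
  · intro x _ y _ h
    exact e.injective (Subtype.ext h)
  · intro y hy
    rw [Finset.mem_filter] at hy
    exact ⟨e.symm ⟨y, hy.1⟩, by simpa using hy.2, by simp⟩

variable [DecidableEq X] {P : Type} {μ : Fin r → ℕ} {c : X → Fin r} {d : X → Fin q}

theorem partialSum_le_of_ell_ne_zero (hμ : ∀ a, μ a ≤ q) {ρ : X → P} {γ : X → Fin q}
    (h : ell (diagram q μ) (symWedge (fiberPerm ρ) (fiberPerm γ) c d) ≠ 0) (k : ℕ) :
    partialSum k μ ≤ ∑ b, min k (Finset.univ.filter fun x => γ x = b).card := by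
  obtain ⟨π, -, σ, -, e, he⟩ := exists_ell_theta_ne_zero h
  have h0 : symWedge (fiberPerm ρ) (fiberPerm γ) c d ≠ 0 := fun h0 => h (by rw [h0, map_zero])
  obtain ⟨π', -, hπ'⟩ := exists_separating_of_symWedge_ne_zero h0
  refine le_of_eq_of_le ?_ (card_lt_le_sum_min (fun x => (c (π' x) : ℕ)) γ ?_ k)
  · rw [card_filter_comp_perm π' fun x => (c x : ℕ) < k,
      ← card_filter_comp_perm π fun x => (c x : ℕ) < k, ← card_diagram_row_lt hμ,
      ← card_filter_equiv e fun p => (p.1 : ℕ) < k]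
    congr 1
    ext x
    simp only [Finset.mem_filter, Finset.mem_univ, true_and, ← he]
  · intro x y hc hγ
    by_contra hxy
    exact hπ' x y hxy (swap_mem_fiberPerm hγ) (Fin.ext hc)

theorem le_partialSum_of_ell_ne_zero (hμ' : Antitone μ) (hμ : ∀ a, μ a ≤ q) {ρ : X → Fin r}
    {γ : X → P} (h : ell (diagram q μ) (symWedge (fiberPerm ρ) (fiberPerm γ) c d) ≠ 0) (k : ℕ) :
    (Finset.univ.filter fun x => (ρ x : ℕ) < k).card ≤ partialSum k μ := by
  obtain ⟨π, -, σ, -, e, he⟩ := exists_ell_theta_ne_zero h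
  have h0 : symWedge (fiberPerm ρ) (fiberPerm γ) c d ≠ 0 := fun h0 => h (by rw [h0, map_zero])
  obtain ⟨σ', -, hσ'⟩ := exists_separating_of_symWedge_ne_zero' h0
  refine (card_lt_le_sum_min (fun x => (ρ x : ℕ)) (fun x => d (σ' x)) ?_ k).trans_eq ?_
  · intro x y hc hγ
    by_contra hxy
    exact hσ' x y hxy (swap_mem_fiberPerm (Fin.ext hc)) hγ
  · rw [← sum_min_colLen hμ' hμ]
    refine Finset.sum_congr rfl fun b _ => ?_
    rw [card_filter_comp_perm σ' fun x => d x = b, ← card_filter_comp_perm σ fun x => d x = b,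
      ← card_diagram_col, ← card_filter_equiv e fun p => p.2 = b]
    congr 2
    ext x
    simp only [Finset.mem_filter, Finset.mem_univ, true_and, ← he]

end Count

/-- Membership in the set of partitions whose diagram lies in the `r × q` box. -/
def IsBox {r : ℕ} (q : ℕ) (ν : Fin r → ℕ) : Prop := Antitone ν ∧ ∀ a, ν a ≤ q

section Products
variable {r q : ℕ}

theorem card_sigma_fst {J : Type} [Fintype J] [DecidableEq J] (m : J → ℕ) (b : J) :
    (Finset.univ.filter fun x : Σ j, Fin (m j) => x.1 = b).card = m b := by
  conv_rhs => rw [← Fintype.card_fin (m b)]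
  rw [← Finset.card_univ]
  symm
  refine Finset.card_bij (fun i _ => ⟨b, i⟩) (by simp) (by simp) ?_
  rintro ⟨j, i⟩ h
  simp only [Finset.mem_filter, Finset.mem_univ, true_and] at h
  subst h
  exact ⟨i, by simp, rfl⟩

theorem prod_matE {J : Type} [Fintype J] [DecidableEq J] (m : J → ℕ) :
    ∃ C : ℝ, C ≠ 0 ∧ ∏ j, matE (omegaMat r q) (m j)
      = C • symElt r q (X := Σ j, Fin (m j)) (fiberPerm id) (fiberPerm Sigma.fst) := by
  refine ⟨∏ j, ((m j).factorial : ℝ)⁻¹, Finset.prod_ne_zero_iff.2 fun j _ => by positivity, ?_⟩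
  have h1 : ∀ j, matE (omegaMat r q) (m j) = ((m j).factorial : ℝ)⁻¹ •
      symElt r q (X := Fin (m j)) (fiberPerm id) (fiberPerm fun _ => ()) := by
    intro j
    have h0 : ((m j).factorial : ℝ) ≠ 0 := by positivity
    rw [fiberPerm_of_injective Function.injective_id, fiberPerm_const, symElt_bot_top, smul_smul,
      inv_mul_cancel₀ h0, one_smul]
  have h2 : fiberPerm (Sigma.fst : (Σ j, Fin (m j)) → J)
      = fiberPerm (Sigma.map id (fun j (_ : Fin (m j)) => ()) :
        (Σ j, Fin (m j)) → Σ _ : J, Unit) := by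
    ext π
    refine forall_congr' fun x => ?_
    simp [Sigma.map]
  simp only [h1]
  rw [Finset.prod_smul, prod_symElt, h2, fiberPerm_of_injective Function.injective_id,
    fiberPerm_of_injective (Function.injective_id.sigma_map fun j => Function.injective_id)]

theorem prod_matH {J : Type} [Fintype J] [DecidableEq J] (m : J → ℕ) :
    ∃ C : ℝ, C ≠ 0 ∧ ∏ j, matH (omegaMat r q) (m j)
      = C • symElt r q (X := Σ j, Fin (m j)) (fiberPerm Sigma.fst) (fiberPerm id) := by
  refine ⟨∏ j, ((m j).factorial : ℝ)⁻¹, Finset.prod_ne_zero_iff.2 fun j _ => by positivity, ?_⟩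
  have h1 : ∀ j, matH (omegaMat r q) (m j) = ((m j).factorial : ℝ)⁻¹ •
      symElt r q (X := Fin (m j)) (fiberPerm fun _ => ()) (fiberPerm id) := by
    intro j
    have h0 : ((m j).factorial : ℝ) ≠ 0 := by positivity
    rw [fiberPerm_of_injective Function.injective_id, fiberPerm_const, symElt_top_bot, smul_smul,
      inv_mul_cancel₀ h0, one_smul]
  have h2 : fiberPerm (Sigma.fst : (Σ j, Fin (m j)) → J)
      = fiberPerm (Sigma.map id (fun j (_ : Fin (m j)) => ()) :
        (Σ j, Fin (m j)) → Σ _ : J, Unit) := by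
    ext π
    refine forall_congr' fun x => ?_
    simp [Sigma.map]
  simp only [h1]
  rw [Finset.prod_smul, prod_symElt, h2, fiberPerm_of_injective Function.injective_id,
    fiberPerm_of_injective (Function.injective_id.sigma_map fun j => Function.injective_id)]

/-- The product of elementary symmetric polynomials given by the columns of a partition. -/
def sEProd (q : ℕ) (ν : Fin r → ℕ) : MvPolynomial.symmetricSubalgebra (Fin r) ℤ :=
  ∏ b : Fin q, sE r (colLen ν b)

theorem coe_sEProd (q : ℕ) (ν : Fin r → ℕ) :
    (sEProd q ν : MvPolynomial (Fin r) ℤ) = esymmProd q ν := by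
  rw [sEProd, esymmProd, SubmonoidClass.coe_finsetProd]
  rfl

theorem symEval_sEProd (ν : Fin r → ℕ) :
    symEval (omegaMat r q) (sEProd q ν) = ∏ b : Fin q, matE (omegaMat r q) (colLen ν b) := by
  rw [sEProd, map_prod]
  simp only [symEval_sE]

theorem domLE_of_ellSq_sEProd {μ ν : Fin r → ℕ} (hμ : IsBox q μ) (hν : IsBox q ν)
    (h : ellSq (diagram q μ) (symEval (omegaMat r q) (sEProd q ν)) ≠ 0) : DomLE μ ν := by
  obtain ⟨C, hC, hE⟩ := prod_matE (r := r) (q := q) fun b : Fin q => colLen ν b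
  rw [symEval_sEProd, hE, map_smul] at h
  obtain ⟨c, d, hcd⟩ := ellSq_symElt_ne_zero_iff.1 (right_ne_zero_of_smul h)
  intro k
  refine (partialSum_le_of_ell_ne_zero hμ.2 hcd k).trans_eq ?_
  rw [← sum_min_colLen hν.1 hν.2]
  refine Finset.sum_congr rfl fun b _ => ?_
  rw [card_sigma_fst fun b : Fin q => colLen ν b]

theorem ellSq_sEProd_ne_zero {ν : Fin r → ℕ} (hν : IsBox q ν) :
    ellSq (diagram q ν) (symEval (omegaMat r q) (sEProd q ν)) ≠ 0 := by
  obtain ⟨C, hC, hE⟩ := prod_matE (r := r) (q := q) fun b : Fin q => colLen ν b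
  rw [symEval_sEProd, hE, map_smul]
  refine smul_ne_zero hC ?_
  let e : (Σ b : Fin q, Fin (colLen ν b)) ≃ diagram q ν :=
    { toFun := fun x => ⟨(Fin.castLE (colLen_le ν x.1) x.2, x.1),
        mem_diagram.2 ((mem_diagram_iff hν.1 _ _).2 x.2.2)⟩
      invFun := fun p => ⟨p.1.2, ⟨p.1.1, (mem_diagram_iff hν.1 _ _).1 (mem_diagram.1 p.2)⟩⟩
      left_inv := fun x => rfl
      right_inv := fun p => rfl }
  refine ellSq_symElt_ne_zero (c := fun x => (e x).1.1) (d := fun x => (e x).1.2) ?_ ?_ e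
    fun x => rfl
  · intro π hπ x
    rw [show π x = x from hπ x]
  · intro σ hσ x
    exact hσ x

theorem partialSum_le_of_ellSq_prod_matH {μ κ : Fin r → ℕ} (hμ : IsBox q μ)
    (h : ellSq (diagram q μ) (∏ a, matH (omegaMat r q) (κ a)) ≠ 0) : DomLE κ μ := by
  obtain ⟨C, hC, hE⟩ := prod_matH (r := r) (q := q) κ
  rw [hE, map_smul] at h
  obtain ⟨c, d, hcd⟩ := ellSq_symElt_ne_zero_iff.1 (right_ne_zero_of_smul h)
  intro k
  refine le_of_eq_of_le ?_ (le_partialSum_of_ell_ne_zero hμ.1 hμ.2 hcd k)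
  rw [Finset.card_eq_sum_card_fiberwise (f := Sigma.fst)
    (t := Finset.univ.filter fun a : Fin r => (a : ℕ) < k) (by
      intro p hp
      simpa using (Finset.mem_filter.1 hp).2), partialSum]
  refine Finset.sum_congr rfl fun a ha => ?_
  rw [← card_sigma_fst κ a, Finset.filter_filter]
  congr 1
  ext x
  simp only [Finset.mem_filter, Finset.mem_univ, true_and] at ha ⊢
  exact ⟨fun h => ⟨h ▸ ha, h⟩, fun h => h.2⟩

theorem sum_filter_lt_le_perm (w : Equiv.Perm (Fin r)) (k : ℕ) :
    ∑ a ∈ Finset.univ.filter (fun a : Fin r => (a : ℕ) < k), (a : ℕ)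
      ≤ ∑ a ∈ Finset.univ.filter (fun a : Fin r => (a : ℕ) < k), (w a : ℕ) := by
  have h1 : ∑ a : Fin r, min ((w a : ℤ) - k) 0 = ∑ a : Fin r, min ((a : ℤ) - k) 0 :=
    Equiv.sum_comp w fun a : Fin r => min ((a : ℤ) - k) 0
  have h2 : ∑ a : Fin r, min ((a : ℤ) - k) 0
      = ∑ a ∈ Finset.univ.filter (fun a : Fin r => (a : ℕ) < k), ((a : ℤ) - k) := by
    rw [Finset.sum_filter]
    refine Finset.sum_congr rfl fun a _ => ?_
    split_ifs <;> omega
  have h3 : ∑ a : Fin r, min ((w a : ℤ) - k) 0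
      ≤ ∑ a ∈ Finset.univ.filter (fun a : Fin r => (a : ℕ) < k), ((w a : ℤ) - k) := by
    rw [Finset.sum_filter]
    refine Finset.sum_le_sum fun a _ => ?_
    split_ifs <;> omega
  rw [h1, h2, Finset.sum_sub_distrib, Finset.sum_sub_distrib] at h3
  have h4 := (sub_le_sub_iff_right _).1 h3
  exact_mod_cast h4

theorem domLE_of_ellSq_sSchur {μ lam : Fin r → ℕ} (hμ : IsBox q μ)
    (h : ellSq (diagram q μ) (symEval (omegaMat r q) (sSchur lam)) ≠ 0) : DomLE lam μ := by
  have h1 : symEval (omegaMat r q) (sSchur lam) = ∑ w : Equiv.Perm (Fin r),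
      (Equiv.Perm.sign w : ℤ) • ∏ a, symEval (omegaMat r q)
        (sHZ r ((lam a : ℤ) - (a : ℕ) + (w a : ℕ))) := by
    rw [sSchur, ← Matrix.det_transpose, Matrix.det_apply, map_sum]
    refine Finset.sum_congr rfl fun w _ => ?_
    rw [Units.smul_def, map_zsmul, map_prod]
    rfl
  rw [h1, map_sum] at h
  obtain ⟨w, -, hw⟩ := Finset.exists_ne_zero_of_sum_ne_zero h
  rw [map_zsmul] at hw
  have hw2 := right_ne_zero_of_smul hw
  have hpos : ∀ a, 0 ≤ (lam a : ℤ) - (a : ℕ) + (w a : ℕ) := by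
    intro a
    by_contra hneg
    refine hw2 ?_
    rw [Finset.prod_eq_zero (Finset.mem_univ a), map_zero]
    rw [sHZ, if_neg hneg, map_zero]
  have h2 : ∀ a, symEval (omegaMat r q) (sHZ r ((lam a : ℤ) - (a : ℕ) + (w a : ℕ)))
      = matH (omegaMat r q) ((lam a : ℤ) - (a : ℕ) + (w a : ℕ)).toNat := by
    intro a
    rw [sHZ, if_pos (hpos a), symEval_sH]
  simp only [h2] at hw2
  have h3 := partialSum_le_of_ellSq_prod_matH hμ hw2
  intro k
  refine le_trans ?_ (h3 k)
  have h4 := sum_filter_lt_le_perm w k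
  have h5 : partialSum k (fun a => ((lam a : ℤ) - (a : ℕ) + (w a : ℕ)).toNat)
      + ∑ a ∈ Finset.univ.filter (fun a : Fin r => (a : ℕ) < k), (a : ℕ)
      = partialSum k lam + ∑ a ∈ Finset.univ.filter (fun a : Fin r => (a : ℕ) < k), (w a : ℕ) := by
    rw [partialSum, partialSum, ← Finset.sum_add_distrib, ← Finset.sum_add_distrib]
    refine Finset.sum_congr rfl fun a _ => ?_
    have := hpos a
    omega
  omega

end Products

section Triangular
variable {n r : ℕ}

theorem ellSq_sSchur_induction (hrn : r ≤ n) (N : ℕ) : ∀ ν : Fin r → ℕ, domRank ν < N →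
    IsBox (n - r) ν →
    ellSq (diagram (n - r) ν) (symEval (omegaMat r (n - r)) (sSchur ν)) ≠ 0 ∧
    ∀ μ, IsBox (n - r) μ →
      ellSq (diagram (n - r) μ) (symEval (omegaMat r (n - r)) (sSchur ν)) ≠ 0 → DomLE μ ν := by
  induction N with
  | zero => exact fun ν h => absurd h (Nat.not_lt_zero _)
  | succ N ih =>
    intro ν hN hν
    have hH : ∀ m, n - r < m → matH (omegaMat r (n - r)) m = 0 := fun m hm =>
      matH_omegaMat_eq_zero hm
    obtain ⟨S, hS, hE⟩ := symmetric_eq_sum_sSchur (sEProd (n - r) ν)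
    have hE' : symEval (omegaMat r (n - r)) (sEProd (n - r) ν)
        = ∑ κ ∈ S, schurCoeff r (sEProd (n - r) ν) κ •
          symEval (omegaMat r (n - r)) (sSchur κ) := by
      conv_lhs => rw [hE]
      rw [map_sum]
      exact Finset.sum_congr rfl fun κ _ => map_zsmul _ _ _
    set c : (Fin r → ℕ) → ℤ := schurCoeff r (sEProd (n - r) ν) with hc
    have hdom : ∀ κ, c κ ≠ 0 → DomLE κ ν := by
      intro κ h
      rw [hc, coe_sEProd] at h
      exact domLE_of_schurCoeff_esymmProd hν.1 hν.2 κ h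
    have key : ∀ κ ∈ S, κ ≠ ν → ∀ μ, IsBox (n - r) μ →
        ellSq (diagram (n - r) μ) (c κ • symEval (omegaMat r (n - r)) (sSchur κ)) ≠ 0 →
        DomLE κ ν ∧ DomLE μ κ := by
      intro κ hκ hne μ hμ h
      rw [map_zsmul] at h
      have h1 := hdom κ (left_ne_zero_of_smul h)
      have h2 := right_ne_zero_of_smul h
      have hκb : IsBox (n - r) κ := by
        refine ⟨hS κ hκ, fun a => ?_⟩
        by_contra ha
        rw [symEval_sSchur_eq_zero _ hrn hH (hS κ hκ) a (not_le.1 ha), map_zero] at h2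
        exact h2 rfl
      exact ⟨h1, (ih κ (by have := h1.domRank_lt hne; omega) hκb).2 μ hμ h2⟩
    have hν0 : ellSq (diagram (n - r) ν) (symEval (omegaMat r (n - r)) (sEProd (n - r) ν)) ≠ 0 :=
      ellSq_sEProd_ne_zero hν
    have hzero : ∀ κ ∈ S, κ ≠ ν →
        ellSq (diagram (n - r) ν) (c κ • symEval (omegaMat r (n - r)) (sSchur κ)) = 0 := by
      intro κ hκ hne
      by_contra h
      obtain ⟨h1, h2⟩ := key κ hκ hne ν hν h
      exact hne (h1.antisymm h2)
    have hνS : ν ∈ S := by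
      by_contra hνS
      refine hν0 ?_
      rw [hE', map_sum]
      exact Finset.sum_eq_zero fun κ hκ => hzero κ hκ fun h => hνS (h ▸ hκ)
    have hcν : ellSq (diagram (n - r) ν) (c ν • symEval (omegaMat r (n - r)) (sSchur ν)) ≠ 0 := by
      rw [hE', map_sum, Finset.sum_eq_single_of_mem ν hνS hzero] at hν0
      exact hν0
    rw [map_zsmul] at hcν
    refine ⟨right_ne_zero_of_smul hcν, fun μ hμ h => ?_⟩
    by_cases hEμ : ellSq (diagram (n - r) μ)
        (symEval (omegaMat r (n - r)) (sEProd (n - r) ν)) = 0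
    · have h1 : ellSq (diagram (n - r) μ)
          (c ν • symEval (omegaMat r (n - r)) (sSchur ν)) ≠ 0 := by
        rw [map_zsmul]
        exact smul_ne_zero (left_ne_zero_of_smul hcν) h
      by_contra hnd
      refine h1 ?_
      rw [hE', map_sum, Finset.sum_eq_single_of_mem ν hνS] at hEμ
      · exact hEμ
      · intro κ hκ hne
        by_contra h2
        obtain ⟨h3, h4⟩ := key κ hκ hne μ hμ h2
        exact hnd (h4.trans h3)
    · exact domLE_of_ellSq_sEProd hμ hν hEμ

theorem ellSq_sSchur_self (hrn : r ≤ n) {ν : Fin r → ℕ} (hν : IsBox (n - r) ν) :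
    ellSq (diagram (n - r) ν) (symEval (omegaMat r (n - r)) (sSchur ν)) ≠ 0 :=
  (ellSq_sSchur_induction hrn _ ν (Nat.lt_succ_self _) hν).1

theorem ellSq_sSchur_of_ne (hrn : r ≤ n) {μ ν : Fin r → ℕ} (hμ : IsBox (n - r) μ)
    (hν : IsBox (n - r) ν) (h : μ ≠ ν) :
    ellSq (diagram (n - r) μ) (symEval (omegaMat r (n - r)) (sSchur ν)) = 0 := by
  by_contra h0
  exact h (((ellSq_sSchur_induction hrn _ ν (Nat.lt_succ_self _) hν).2 μ hμ h0).antisymm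
    (domLE_of_ellSq_sSchur hμ h0))

/-- The Young symmetrizer element of a diagram. -/
def diagElt (q : ℕ) (lam : Fin r → ℕ) : ExtC r q :=
  symElt r q (X := diagram q lam) (fiberPerm fun p => p.1.1) (fiberPerm fun p => p.1.2)

theorem ellSq_diagElt_self (q : ℕ) (lam : Fin r → ℕ) :
    ellSq (diagram q lam) (diagElt q lam) ≠ 0 :=
  ellSq_symElt_ne_zero (c := fun p : diagram q lam => p.1.1) (d := fun p => p.1.2)
    (fun _ hπ x => hπ x) (fun _ hσ x => hσ x) (Equiv.refl _) fun _ => rfl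

theorem eq_of_ellSq_diagElt_ne_zero {q : ℕ} {lam μ : Fin r → ℕ} (hlam : IsBox q lam)
    (hμ : IsBox q μ) (h : ellSq (diagram q μ) (diagElt q lam) ≠ 0) : μ = lam := by
  obtain ⟨c, d, hcd⟩ := ellSq_symElt_ne_zero_iff.1 h
  refine DomLE.antisymm (fun k => ?_) fun k => ?_
  · refine (partialSum_le_of_ell_ne_zero hμ.2 hcd k).trans_eq ?_
    rw [← sum_min_colLen hlam.1 hlam.2]
    refine Finset.sum_congr rfl fun b _ => ?_
    rw [← card_diagram_col, ← card_filter_equiv (Equiv.refl (diagram q lam)) fun p => p.2 = b]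
    rfl
  · refine le_of_eq_of_le ?_ (le_partialSum_of_ell_ne_zero hμ.1 hμ.2 hcd k)
    rw [← card_diagram_row_lt hlam.2,
      ← card_filter_equiv (Equiv.refl (diagram q lam)) fun p => (p.1 : ℕ) < k]
    rfl

theorem mem_boxSchurSpan_iff {q : ℕ} {x : ExtC r q} (hx : x ∈ boxSchurSpan (omegaMat r q) q) :
    ∃ c : {ν : Fin r → ℕ // IsBox q ν} →₀ ℝ,
      x = c.sum fun ν a => a • symEval (omegaMat r q) (sSchur ν.1) := by
  have h1 : {x | ∃ ν : Fin r → ℕ, Antitone ν ∧ (∀ a, ν a ≤ q) ∧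
      x = symEval (omegaMat r q) (sSchur ν)}
      = Set.range fun ν : {ν : Fin r → ℕ // IsBox q ν} => symEval (omegaMat r q) (sSchur ν.1) := by
    ext x
    constructor
    · rintro ⟨ν, h1, h2, rfl⟩
      exact ⟨⟨ν, h1, h2⟩, rfl⟩
    · rintro ⟨⟨ν, h1, h2⟩, rfl⟩
      exact ⟨ν, h1, h2, rfl⟩
  rw [boxSchurSpan, h1, Finsupp.mem_span_range_iff_exists_finsupp] at hx
  obtain ⟨c, hc⟩ := hx
  exact ⟨c, hc.symm⟩

theorem ellSq_finsupp_sum (hrn : r ≤ n) (c : {ν : Fin r → ℕ // IsBox (n - r) ν} →₀ ℝ)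
    (μ : {ν : Fin r → ℕ // IsBox (n - r) ν}) :
    ellSq (diagram (n - r) μ.1)
        (c.sum fun ν a => a • symEval (omegaMat r (n - r)) (sSchur ν.1))
      = c μ * ellSq (diagram (n - r) μ.1) (symEval (omegaMat r (n - r)) (sSchur μ.1)) := by
  classical
  rw [map_finsuppSum, Finsupp.sum]
  simp only [map_smul, smul_eq_mul]
  refine Finset.sum_eq_single μ (fun ν _ hne => ?_) fun hμ => ?_
  · rw [ellSq_sSchur_of_ne hrn μ.2 ν.2 fun h => hne (Subtype.ext h.symm), mul_zero]
  · rw [Finsupp.notMem_support_iff.1 hμ, zero_mul]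

theorem diagElt_eq (hrn : r ≤ n) {lam : Fin r → ℕ} (hlam : IsBox (n - r) lam) :
    ∃ C : ℝ, C ≠ 0 ∧
      diagElt (n - r) lam = C • symEval (omegaMat r (n - r)) (sSchur lam) := by
  have hmem : diagElt (n - r) lam ∈ boxSchurSpan (omegaMat r (n - r)) (n - r) := by
    refine sum_mem fun π _ => sum_mem fun σ _ => zsmul_mem ?_ _
    exact permTrace_mem_boxSchurSpan _ hrn (fun m hm => matH_omegaMat_eq_zero hm) _ _
  obtain ⟨c, hc⟩ := mem_boxSchurSpan_iff hmem
  have h1 : ∀ μ : {ν : Fin r → ℕ // IsBox (n - r) ν}, μ ≠ ⟨lam, hlam⟩ → c μ = 0 := by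
    intro μ hμ
    have h2 := ellSq_finsupp_sum hrn c μ
    rw [← hc] at h2
    by_contra h0
    refine hμ (Subtype.ext (eq_of_ellSq_diagElt_ne_zero hlam μ.2 ?_))
    rw [h2]
    exact mul_ne_zero h0 (ellSq_sSchur_self hrn μ.2)
  have h2 : diagElt (n - r) lam
      = c ⟨lam, hlam⟩ • symEval (omegaMat r (n - r)) (sSchur lam) := by
    rw [hc]
    refine Finset.sum_eq_single (⟨lam, hlam⟩ : {ν : Fin r → ℕ // IsBox (n - r) ν})
      (fun μ _ hne => ?_) fun hμ => ?_
    · beta_reduce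
      rw [h1 μ hne, zero_smul]
    · beta_reduce
      rw [Finsupp.notMem_support_iff.1 hμ, zero_smul]
  refine ⟨_, fun h0 => ?_, h2⟩
  rw [h0, zero_smul] at h2
  refine ellSq_diagElt_self (n - r) lam ?_
  rw [h2, map_zero]

/-- A symmetric polynomial outside the ideal of relations has a nonzero image, detected by one
of the coordinate functionals. -/
theorem exists_ellSq_symEval_ne_zero (hrn : r ≤ n)
    (f : MvPolynomial.symmetricSubalgebra (Fin r) ℤ)
    (hf : (f : MvPolynomial (Fin r) ℤ) ∉ grassIdeal r n) :
    ∃ D, ellSq D (symEval (omegaMat r (n - r)) f) ≠ 0 := by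
  obtain ⟨S, hS, hE⟩ := symmetric_eq_sum_sSchur f
  obtain ⟨ν, hνS, hν⟩ : ∃ ν ∈ S, ((schurCoeff r f ν • sSchur ν :
      MvPolynomial.symmetricSubalgebra (Fin r) ℤ) : MvPolynomial (Fin r) ℤ) ∉ grassIdeal r n := by
    by_contra hall
    push Not at hall
    refine hf ?_
    rw [hE, AddSubmonoidClass.coe_finsetSum]
    exact sum_mem hall
  have hbox : ∀ κ ∈ S, ¬ IsBox (n - r) κ → ∃ a, n - r < κ a := by
    intro κ hκ h
    by_contra hall
    push Not at hall
    exact h ⟨hS κ hκ, hall⟩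
  have hνb : IsBox (n - r) ν := by
    by_contra h
    obtain ⟨a, ha⟩ := hbox ν hνS h
    refine hν ?_
    rw [SetLike.val_smul, coe_sSchur]
    have hr : 0 < r := a.pos
    have ha0 : n - r < ν ⟨0, hr⟩ := ha.trans_le (hS ν hνS (Fin.mk_le_of_le_val (Nat.zero_le _)))
    exact zsmul_mem (schurP_mem_grassIdeal hrn ν ⟨0, hr⟩ rfl ha0) _
  have hcν : schurCoeff r f ν ≠ 0 := by
    intro h
    refine hν ?_
    rw [h, zero_smul]
    exact zero_mem _
  refine ⟨diagram (n - r) ν, ?_⟩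
  have hE' : symEval (omegaMat r (n - r)) f
      = ∑ κ ∈ S, schurCoeff r f κ • symEval (omegaMat r (n - r)) (sSchur κ) := by
    conv_lhs => rw [hE]
    rw [map_sum]
    exact Finset.sum_congr rfl fun κ _ => map_zsmul _ _ _
  rw [hE', map_sum, Finset.sum_eq_single_of_mem ν hνS, map_zsmul]
  · exact smul_ne_zero hcν (ellSq_sSchur_self hrn hνb)
  · intro κ hκ hne
    rw [map_zsmul]
    by_cases hκb : IsBox (n - r) κ
    · rw [ellSq_sSchur_of_ne hrn hνb hκb hne.symm, smul_zero]
    · obtain ⟨a, ha⟩ := hbox κ hκ hκb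
      rw [symEval_sSchur_eq_zero _ hrn (fun m hm => matH_omegaMat_eq_zero hm) (hS κ hκ) a ha,
        map_zero, smul_zero]

/-- The product of Schur polynomials lies outside the ideal of relations exactly when the
symmetrizer of the disjoint union of the diagrams is detected by a coordinate functional. -/
theorem prod_schurP_notMem_iff (hrn : r ≤ n) {s : ℕ} (lam : Fin s → Fin r → ℕ)
    (hlam : ∀ j, IsBox (n - r) (lam j)) :
    ∏ j, schurP (lam j) ∉ grassIdeal r n ↔
      ∃ D, ellSq D (symElt r (n - r) (X := Σ j, diagram (n - r) (lam j))
        (fiberPerm (Sigma.map id (fun j (p : diagram (n - r) (lam j)) => p.1.1) :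
          (Σ j, diagram (n - r) (lam j)) → Σ _ : Fin s, Fin r))
        (fiberPerm (Sigma.map id (fun j (p : diagram (n - r) (lam j)) => p.1.2) :
          (Σ j, diagram (n - r) (lam j)) → Σ _ : Fin s, Fin (n - r)))) ≠ 0 := by
  have h1 : ∀ j, ∃ C : ℝ, C ≠ 0 ∧ diagElt (n - r) (lam j)
      = C • symEval (omegaMat r (n - r)) (sSchur (lam j)) := fun j => diagElt_eq hrn (hlam j)
  choose C hC hCe using h1
  have h2 : symElt r (n - r) (X := Σ j, diagram (n - r) (lam j))
        (fiberPerm (Sigma.map id (fun j (p : diagram (n - r) (lam j)) => p.1.1) :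
          (Σ j, diagram (n - r) (lam j)) → Σ _ : Fin s, Fin r))
        (fiberPerm (Sigma.map id (fun j (p : diagram (n - r) (lam j)) => p.1.2) :
          (Σ j, diagram (n - r) (lam j)) → Σ _ : Fin s, Fin (n - r)))
      = (∏ j, C j) • symEval (omegaMat r (n - r)) (∏ j, sSchur (lam j)) := by
    rw [← prod_symElt, map_prod, ← Finset.prod_smul]
    exact Finset.prod_congr rfl fun j _ => hCe j
  have h3 : ((∏ j, sSchur (lam j) : MvPolynomial.symmetricSubalgebra (Fin r) ℤ) :
      MvPolynomial (Fin r) ℤ) = ∏ j, schurP (lam j) := by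
    rw [SubmonoidClass.coe_finsetProd]
    exact Finset.prod_congr rfl fun j _ => coe_sSchur _
  rw [h2, ← h3]
  constructor
  · intro h
    obtain ⟨D, hD⟩ := exists_ellSq_symEval_ne_zero hrn _ h
    refine ⟨D, ?_⟩
    rw [map_smul]
    exact smul_ne_zero (Finset.prod_ne_zero_iff.2 fun j _ => hC j) hD
  · rintro ⟨D, hD⟩ hmem
    rw [symEval_eq_zero_of_mem _ (fun m hm => matH_omegaMat_eq_zero hm) _ hmem, smul_zero,
      map_zero] at hD
    exact hD rfl

end Triangular

section Minor

theorem exists_det_ne_zero_of_linearIndependent {K X Y : Type} [Field K] [Fintype X]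
    [DecidableEq X] [Fintype Y] {v : X → Y → K} (h : LinearIndependent K v) :
    ∃ e : X → Y, Matrix.det (Matrix.of fun x y => v x (e y)) ≠ 0 := by
  have h1 : finrank K (span K (Set.range (Matrix.of v).col)) = Fintype.card X := by
    rw [← Matrix.rank_eq_finrank_span_cols]
    exact LinearIndependent.rank_matrix (M := Matrix.of v) h
  obtain ⟨κ, a, ha, hspan, hli⟩ := exists_linearIndependent' K (Matrix.of v).col
  have : Finite κ := Finite.of_injective a ha
  have := Fintype.ofFinite κ
  rw [← hspan, finrank_span_eq_card hli] at h1
  obtain ⟨f⟩ : Nonempty (X ≃ κ) := ⟨Fintype.equivOfCardEq h1.symm⟩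
  refine ⟨a ∘ f, ?_⟩
  have h2 : LinearIndependent K (Matrix.of fun x y => v x ((a ∘ f) y)).transpose.row :=
    hli.comp f f.injective
  rw [Matrix.linearIndependent_rows_iff_isUnit, Matrix.isUnit_iff_isUnit_det,
    Matrix.det_transpose] at h2
  exact h2.ne_zero

theorem linearIndependent_of_det_ne_zero {K X Y : Type} [Field K] [Fintype X]
    [DecidableEq X] {v : X → Y → K} {e : X → Y}
    (h : Matrix.det (Matrix.of fun x y => v x (e y)) ≠ 0) : LinearIndependent K v := by
  have h2 : LinearIndependent K (Matrix.of fun x y => v x (e y)).row := by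
    rw [Matrix.linearIndependent_rows_iff_isUnit, Matrix.isUnit_iff_isUnit_det]
    exact h.isUnit
  exact LinearIndependent.of_comp (LinearMap.funLeft K K e) h2

/-- The family of rank one matrices with rows from `A` and columns from `B`. -/
def tensorFam {K X P P' : Type} [Field K] {r q : ℕ} (ρ : X → P) (γ : X → P')
    (A : P → Fin r → K) (B : P' → Fin q → K) : X → Fin r × Fin q → K :=
  fun x p => A (ρ x) p.1 * B (γ x) p.2

/-- The minors of the universal family of rank one matrices. -/
def minorPoly {X P P' : Type} [Fintype X] [DecidableEq X] {r q : ℕ} (ρ : X → P) (γ : X → P')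
    (e : X → Fin r × Fin q) : MvPolynomial ((P × Fin r) ⊕ (P' × Fin q)) ℤ :=
  Matrix.det (Matrix.of fun x y => MvPolynomial.X (Sum.inl (ρ x, (e y).1)) *
    MvPolynomial.X (Sum.inr (γ x, (e y).2)))

theorem aeval_minorPoly {K X P P' : Type} [Field K] [Fintype X] [DecidableEq X] {r q : ℕ}
    (ρ : X → P) (γ : X → P') (e : X → Fin r × Fin q) (t : (P × Fin r) ⊕ (P' × Fin q) → K) :
    MvPolynomial.aeval t (minorPoly ρ γ e)
      = Matrix.det (Matrix.of fun x y => tensorFam ρ γ (fun p a => t (Sum.inl (p, a)))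
          (fun p b => t (Sum.inr (p, b))) x (e y)) := by
  rw [minorPoly, AlgHom.map_det]
  congr 1
  ext x y
  simp [tensorFam]

theorem minorPoly_ne_zero_of_linearIndependent {K X P P' : Type} [Field K] [Fintype X]
    [DecidableEq X] {r q : ℕ} {ρ : X → P} {γ : X → P'} {A : P → Fin r → K} {B : P' → Fin q → K}
    (h : LinearIndependent K (tensorFam ρ γ A B)) : ∃ e, minorPoly (r := r) (q := q) ρ γ e ≠ 0 := by
  obtain ⟨e, he⟩ := exists_det_ne_zero_of_linearIndependent h
  refine ⟨e, fun h0 => he ?_⟩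
  have h1 := aeval_minorPoly ρ γ e (Sum.elim (fun p => A p.1 p.2) (fun p => B p.1 p.2))
  rw [h0, map_zero] at h1
  exact h1.symm

theorem exists_aeval_ne_zero {K σ : Type} [Field K] [CharZero K] {p : MvPolynomial σ ℤ}
    (hp : p ≠ 0) : ∃ t : σ → K, MvPolynomial.aeval t p ≠ 0 := by
  by_contra hall
  push Not at hall
  refine hp (MvPolynomial.map_injective (Int.castRingHom K) Int.cast_injective ?_)
  rw [map_zero]
  refine MvPolynomial.funext fun t => ?_
  rw [map_zero, MvPolynomial.eval_map, ← hall t, MvPolynomial.aeval_def]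
  rfl

end Minor

section Polarization
variable {X P P' : Type} [Fintype X] [DecidableEq X] {r q : ℕ}

theorem ell_wedge {D : Finset (Fin r × Fin q)} (e : X ≃ D) (v : X → MatV r q) :
    ∃ ε : ℤˣ, ell D (wedge X r q v) = ε • Matrix.det (Matrix.of fun x y => v x (e y)) := by
  have hc : Fintype.card X = D.card := by
    rw [Fintype.card_congr e, Fintype.card_coe]
  rw [wedge_eq_ιMulti]
  have key : ∀ (e₀ : X ≃ Fin D.card), ∃ ε : ℤˣ, ell D (ExteriorAlgebra.ιMulti ℝ D.card
      (v ∘ e₀.symm)) = ε • Matrix.det (Matrix.of fun x y => v x (e y)) := by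
    intro e₀
    rw [ell_ιMulti]
    set τ : Equiv.Perm X := (e₀.trans D.equivFin.symm).trans e.symm with hτ
    refine ⟨Equiv.Perm.sign τ, ?_⟩
    rw [← Matrix.det_reindex_self e₀.symm, Units.smul_def, zsmul_eq_mul, ← Matrix.det_permute']
    congr 1
    ext x y
    simp [hτ]
  revert key
  rw [← hc]
  exact fun key => key _

theorem wedge_tensorFam (ρ : X → P) (γ : X → P') (A : P → Fin r → ℝ) (B : P' → Fin q → ℝ) :
    wedge X r q (tensorFam ρ γ A B) = ∑ p : (X → Fin r) × (X → Fin q),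
      (∏ x, A (ρ x) (p.1 x) * B (γ x) (p.2 x)) • theta p.1 p.2 := by
  classical
  have h1 : tensorFam ρ γ A B = fun x => ∑ p : Fin r × Fin q,
      (A (ρ x) p.1 * B (γ x) p.2) • (matUnit p : MatV r q) := by
    ext x p
    rw [Finset.sum_apply, Finset.sum_eq_single p]
    · simp [tensorFam, matUnit]
    · intro p' _ h
      simp [matUnit, Pi.single_eq_of_ne h.symm]
    · simp
  rw [h1]
  have h2 := (wedge X r q).toMultilinearMap.map_sum fun x (p : Fin r × Fin q) =>
      (A (ρ x) p.1 * B (γ x) p.2) • (matUnit p : MatV r q)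
  refine h2.trans ?_
  refine Fintype.sum_equiv (Equiv.arrowProdEquivProdArrow X (fun _ => Fin r) (fun _ => Fin q))
    _ _ fun p => ?_
  rw [MultilinearMap.map_smul_univ]
  rfl

open Classical in
/-- The exponent recording a pair of index functions up to permutations of fibres. -/
def fiberExp (ρ : X → P) (γ : X → P') (p : (X → Fin r) × (X → Fin q)) :
    (P × Fin r) ⊕ (P' × Fin q) →₀ ℕ :=
  ∑ x, (Finsupp.single (Sum.inl (ρ x, p.1 x)) 1 + Finsupp.single (Sum.inr (γ x, p.2 x)) 1)

omit [DecidableEq X] in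
theorem prod_X_eq_monomial_fiberExp (ρ : X → P) (γ : X → P') (p : (X → Fin r) × (X → Fin q)) :
    ∏ x, (MvPolynomial.X (Sum.inl (ρ x, p.1 x)) * MvPolynomial.X (Sum.inr (γ x, p.2 x)) :
      MvPolynomial ((P × Fin r) ⊕ (P' × Fin q)) ℝ)
      = MvPolynomial.monomial (fiberExp ρ γ p) 1 := by
  rw [fiberExp, MvPolynomial.monomial_sum_one]
  refine Finset.prod_congr rfl fun x _ => ?_
  rw [MvPolynomial.X, MvPolynomial.X, MvPolynomial.monomial_mul, one_mul]

omit [DecidableEq X] in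
theorem exists_perm_of_card_fiber {Z : Type} [DecidableEq Z] (f g : X → Z)
    (h : ∀ z, (Finset.univ.filter fun x => f x = z).card
      = (Finset.univ.filter fun x => g x = z).card) :
    ∃ π : Equiv.Perm X, ∀ x, g (π x) = f x := by
  have h1 : ∀ z, Nonempty ({x // f x = z} ≃ {x // g x = z}) := fun z => by
    refine ⟨Fintype.equivOfCardEq ?_⟩
    rw [Fintype.card_subtype, Fintype.card_subtype, h z]
  exact ⟨Equiv.ofFiberEquiv fun z => (h1 z).some, fun x => Equiv.ofFiberEquiv_map _ x⟩

omit [DecidableEq X] in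
theorem fiberExp_inl [DecidableEq P] (ρ : X → P) (γ : X → P') (p : (X → Fin r) × (X → Fin q))
    (z : P × Fin r) : fiberExp ρ γ p (Sum.inl z)
      = (Finset.univ.filter fun x => (ρ x, p.1 x) = z).card := by
  classical
  rw [fiberExp, Finsupp.finsetSum_apply, Finset.card_filter]
  refine Finset.sum_congr rfl fun x _ => ?_
  simp [Finsupp.single_apply]

omit [DecidableEq X] in
theorem fiberExp_inr [DecidableEq P'] (ρ : X → P) (γ : X → P') (p : (X → Fin r) × (X → Fin q))
    (z : P' × Fin q) : fiberExp ρ γ p (Sum.inr z)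
      = (Finset.univ.filter fun x => (γ x, p.2 x) = z).card := by
  classical
  rw [fiberExp, Finsupp.finsetSum_apply, Finset.card_filter]
  refine Finset.sum_congr rfl fun x _ => ?_
  simp [Finsupp.single_apply]

omit [DecidableEq X] in
theorem exists_perm_of_fiberExp_eq {ρ : X → P} {γ : X → P'} {p p' : (X → Fin r) × (X → Fin q)}
    (h : fiberExp ρ γ p = fiberExp ρ γ p') :
    ∃ π ∈ fiberPerm ρ, ∃ σ ∈ fiberPerm γ, p.1 = p'.1 ∘ π ∧ p.2 = p'.2 ∘ σ := by
  classical
  obtain ⟨π, hπ⟩ := exists_perm_of_card_fiber (fun x => (ρ x, p.1 x)) (fun x => (ρ x, p'.1 x))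
    fun z => by rw [← fiberExp_inl ρ γ p, ← fiberExp_inl ρ γ p', h]
  obtain ⟨σ, hσ⟩ := exists_perm_of_card_fiber (fun x => (γ x, p.2 x)) (fun x => (γ x, p'.2 x))
    fun z => by rw [← fiberExp_inr ρ γ p, ← fiberExp_inr ρ γ p', h]
  refine ⟨π, fun x => (Prod.ext_iff.1 (hπ x)).1, σ, fun x => (Prod.ext_iff.1 (hσ x)).1,
    funext fun x => (Prod.ext_iff.1 (hπ x)).2.symm, funext fun x => (Prod.ext_iff.1 (hσ x)).2.symm⟩

omit [DecidableEq X] in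
theorem fiberExp_comp {ρ : X → P} {γ : X → P'} {π σ : Equiv.Perm X} (hπ : π ∈ fiberPerm ρ)
    (hσ : σ ∈ fiberPerm γ) (p : (X → Fin r) × (X → Fin q)) :
    fiberExp ρ γ (p.1 ∘ π, p.2 ∘ σ) = fiberExp ρ γ p := by
  classical
  ext z
  rcases z with z | z
  · rw [fiberExp_inl, fiberExp_inl]
    refine Finset.card_equiv π fun x => ?_
    simp [hπ x]
  · rw [fiberExp_inr, fiberExp_inr]
    refine Finset.card_equiv σ fun x => ?_
    simp [hσ x]

theorem symWedge_comp {H K : Subgroup (Equiv.Perm X)} {π σ : Equiv.Perm X} (hπ : π ∈ H)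
    (hσ : σ ∈ K) (c : X → Fin r) (d : X → Fin q) :
    symWedge H K (c ∘ π) (d ∘ σ) = symWedge H K c d := by
  classical
  rw [symWedge, symWedge]
  refine Fintype.sum_equiv (Equiv.mulLeft (⟨π, hπ⟩ : H)) _ _ fun π' => ?_
  refine Fintype.sum_equiv (Equiv.mulLeft (⟨σ, hσ⟩ : K)) _ _ fun σ' => ?_
  rfl

theorem sum_symWedge_fiberExp (ρ : X → P) (γ : X → P') (D : Finset (Fin r × Fin q))
    (w : ((P × Fin r) ⊕ (P' × Fin q) →₀ ℕ) → ℝ) :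
    ∃ C : ℝ, C ≠ 0 ∧ C * ∑ p, w (fiberExp ρ γ p) * ell D (theta p.1 p.2)
      = ∑ p, w (fiberExp ρ γ p) * ell D (symWedge (fiberPerm ρ) (fiberPerm γ) p.1 p.2) := by
  classical
  have hp : ∀ (G : Type) [Group G] {_ : Fintype G}, Fintype.card G ≠ 0 :=
    fun G _ _ => Fintype.card_ne_zero
  refine ⟨(Fintype.card (fiberPerm ρ) * Fintype.card (fiberPerm γ) : ℕ),
    Nat.cast_ne_zero.2 (mul_ne_zero (hp _) (hp _)), ?_⟩
  have h1 : ∀ (π : fiberPerm ρ) (σ : fiberPerm γ),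
      ∑ p : (X → Fin r) × (X → Fin q), w (fiberExp ρ γ p) * ell D (theta p.1 p.2)
      = ∑ p : (X → Fin r) × (X → Fin q), w (fiberExp ρ γ p) *
        ell D (theta (p.1 ∘ (π : Equiv.Perm X)) (p.2 ∘ (σ : Equiv.Perm X))) := by
    intro π σ
    symm
    refine Fintype.sum_equiv (Equiv.prodCongr
      (Equiv.arrowCongr (π : Equiv.Perm X).symm (Equiv.refl _))
      (Equiv.arrowCongr (σ : Equiv.Perm X).symm (Equiv.refl _))) _ _ fun p => ?_
    rw [← fiberExp_comp π.2 σ.2 p]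
    rfl
  simp only [symWedge, map_sum, Finset.mul_sum]
  rw [Finset.sum_comm]
  simp only [Finset.sum_comm (s := (Finset.univ : Finset ((X → Fin r) × (X → Fin q))))]
  simp only [← h1, Finset.sum_const, Finset.card_univ, nsmul_eq_mul]
  rw [← Finset.mul_sum]
  push_cast
  ring

theorem exists_ellSq_ne_zero_iff_minorPoly (ρ : X → P) (γ : X → P') :
    (∃ D, ellSq D (symElt r q (fiberPerm ρ) (fiberPerm γ)) ≠ 0)
      ↔ ∃ e, minorPoly (r := r) (q := q) ρ γ e ≠ 0 := by
  classical
  constructor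
  · rintro ⟨D, hD⟩
    obtain ⟨c, d, hcd⟩ := ellSq_symElt_ne_zero_iff.1 hD
    obtain ⟨-, -, -, -, e, -⟩ := exists_ell_theta_ne_zero hcd
    refine ⟨fun x => e x, fun h0 => hcd ?_⟩
    have h1 : ∑ p : (X → Fin r) × (X → Fin q), MvPolynomial.C (ell D (theta p.1 p.2)) *
        ∏ x, (MvPolynomial.X (Sum.inl (ρ x, p.1 x)) * MvPolynomial.X (Sum.inr (γ x, p.2 x)) :
          MvPolynomial ((P × Fin r) ⊕ (P' × Fin q)) ℝ) = 0 := by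
      refine MvPolynomial.funext fun t => ?_
      obtain ⟨ε, hε⟩ := ell_wedge e (tensorFam ρ γ (fun p a => t (Sum.inl (p, a)))
          (fun p b => t (Sum.inr (p, b))))
      rw [← aeval_minorPoly ρ γ (fun x => (e x : Fin r × Fin q)) t, h0, map_zero, smul_zero,
        wedge_tensorFam, map_sum] at hε
      rw [map_zero, map_sum, ← hε]
      refine Finset.sum_congr rfl fun p _ => ?_
      rw [map_smul, map_mul, MvPolynomial.eval_C, map_prod, smul_eq_mul, mul_comm]
      simp only [map_mul, MvPolynomial.eval_X]
    have h2 := congrArg (MvPolynomial.coeff (fiberExp ρ γ (c, d))) h1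
    rw [MvPolynomial.coeff_sum, MvPolynomial.coeff_zero] at h2
    obtain ⟨C, hC, h3⟩ := sum_symWedge_fiberExp ρ γ D
      fun m => if m = fiberExp ρ γ (c, d) then 1 else 0
    have h4 : ∑ p : (X → Fin r) × (X → Fin q),
        (if fiberExp ρ γ p = fiberExp ρ γ (c, d) then (1 : ℝ) else 0) * ell D (theta p.1 p.2)
        = 0 := by
      refine Eq.trans (Finset.sum_congr rfl fun p _ => ?_) h2
      rw [prod_X_eq_monomial_fiberExp, MvPolynomial.coeff_C_mul, MvPolynomial.coeff_monomial,
        mul_comm]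
    rw [h4, mul_zero] at h3
    have h5 : ∑ p : (X → Fin r) × (X → Fin q),
        (if fiberExp ρ γ p = fiberExp ρ γ (c, d) then (1 : ℝ) else 0) *
          ell D (symWedge (fiberPerm ρ) (fiberPerm γ) p.1 p.2)
        = ∑ p : (X → Fin r) × (X → Fin q),
        (if fiberExp ρ γ p = fiberExp ρ γ (c, d) then (1 : ℝ) else 0) *
          ell D (symWedge (fiberPerm ρ) (fiberPerm γ) c d) := by
      refine Finset.sum_congr rfl fun p _ => ?_
      split_ifs with h
      · obtain ⟨π, hπ, σ, hσ, h6, h7⟩ := exists_perm_of_fiberExp_eq h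
        rw [h6, h7, symWedge_comp hπ hσ]
      · simp
    rw [h5, ← Finset.sum_mul] at h3
    refine (mul_eq_zero.1 h3.symm).resolve_left ?_
    rw [Finset.sum_boole]
    exact Nat.cast_ne_zero.2 (Finset.card_ne_zero.2 ⟨(c, d), by simp⟩)
  · rintro ⟨e, he⟩
    obtain ⟨t, ht⟩ := exists_aeval_ne_zero (K := ℝ) he
    rw [aeval_minorPoly] at ht
    have hinj : Function.Injective e := by
      intro x y hxy
      by_contra hne
      refine ht (Matrix.det_zero_of_column_eq hne fun z => ?_)
      simp only [Matrix.of_apply, hxy]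
    refine ⟨Finset.univ.image e, ?_⟩
    let e' : X ≃ (Finset.univ.image e : Finset (Fin r × Fin q)) :=
      (Equiv.ofInjective e hinj).trans (Equiv.subtypeEquivRight fun y => by simp)
    obtain ⟨ε, hε⟩ := ell_wedge e' (tensorFam ρ γ (fun p a => t (Sum.inl (p, a)))
          (fun p b => t (Sum.inr (p, b))))
    have h1 : ell (Finset.univ.image e) (wedge X r q (tensorFam ρ γ
        (fun p a => t (Sum.inl (p, a))) (fun p b => t (Sum.inr (p, b))))) ≠ 0 := by
      rw [hε]
      exact (smul_ne_zero_iff_ne ε).2 ht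
    rw [wedge_tensorFam, map_sum] at h1
    obtain ⟨C, hC, h3⟩ := sum_symWedge_fiberExp ρ γ (Finset.univ.image e)
      fun m => MvPolynomial.eval t (MvPolynomial.monomial m (1 : ℝ))
    have h4 : ∑ p : (X → Fin r) × (X → Fin q),
        MvPolynomial.eval t (MvPolynomial.monomial (fiberExp ρ γ p) (1 : ℝ)) *
          ell (Finset.univ.image e) (theta p.1 p.2) ≠ 0 := by
      convert h1 using 2 with p
      rw [map_smul, ← prod_X_eq_monomial_fiberExp, map_prod, smul_eq_mul]
      simp only [map_mul, MvPolynomial.eval_X]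
    have h5 := mul_ne_zero hC h4
    rw [h3] at h5
    obtain ⟨p, -, hp⟩ := Finset.exists_ne_zero_of_sum_ne_zero h5
    exact ellSq_symElt_ne_zero_iff.2 ⟨p.1, p.2, right_ne_zero_of_mul hp⟩

end Polarization

/-- The index type of the disjoint union of the diagrams. -/
abbrev DiagSum {s r : ℕ} (q : ℕ) (lam : Fin s → Fin r → ℕ) : Type := Σ j, diagram q (lam j)

/-- The row of a box in the disjoint union of diagrams, together with its diagram. -/
def diagRow {s r : ℕ} (q : ℕ) (lam : Fin s → Fin r → ℕ) : DiagSum q lam → Σ _ : Fin s, Fin r :=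
  Sigma.map id fun _ p => p.1.1

/-- The column of a box in the disjoint union of diagrams, together with its diagram. -/
def diagCol {s r : ℕ} (q : ℕ) (lam : Fin s → Fin r → ℕ) : DiagSum q lam → Σ _ : Fin s, Fin q :=
  Sigma.map id fun _ p => p.1.2

theorem prod_schurP_notMem_iff_minorPoly {n r s : ℕ} (hrn : r ≤ n) (lam : Fin s → Fin r → ℕ)
    (hlam : ∀ j, IsBox (n - r) (lam j)) :
    ∏ j, schurP (lam j) ∉ grassIdeal r n ↔
      ∃ e, minorPoly (r := r) (q := n - r) (diagRow (n - r) lam) (diagCol (n - r) lam) e ≠ 0 := by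
  rw [prod_schurP_notMem_iff hrn lam hlam]
  exact exists_ellSq_ne_zero_iff_minorPoly _ _

section Index
variable {n r : ℕ}

/-- The partition attached to the subset of `[n]` recorded by `i`. -/
def lamI (i : Fin r → Fin n) (a : Fin r) : ℕ := n - r + a - i a

theorem strictMono_add_le_add {i : Fin r → Fin n} (hi : StrictMono i) {a b : Fin r}
    (hab : a ≤ b) : (i a : ℕ) + b ≤ i b + a := by
  have key : ∀ m : ℕ, ∀ b : Fin r, (b : ℕ) = a + m → (i a : ℕ) + b ≤ i b + a := by
    intro m
    induction m with
    | zero =>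
      intro b hb
      have : b = a := Fin.ext (by simpa using hb)
      rw [this]
    | succ m ih =>
      intro b hb
      have h1 := ih ⟨a + m, by have := b.2; lia⟩ rfl
      have h2 : i ⟨a + m, by have := b.2; lia⟩ < i b :=
        hi (Fin.lt_def.2 (by simp only; lia))
      rw [Fin.lt_def] at h2
      simp only at h1
      lia
  exact key (b - a) b (by have := Fin.le_def.1 hab; lia)

theorem strictMono_val_le {i : Fin r → Fin n} (hi : StrictMono i) (a : Fin r) :
    (a : ℕ) ≤ i a := by
  have h := strictMono_add_le_add hi (a := ⟨0, a.pos⟩) (b := a) (Fin.le_def.2 (Nat.zero_le _))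
  simp only at h
  lia

theorem strictMono_le_add {i : Fin r → Fin n} (hi : StrictMono i) (a : Fin r) :
    (i a : ℕ) ≤ n - r + a := by
  have hr := a.pos
  have h := strictMono_add_le_add hi (a := a) (b := ⟨r - 1, by lia⟩)
    (Fin.le_def.2 (by simp only; have := a.2; lia))
  have h2 := (i ⟨r - 1, by lia⟩).2
  simp only at h
  lia

theorem isBox_lamI {i : Fin r → Fin n} (hi : StrictMono i) : IsBox (n - r) (lamI i) := by
  refine ⟨fun a b hab => ?_, fun a => ?_⟩
  · have := strictMono_add_le_add hi hab
    simp only [lamI]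
    lia
  · have := strictMono_val_le hi a
    simp only [lamI]
    lia

theorem cast_lamI (hrn : r ≤ n) {i : Fin r → Fin n} (hi : StrictMono i) (a : Fin r) :
    (lamI i a : ℤ) = (n : ℤ) - (r : ℤ) + ((a : ℕ) : ℤ) - ((i a : ℕ) : ℤ) := by
  have := strictMono_le_add hi a
  simp only [lamI]
  lia

theorem schurI_eq_schurP (hrn : r ≤ n) {i : Fin r → Fin n} (hi : StrictMono i) :
    schurI i = schurP (lamI i) := by
  rw [schurI, schurP]
  congr 2
  ext1 a
  ext1 b
  congr 1
  rw [cast_lamI hrn hi]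
  ring

theorem card_diagram {q : ℕ} {ν : Fin r → ℕ} (hν : ∀ a, ν a ≤ q) :
    (diagram q ν).card = ∑ a, ν a := by
  have h := card_diagram_row_lt hν r
  rw [partialSum] at h
  simpa using h

theorem card_diagSum_lamI (hrn : r ≤ n) {s : ℕ} {I : Fin s → Fin r → Fin n}
    (hI : ∀ j, StrictMono (I j)) :
    (Fintype.card (DiagSum (n - r) fun j => lamI (I j)) : ℤ) = ∑ j, codimZ n r (I j) := by
  rw [Fintype.card_sigma, Nat.cast_sum]
  refine Finset.sum_congr rfl fun j _ => ?_
  rw [Fintype.card_coe, card_diagram (isBox_lamI (hI j)).2, codimZ, Nat.cast_sum]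
  exact Finset.sum_congr rfl fun a _ => cast_lamI hrn (hI j) a

theorem prod_omegaCls_ne_zero_iff (hrn : r ≤ n) {s : ℕ} {I : Fin s → Fin r → Fin n}
    (hI : ∀ j, StrictMono (I j)) :
    ∏ j, omegaCls (I j) ≠ 0 ↔ ∃ e, minorPoly (r := r) (q := n - r)
      (diagRow (n - r) fun j => lamI (I j)) (diagCol (n - r) fun j => lamI (I j)) e ≠ 0 := by
  rw [← prod_schurP_notMem_iff_minorPoly hrn _ fun j => isBox_lamI (hI j)]
  simp only [omegaCls]
  rw [← map_prod, Ne, Ideal.Quotient.eq_zero_iff_mem,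
    Finset.prod_congr rfl fun j _ => schurI_eq_schurP hrn (hI j)]

end Index

section HomSpace
variable {k M Q : Type} [Field k] [AddCommGroup M] [Module k M] [AddCommGroup Q] [Module k Q]
  {n r s : ℕ}

theorem mem_homConstraint {p : Submodule k M} {q : Submodule k Q} {φ : M →ₗ[k] Q} :
    φ ∈ homConstraint p q ↔ ∀ x ∈ p, φ x ∈ q := by
  rw [homConstraint, LinearMap.mem_ker, LinearMap.ext_iff]
  simp

theorem mem_spanFlag_iff {q : ℕ} (g : Basis (Fin q) k Q) (m : ℕ) (y : Q) :
    y ∈ spanFlag k g m ↔ ∀ b : Fin q, m ≤ (b : ℕ) → g.coord b y = 0 := by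
  rw [spanFlag, Basis.mem_span_image]
  constructor
  · intro h b hb
    by_contra h0
    have := h (Finsupp.mem_support_iff.2 h0 : b ∈ (g.repr y).support)
    simp only [Set.mem_ofPred_eq] at this
    lia
  · intro h b hb
    simp only [Set.mem_ofPred_eq]
    by_contra h0
    exact Finsupp.mem_support_iff.1 hb (h b (by lia))

theorem spanFlag_mono {q : ℕ} (g : Fin q → Q) : Monotone (spanFlag k g) := fun _ _ h =>
  span_mono (Set.image_mono fun _ ha => lt_of_lt_of_le ha h)

theorem mem_homSpace_spanFlag_iff {I : Fin s → Fin r → Fin n} (hI : ∀ j, StrictMono (I j))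
    (f : Fin s → Fin r → M) (G : Fin s → ℕ → Submodule k Q) (hG : ∀ j, Monotone (G j))
    {φ : M →ₗ[k] Q} : φ ∈ homSpace I (fun j => spanFlag k (f j)) G ↔
      ∀ j a, φ (f j a) ∈ G j (I j a - a) := by
  simp only [homSpace, mem_iInf, mem_homConstraint]
  refine forall_congr' fun j => ⟨fun h a => ?_, fun h a x hx => ?_⟩
  · exact h a _ (subset_span ⟨a, Nat.lt_succ_self _, rfl⟩)
  · have hle : spanFlag k (f j) (a + 1) ≤ (G j (I j a - a)).comap φ := by
      refine span_le.2 ?_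
      rintro _ ⟨b, hb, rfl⟩
      refine hG j ?_ (h b)
      have h1 : b ≤ a := Fin.le_def.2 (Nat.lt_succ_iff.1 hb)
      have := strictMono_add_le_add (hI j) h1
      lia
    exact hle hx

/-- The matrix of a linear map, as a linearly independent family of functionals. -/
def matFunctional {q : ℕ} (bM : Basis (Fin r) k M) (bQ : Basis (Fin q) k Q)
    (p : Fin r × Fin q) : Dual k (M →ₗ[k] Q) := bQ.coord p.2 ∘ₗ LinearMap.applyₗ (bM p.1)

theorem linearIndependent_matFunctional {q : ℕ} (bM : Basis (Fin r) k M)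
    (bQ : Basis (Fin q) k Q) : LinearIndependent k (matFunctional bM bQ) := by
  classical
  rw [Fintype.linearIndependent_iff]
  intro w hw p
  have h := LinearMap.congr_fun hw (bM.constr k (Pi.single p.1 (bQ p.2)))
  simp only [LinearMap.sum_apply, LinearMap.smul_apply, matFunctional, LinearMap.comp_apply,
    LinearMap.applyₗ_apply_apply, Basis.constr_basis, LinearMap.zero_apply, Basis.coord_apply] at h
  rw [Finset.sum_eq_single p] at h
  · simpa using h
  · rintro ⟨c, d⟩ - hne
    by_cases hc : c = p.1
    · subst hc
      have hd : p.2 ≠ d := fun hd => hne (by rw [← hd])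
      simp [hd]
    · simp [Pi.single_eq_of_ne hc]
  · simp

variable (I : Fin s → Fin r → Fin n)

/-- The coordinates of bases `f` of `M` in a reference basis. -/
def rowCoord (bM : Basis (Fin r) k M) (f : Fin s → Fin r → M) (x : Σ _ : Fin s, Fin r) :
    Fin r → k := fun c => bM.repr (f x.1 x.2) c

/-- The dual coordinates, in reverse order, of bases `g` of `Q` in a reference basis. -/
def colCoord {q : ℕ} (bQ : Basis (Fin q) k Q) (g : Fin s → Basis (Fin q) k Q)
    (x : Σ _ : Fin s, Fin q) : Fin q → k := fun c => (g x.1).coord (Fin.rev x.2) (bQ c)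

theorem sum_tensorFam_smul_matFunctional {q : ℕ} {X : Type} (ρ : X → Σ _ : Fin s, Fin r)
    (γ : X → Σ _ : Fin s, Fin q) (bM : Basis (Fin r) k M) (bQ : Basis (Fin q) k Q)
    (f : Fin s → Fin r → M) (g : Fin s → Basis (Fin q) k Q) (x : X) (φ : M →ₗ[k] Q) :
    (∑ p, tensorFam ρ γ (rowCoord bM f) (colCoord bQ g) x p • matFunctional bM bQ p) φ
      = (g (γ x).1).coord (Fin.rev (γ x).2) (φ (f (ρ x).1 (ρ x).2)) := by
  conv_rhs => rw [← bM.sum_repr (f (ρ x).1 (ρ x).2), map_sum, map_sum]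
  rw [LinearMap.sum_apply, Fintype.sum_prod_type]
  refine Finset.sum_congr rfl fun c _ => ?_
  rw [map_smul, map_smul, smul_eq_mul]
  conv_rhs => rw [← bQ.sum_repr (φ (bM c)), map_sum, Finset.mul_sum]
  refine Finset.sum_congr rfl fun d _ => ?_
  simp only [LinearMap.smul_apply, tensorFam, rowCoord, colCoord, matFunctional,
    LinearMap.comp_apply, LinearMap.applyₗ_apply_apply, map_smul, smul_eq_mul, Basis.coord_apply]
  ring

theorem finrank_homSpace_eq_iff (hrn : r ≤ n) {I : Fin s → Fin r → Fin n}
    (hI : ∀ j, StrictMono (I j)) (bM : Basis (Fin r) k M) (bQ : Basis (Fin (n - r)) k Q)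
    (f : Fin s → Fin r → M) (g : Fin s → Basis (Fin (n - r)) k Q) :
    (finrank k (homSpace I (fun j => spanFlag k (f j)) (fun j => spanFlag k (g j))) : ℤ)
        = (r : ℤ) * ((n : ℤ) - (r : ℤ)) - ∑ j, codimZ n r (I j) ↔
      LinearIndependent k (tensorFam (diagRow (n - r) fun j => lamI (I j))
        (diagCol (n - r) fun j => lamI (I j)) (rowCoord bM f) (colCoord bQ g)) := by
  classical
  have : FiniteDimensional k M := bM.finiteDimensional_of_finite
  have : FiniteDimensional k Q := bQ.finiteDimensional_of_finite
  set ρ := diagRow (n - r) fun j => lamI (I j) with hρ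
  set γ := diagCol (n - r) fun j => lamI (I j) with hγ
  set v := tensorFam ρ γ (rowCoord bM f) (colCoord bQ g) with hv
  let Θ : (Fin r × Fin (n - r) → k) →ₗ[k] Dual k (M →ₗ[k] Q) :=
    Fintype.linearCombination k (matFunctional bM bQ)
  have hΘ : LinearMap.ker Θ = ⊥ :=
    LinearMap.ker_eq_bot.2
      (linearIndependent_matFunctional bM bQ).fintypeLinearCombination_injective
  have happ : ∀ x φ, Θ (v x) φ = (g (γ x).1).coord (Fin.rev (γ x).2) (φ (f (ρ x).1 (ρ x).2)) :=
    fun x φ => sum_tensorFam_smul_matFunctional ρ γ bM bQ f g x φ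
  have hspace : homSpace I (fun j => spanFlag k (f j)) (fun j => spanFlag k (g j))
      = (span k (Set.range (Θ ∘ v))).dualCoannihilator := by
    ext φ
    rw [mem_homSpace_spanFlag_iff hI f _ fun j => spanFlag_mono _, mem_dualCoannihilator]
    have h1 : (∀ ψ ∈ span k (Set.range (Θ ∘ v)), ψ φ = 0) ↔ ∀ x, Θ (v x) φ = 0 := by
      constructor
      · intro h x
        exact h _ (subset_span ⟨x, rfl⟩)
      · intro h ψ hψ
        have : span k (Set.range (Θ ∘ v)) ≤ LinearMap.ker (Dual.eval k (M →ₗ[k] Q) φ) := by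
          refine span_le.2 ?_
          rintro _ ⟨x, rfl⟩
          exact h x
        exact this hψ
    rw [h1]
    simp only [happ, mem_spanFlag_iff]
    constructor
    · rintro h ⟨j, p, hp⟩
      refine h j p.1 (Fin.rev p.2) ?_
      simp only [mem_diagram, lamI] at hp
      rw [Fin.val_rev]
      have := strictMono_val_le (hI j) p.1
      have := p.2.2
      lia
    · intro h j a b hb
      have h2 := h ⟨j, (a, Fin.rev b), by
        simp only [mem_diagram, lamI, Fin.val_rev]
        have := strictMono_val_le (hI j) a
        have := b.2
        lia⟩
      change (g j).coord (Fin.rev (Fin.rev b)) (φ (f j a)) = 0 at h2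
      rwa [Fin.rev_rev] at h2
  have h3 := Subspace.finrank_add_finrank_dualCoannihilator_eq (span k (Set.range (Θ ∘ v)))
  rw [← hspace, finrank_linearMap, finrank_eq_card_basis bM, finrank_eq_card_basis bQ,
    Fintype.card_fin, Fintype.card_fin] at h3
  rw [← LinearMap.linearIndependent_iff Θ hΘ, linearIndependent_iff_card_eq_finrank_span,
    Set.finrank, ← card_diagSum_lamI hrn hI, ← Nat.cast_sub hrn, ← Nat.cast_mul, ← h3]
  lia

end HomSpace

section PolyFun
variable (k D : Type) [Field k] [AddCommGroup D] [Module k D]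

/-- The algebra of polynomial functions on a vector space. -/
def polyFun : Subalgebra k (D → k) :=
  (MvPolynomial.aeval (fun (l : Dual k D) (x : D) => l x)).range

variable {k D}

theorem mem_polyFun {F : D → k} : F ∈ polyFun k D ↔ ∃ p, ∀ x, F x = mEval k x p := by
  have h : ∀ (p : MvPolynomial (Dual k D) k) (x : D),
      MvPolynomial.aeval (fun (l : Dual k D) (x : D) => l x) p x = mEval k x p := by
    intro p x
    rw [mEval, ← MvPolynomial.coe_aeval_eq_eval]
    exact MvPolynomial.map_aeval (fun (l : Dual k D) (x : D) => l x)
      (Pi.evalRingHom (fun _ : D => k) x) p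
  rw [polyFun, AlgHom.mem_range]
  constructor
  · rintro ⟨p, rfl⟩
    exact ⟨p, h p⟩
  · rintro ⟨p, hp⟩
    exact ⟨p, funext fun x => (h p x).trans (hp x).symm⟩

theorem dual_mem_polyFun (l : Dual k D) : (fun x => l x) ∈ polyFun k D :=
  mem_polyFun.2 ⟨MvPolynomial.X l, fun x => by simp [mEval]⟩

theorem const_mem_polyFun (c : k) : (fun _ => c) ∈ polyFun k D :=
  Subalgebra.algebraMap_mem (polyFun k D) c

theorem det_mem_polyFun {X : Type} [Fintype X] [DecidableEq X] {A : D → Matrix X X k}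
    (h : ∀ x y, (fun b => A b x y) ∈ polyFun k D) : (fun b => (A b).det) ∈ polyFun k D := by
  have h1 : (fun b => (A b).det)
      = ∑ σ : Equiv.Perm X, Equiv.Perm.sign σ • ∏ x, fun b => A b (σ x) x := by
    ext b
    simp [Matrix.det_apply, Finset.sum_apply, Finset.prod_apply, Units.smul_def]
  rw [h1]
  refine Subalgebra.sum_mem _ fun σ _ => ?_
  rw [Units.smul_def]
  exact (polyFun k D).toSubring.zsmul_mem (Subalgebra.prod_mem _ fun x _ => h _ _) _

theorem adjugate_mem_polyFun {X : Type} [Fintype X] [DecidableEq X] {A : D → Matrix X X k}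
    (h : ∀ x y, (fun b => A b x y) ∈ polyFun k D) (x y : X) :
    (fun b => (A b).adjugate x y) ∈ polyFun k D := by
  simp only [Matrix.adjugate_apply]
  refine det_mem_polyFun fun z w => ?_
  by_cases hz : z = y
  · simp only [hz, Matrix.updateRow_self]
    exact const_mem_polyFun _
  · simp only [ne_eq, hz, not_false_eq_true, Matrix.updateRow_ne]
    exact h z w

theorem isOpen_ne_zero_of_mem_polyFun {F : D → k} (hF : F ∈ polyFun k D) :
    @IsOpen _ (mZariski k D) {x | F x ≠ 0} := by
  obtain ⟨p, hp⟩ := mem_polyFun.1 hF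
  refine TopologicalSpace.GenerateOpen.basic _ ⟨p, ?_⟩
  ext x
  simp only [Set.mem_ofPred_eq, hp]

end PolyFun

section Generic
variable {k : Type} [Field k] {n r s q : ℕ}

/-- A minor of the family of rank one matrices attached to tuples of bases, with denominators
cleared. -/
def flagMinor {X : Type} [Fintype X] [DecidableEq X] (ρ : X → Σ _ : Fin s, Fin r)
    (γ : X → Σ _ : Fin s, Fin q) (e : X → Fin r × Fin q)
    (b : (Fin s → Fin r → Fin r → k) × (Fin s → Fin q → Fin q → k)) : k :=
  Matrix.det (Matrix.of fun x y => tensorFam ρ γ (fun z => b.1 z.1 z.2)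
    (fun z c => (Matrix.of (b.2 z.1)).adjugate c (Fin.rev z.2)) x (e y))

variable {X : Type} [Fintype X] [DecidableEq X] (ρ : X → Σ _ : Fin s, Fin r)
    (γ : X → Σ _ : Fin s, Fin q) (e : X → Fin r × Fin q)

theorem fst_entry_mem_polyFun (j : Fin s) (a c : Fin r) :
    (fun b : (Fin s → Fin r → Fin r → k) × (Fin s → Fin q → Fin q → k) => b.1 j a c)
      ∈ polyFun k ((Fin s → Fin r → Fin r → k) × (Fin s → Fin q → Fin q → k)) :=
  dual_mem_polyFun (k := k) (D := (Fin s → Fin r → Fin r → k) × (Fin s → Fin q → Fin q → k))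
    { toFun := fun b => b.1 j a c
      map_add' := fun _ _ => rfl
      map_smul' := fun _ _ => rfl }

theorem snd_entry_mem_polyFun (j : Fin s) (a c : Fin q) :
    (fun b : (Fin s → Fin r → Fin r → k) × (Fin s → Fin q → Fin q → k) => b.2 j a c)
      ∈ polyFun k ((Fin s → Fin r → Fin r → k) × (Fin s → Fin q → Fin q → k)) :=
  dual_mem_polyFun (k := k) (D := (Fin s → Fin r → Fin r → k) × (Fin s → Fin q → Fin q → k))
    { toFun := fun b => b.2 j a c
      map_add' := fun _ _ => rfl
      map_smul' := fun _ _ => rfl }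

theorem flagMinor_mem_polyFun : flagMinor (k := k) ρ γ e ∈ polyFun k _ :=
  det_mem_polyFun fun _ _ => Subalgebra.mul_mem _ (fst_entry_mem_polyFun _ _ _)
    (adjugate_mem_polyFun (fun c d => snd_entry_mem_polyFun _ c d) _ _)

theorem flagMinor_eq (b : (Fin s → Fin r → Fin r → k) × (Fin s → Fin q → Fin q → k))
    (C : Fin s → Matrix (Fin q) (Fin q) k) (hC : ∀ j, C j * Matrix.of (b.2 j) = 1) :
    flagMinor ρ γ e b = (∏ x, (Matrix.of (b.2 (γ x).1)).det) *
      Matrix.det (Matrix.of fun x y => tensorFam ρ γ (fun z => b.1 z.1 z.2)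
        (fun z c => C z.1 c (Fin.rev z.2)) x (e y)) := by
  rw [flagMinor, ← Matrix.det_mul_column]
  congr 1
  ext x y
  have h : (Matrix.of (b.2 (γ x).1)).adjugate = (Matrix.of (b.2 (γ x).1)).det • C (γ x).1 := by
    have h1 := congrArg (· * (Matrix.of (b.2 (γ x).1)).adjugate) (hC (γ x).1)
    simp only [Matrix.mul_assoc, Matrix.mul_adjugate, Matrix.one_mul, Matrix.mul_smul,
      Matrix.mul_one] at h1
    exact h1.symm
  simp only [Matrix.of_apply, tensorFam, h, Matrix.smul_apply, smul_eq_mul]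
  ring

theorem isUnit_of_iff_linearIndependent (v : Fin q → Fin q → k) :
    (Matrix.of v).det ≠ 0 ↔ LinearIndependent k v := by
  rw [← isUnit_iff_ne_zero, ← Matrix.isUnit_iff_isUnit_det,
    ← Matrix.linearIndependent_rows_iff_isUnit]
  rfl

/-- A linearly independent `q`-tuple in `k^q` as a basis. -/
def basisOfLI {v : Fin q → Fin q → k} (h : LinearIndependent k v) : Basis (Fin q) k (Fin q → k) :=
  basisOfLinearIndependentOfCardEqFinrank' v h (by simp)

theorem coe_basisOfLI {v : Fin q → Fin q → k} (h : LinearIndependent k v) : ⇑(basisOfLI h) = v := by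
  simp [basisOfLI]

theorem coord_mul_of {v : Fin q → Fin q → k} (g : Basis (Fin q) k (Fin q → k)) (hg : ⇑g = v) :
    (Matrix.of fun c d => g.coord d (Pi.basisFun k (Fin q) c)) * Matrix.of v = 1 := by
  ext c d
  have h := congrFun (g.sum_repr (Pi.basisFun k (Fin q) c)) d
  rw [Finset.sum_apply] at h
  rw [Matrix.mul_apply]
  simp only [Matrix.of_apply, Basis.coord_apply, ← hg]
  simp only [Pi.smul_apply, smul_eq_mul] at h
  rw [h, Matrix.one_apply, Pi.basisFun_apply, Pi.single_apply]
  simp only [eq_comm]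

theorem linearIndependent_tensorFam_of_flagMinor_ne_zero
    (b : (Fin s → Fin r → Fin r → k) × (Fin s → Fin q → Fin q → k))
    (g : Fin s → Basis (Fin q) k (Fin q → k)) (hg : ∀ j, ⇑(g j) = b.2 j)
    (h : flagMinor ρ γ e b ≠ 0) :
    LinearIndependent k (tensorFam ρ γ (rowCoord (Pi.basisFun k (Fin r)) b.1)
      (colCoord (Pi.basisFun k (Fin q)) g)) := by
  rw [flagMinor_eq ρ γ e b _ fun j => coord_mul_of (g j) (hg j)] at h
  refine linearIndependent_of_det_ne_zero (e := e) ?_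
  convert right_ne_zero_of_mul h using 3
  ext x y
  simp [tensorFam, rowCoord, colCoord]

theorem exists_flagMinor_ne_zero [CharZero k] (h : minorPoly (r := r) (q := q) ρ γ e ≠ 0) :
    ∃ b : (Fin s → Fin r → Fin r → k) × (Fin s → Fin q → Fin q → k), flagMinor ρ γ e b ≠ 0 ∧
      (∀ j, LinearIndependent k (b.1 j)) ∧ ∀ j, LinearIndependent k (b.2 j) := by
  have hl : ∏ j : Fin s, Matrix.det (Matrix.of fun a c : Fin r => (MvPolynomial.X
      (Sum.inl (⟨j, a⟩, c)) : MvPolynomial (((Σ _ : Fin s, Fin r) × Fin r) ⊕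
        ((Σ _ : Fin s, Fin q) × Fin q)) ℤ)) ≠ 0 := by
    refine Finset.prod_ne_zero_iff.2 fun j _ h0 => ?_
    have := congrArg (MvPolynomial.aeval (Sum.elim
      (fun z => (1 : Matrix (Fin r) (Fin r) ℤ) z.1.2 z.2) (fun _ => 0))) h0
    rw [AlgHom.map_det, map_zero] at this
    refine one_ne_zero ((Matrix.det_one (n := Fin r) (R := ℤ)).symm.trans (Eq.trans ?_ this))
    congr 1
    ext a c
    simp
  have hr : ∏ j : Fin s, Matrix.det (Matrix.of fun a c : Fin q => (MvPolynomial.X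
      (Sum.inr (⟨j, a⟩, c)) : MvPolynomial (((Σ _ : Fin s, Fin r) × Fin r) ⊕
        ((Σ _ : Fin s, Fin q) × Fin q)) ℤ)) ≠ 0 := by
    refine Finset.prod_ne_zero_iff.2 fun j _ h0 => ?_
    have := congrArg (MvPolynomial.aeval (Sum.elim (fun _ => 0)
      (fun z => (1 : Matrix (Fin q) (Fin q) ℤ) z.1.2 z.2))) h0
    rw [AlgHom.map_det, map_zero] at this
    refine one_ne_zero ((Matrix.det_one (n := Fin q) (R := ℤ)).symm.trans (Eq.trans ?_ this))
    congr 1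
    ext a c
    simp
  obtain ⟨t, ht⟩ := exists_aeval_ne_zero (K := k) (mul_ne_zero h (mul_ne_zero hl hr))
  rw [map_mul, map_mul, map_prod, map_prod, aeval_minorPoly] at ht
  have ht1 := left_ne_zero_of_mul ht
  have ht2 := Finset.prod_ne_zero_iff.1 (left_ne_zero_of_mul (right_ne_zero_of_mul ht))
  have ht3 := Finset.prod_ne_zero_iff.1 (right_ne_zero_of_mul (right_ne_zero_of_mul ht))
  let N : Fin s → Matrix (Fin q) (Fin q) k := fun j => Matrix.of fun d c => t (Sum.inr (⟨j, d⟩, c))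
  have hN : ∀ j, (N j).det ≠ 0 := fun j => by
    have h1 := ht3 j (Finset.mem_univ _)
    rw [AlgHom.map_det] at h1
    convert h1 using 2
    ext a c
    simp [N]
  let C : Fin s → Matrix (Fin q) (Fin q) k := fun j => ((N j).submatrix (Fin.revPerm) id).transpose
  have hC : ∀ j, (C j).det ≠ 0 := fun j => by
    rw [Matrix.det_transpose, Matrix.det_permute]
    refine mul_ne_zero ?_ (hN j)
    exact_mod_cast Units.ne_zero _
  let b : (Fin s → Fin r → Fin r → k) × (Fin s → Fin q → Fin q → k) :=
    (fun j a c => t (Sum.inl (⟨j, a⟩, c)), fun j c d => (C j)⁻¹ c d)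
  have hb : ∀ j, C j * Matrix.of (b.2 j) = 1 := fun j => by
    change C j * (C j)⁻¹ = 1
    exact Matrix.mul_nonsing_inv _ (isUnit_iff_ne_zero.2 (hC j))
  have hb2 : ∀ j, (Matrix.of (b.2 j)).det ≠ 0 := fun j => by
    have h1 := congrArg Matrix.det (hb j)
    rw [Matrix.det_mul, Matrix.det_one] at h1
    exact right_ne_zero_of_mul (h1.trans_ne one_ne_zero)
  refine ⟨b, ?_, fun j => ?_, fun j => ?_⟩
  · rw [flagMinor_eq ρ γ e b C hb]
    refine mul_ne_zero (Finset.prod_ne_zero_iff.2 fun x _ => hb2 _) ?_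
    convert ht1 using 4 with x y
    simp [b, C, N]
  · rw [← isUnit_of_iff_linearIndependent]
    have h1 := ht2 j (Finset.mem_univ _)
    rw [AlgHom.map_det] at h1
    convert h1 using 2
    ext a c
    simp [b]
  · rw [← isUnit_of_iff_linearIndependent]
    exact hb2 j

theorem genericFlagPairs_of_prod_omegaCls_ne_zero [CharZero k] (hrn : r ≤ n)
    {I : Fin s → Fin r → Fin n} (hI : ∀ j, StrictMono (I j)) (h : ∏ j, omegaCls (I j) ≠ 0) :
    GenericFlagPairs k (M := Fin r → k) (Q := Fin (n - r) → k) s r (n - r)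
      (fun F G => (finrank k (homSpace I F G) : ℤ)
        = (r : ℤ) * ((n : ℤ) - (r : ℤ)) - ∑ j, codimZ n r (I j)) := by
  obtain ⟨e, he⟩ := (prod_omegaCls_ne_zero_iff hrn hI).1 h
  obtain ⟨b, hb, hb1, hb2⟩ := exists_flagMinor_ne_zero (k := k) _ _ e he
  refine ⟨_, isOpen_ne_zero_of_mem_polyFun (flagMinor_mem_polyFun _ _ e), ⟨b, hb, hb1, hb2⟩, ?_⟩
  rintro b hb ⟨-, hb2⟩
  have h1 := linearIndependent_tensorFam_of_flagMinor_ne_zero _ _ e b (fun j => basisOfLI (hb2 j))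
    (fun j => coe_basisOfLI (hb2 j)) hb
  have h2 := (finrank_homSpace_eq_iff hrn hI (Pi.basisFun k (Fin r)) (Pi.basisFun k (Fin (n - r)))
    b.1 fun j => basisOfLI (hb2 j)).2 h1
  have h3 : (fun j => spanFlag k ⇑(basisOfLI (hb2 j))) = fun j => spanFlag k (b.2 j) :=
    funext fun j => congrArg _ (coe_basisOfLI (hb2 j))
  rw [h3] at h2
  exact h2

end Generic

section AdaptedBasis
variable {k W : Type} [Field k] [AddCommGroup W] [Module k W] {n r : ℕ}

theorem finrank_span_image_basis (v : Basis (Fin n) k W) (s : Finset (Fin n)) :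
    finrank k (span k (v '' s)) = s.card := by
  classical
  have h : LinearIndependent k fun x : s => v x := v.linearIndependent.comp _ Subtype.val_injective
  have h2 := finrank_span_eq_card h
  rw [Fintype.card_coe] at h2
  rw [← h2, Set.image_eq_range]
  rfl

theorem span_image_inf_span_image (v : Basis (Fin n) k W) (s t : Set (Fin n)) :
    span k (v '' s) ⊓ span k (v '' t) = span k (v '' (s ∩ t)) := by
  ext x
  simp only [mem_inf, Basis.mem_span_image, Set.subset_inter_iff]

theorem isFlag_spanFlag (v : Basis (Fin n) k W) : IsFlag (spanFlag k v) := by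
  refine ⟨spanFlag_mono v, fun m => ?_⟩
  have h := finrank_span_image_basis v (Finset.univ.filter fun a : Fin n => (a : ℕ) < m)
  rw [card_filter_val_lt] at h
  rw [finrank_eq_card_basis v, Fintype.card_fin, ← h, spanFlag]
  have h2 : {a : Fin n | (a : ℕ) < m}
      = (Finset.univ.filter fun a : Fin n => (a : ℕ) < m : Finset (Fin n)) := by
    ext x
    simp
  rw [h2]

theorem cellMem_spanFlag (v : Basis (Fin n) k W) {i : Fin r → Fin n} (hi : StrictMono i) :
    cellMem i (spanFlag k v) (span k (Set.range (v ∘ i))) := by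
  classical
  constructor
  · rw [finrank_span_eq_card (v.linearIndependent.comp i hi.injective), Fintype.card_fin]
  · intro u _
    have h := finrank_span_image_basis v
      ((Finset.univ.filter fun a : Fin r => (i a : ℕ) + 1 ≤ u).map ⟨i, hi.injective⟩)
    rw [Finset.card_map] at h
    have h2 : Set.range i ∩ {a | (a : ℕ) < u} = ((Finset.univ.filter fun a : Fin r =>
        (i a : ℕ) + 1 ≤ u).map ⟨i, hi.injective⟩ : Set (Fin n)) := by
      ext x
      simp only [Set.mem_inter_iff, Set.mem_range, Set.mem_ofPred_eq, Finset.coe_map,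
        Function.Embedding.coeFn_mk, Set.mem_image, Finset.coe_filter, Finset.mem_univ, true_and]
      constructor
      · rintro ⟨⟨a, rfl⟩, h⟩
        exact ⟨a, h, rfl⟩
      · rintro ⟨a, h, rfl⟩
        exact ⟨⟨a, rfl⟩, h⟩
    rw [← h, Set.range_comp, spanFlag, span_image_inf_span_image, h2]

theorem exists_mem_notMem_of_finrank_lt [FiniteDimensional k W] {p q : Submodule k W}
    (h : finrank k p < finrank k q) : ∃ x ∈ q, x ∉ p := by
  by_contra! hall
  exact absurd (finrank_mono (hall : q ≤ p)) (not_le.2 h)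

theorem exists_adapted_basis (hW : finrank k W = n) [FiniteDimensional k W]
    {i : Fin r → Fin n} (hi : StrictMono i) {E : ℕ → Submodule k W} (hE : IsFlag E)
    {T : Submodule k W} (hT : cellMem i E T) :
    ∃ v : Basis (Fin n) k W, E = spanFlag k v ∧ T = span k (Set.range (v ∘ i)) := by
  have hx : ∀ u : Fin n, ∃ x ∈ E (u + 1), x ∉ E u ∧ ((∃ a, i a = u) → x ∈ T) := by
    intro u
    by_cases hu : ∃ a, i a = u
    · obtain ⟨a, rfl⟩ := hu
      have h1 := hT.2 (i a) (i a).2.le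
      have h2 := hT.2 (i a + 1) (i a).2
      have h3 : finrank k ↥(T ⊓ E (i a)) < finrank k ↥(T ⊓ E (i a + 1)) := by
        rw [h1, h2]
        refine Finset.card_lt_card (Finset.ssubset_iff_of_subset ?_ |>.2 ⟨a, by simp, by simp⟩)
        intro b
        simp only [Finset.mem_filter, Finset.mem_univ, true_and]
        lia
      obtain ⟨x, hx, hx'⟩ := exists_mem_notMem_of_finrank_lt h3
      exact ⟨x, hx.2, fun h => hx' ⟨hx.1, h⟩, fun _ => hx.1⟩
    · have h3 : finrank k ↥(E u) < finrank k ↥(E (u + 1)) := by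
        rw [hE.2, hE.2, hW]
        have := u.2
        lia
      obtain ⟨x, hx, hx'⟩ := exists_mem_notMem_of_finrank_lt h3
      exact ⟨x, hx, hx', fun h => absurd h hu⟩
  choose w hw1 hw2 hw3 using hx
  have hspan : ∀ m : ℕ, m ≤ n → E m = spanFlag k w m := by
    intro m
    induction m with
    | zero =>
      intro _
      have h0 : finrank k (E 0) = 0 := by rw [hE.2]; simp
      rw [finrank_eq_zero.1 h0]
      simp [spanFlag]
    | succ m ih =>
      intro hm
      refine le_antisymm ?_ (span_le.2 ?_)
      · have h1 : E m ⊔ span k {w ⟨m, hm⟩} = E (m + 1) := by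
          refine eq_of_le_of_finrank_le (sup_le (hE.1 m.le_succ)
            ((span_singleton_le_iff_mem _ _).2 (hw1 ⟨m, hm⟩))) ?_
          have h2 : finrank k (E m) < finrank k ↥(E m ⊔ span k {w ⟨m, hm⟩}) := by
            refine finrank_lt_finrank_of_lt (left_lt_sup.2 fun h => hw2 ⟨m, hm⟩ ?_)
            exact (span_singleton_le_iff_mem _ _).1 h
          rw [hE.2, hW] at h2 ⊢
          lia
        rw [← h1, ih (by lia)]
        refine sup_le (spanFlag_mono w m.le_succ) ((span_singleton_le_iff_mem _ _).2 ?_)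
        exact subset_span ⟨⟨m, hm⟩, Nat.lt_succ_self _, rfl⟩
      · rintro _ ⟨a, ha, rfl⟩
        exact hE.1 (Nat.succ_le_of_lt ha) (hw1 a)
  have htop : ⊤ ≤ span k (Set.range w) := by
    have h1 : E n = ⊤ := by
      refine eq_top_of_finrank_eq ?_
      rw [hE.2, hW, min_self]
    rw [← h1, hspan n le_rfl]
    exact span_mono (Set.image_subset_range _ _)
  let v : Basis (Fin n) k W := basisOfTopLeSpanOfCardEqFinrank w htop (by simp [hW])
  have hv : ⇑v = w := coe_basisOfTopLeSpanOfCardEqFinrank w htop _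
  refine ⟨v, ?_, ?_⟩
  · funext m
    by_cases hm : m ≤ n
    · rw [hspan m hm, hv]
    · have h1 : ∀ F : ℕ → Submodule k W, IsFlag F → F m = ⊤ := fun F hF => by
        refine eq_top_of_finrank_eq ?_
        rw [hF.2, hW]
        lia
      rw [h1 E hE, h1 _ (isFlag_spanFlag v)]
  · refine (eq_of_le_of_finrank_le (span_le.2 ?_) ?_).symm
    · rintro _ ⟨a, rfl⟩
      simp only [Function.comp_apply, hv]
      exact hw3 _ ⟨a, rfl⟩
    · rw [hT.1, finrank_span_eq_card (v.linearIndependent.comp i hi.injective), Fintype.card_fin]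

theorem cellMem_map {i : Fin r → Fin n} {E : ℕ → Submodule k W} {T : Submodule k W}
    (hT : cellMem i E T) (g : W ≃ₗ[k] W) (hg : ∀ u, (E u).map (g : W →ₗ[k] W) = E u) :
    cellMem i E (T.map (g : W →ₗ[k] W)) := by
  constructor
  · rw [LinearEquiv.finrank_map_eq, hT.1]
  · intro u hu
    rw [← hT.2 u hu]
    conv_lhs => rw [← hg u, ← Submodule.map_inf _ g.injective]
    exact LinearEquiv.finrank_map_eq g _

end AdaptedBasis

section Derivative
open Polynomial
variable {k D : Type} [Field k] [AddCommGroup D] [Module k D]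

theorem eval_aeval_curve (p : MvPolynomial (Dual k D) k) (γ : Dual k D → k[X]) {t : k} {x : D}
    (h : ∀ l, (γ l).eval t = l x) : (MvPolynomial.aeval γ p).eval t = mEval k x p := by
  have h2 := MvPolynomial.map_aeval γ (Polynomial.evalRingHom t) p
  rw [Polynomial.coe_evalRingHom] at h2
  rw [h2, MvPolynomial.coe_eval₂Hom, mEval, MvPolynomial.eval]
  have h3 : (Polynomial.evalRingHom t).comp (algebraMap k k[X]) = RingHom.id k := by
    ext
    simp
  rw [h3, MvPolynomial.coe_eval₂Hom]
  congr 1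
  funext l
  exact h l

theorem derivative_curve (p : MvPolynomial (Dual k D) k) (γ : Dual k D → k[X]) (x y : D)
    (h0 : ∀ l, (γ l).eval 0 = l x) (h1 : ∀ l, (derivative (γ l)).eval 0 = l y) :
    (derivative (MvPolynomial.aeval γ p)).eval 0
      = (∑ l ∈ p.vars, mEval k x (MvPolynomial.pderiv l p) • (l : Dual k D)) y := by
  classical
  have hev : ∀ p : MvPolynomial (Dual k D) k, (MvPolynomial.aeval γ p).eval 0 = mEval k x p :=
    fun p => eval_aeval_curve p γ h0
  have key : ∀ p : MvPolynomial (Dual k D) k, ∃ s₀ : Finset (Dual k D), ∀ s, s₀ ⊆ s →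
      (derivative (MvPolynomial.aeval γ p)).eval 0
        = ∑ l ∈ s, mEval k x (MvPolynomial.pderiv l p) * l y := by
    intro p
    induction p using MvPolynomial.induction_on with
    | C a =>
      refine ⟨∅, fun s _ => ?_⟩
      simp [mEval]
    | add p q hp hq =>
      obtain ⟨s, hs⟩ := hp
      obtain ⟨t, ht⟩ := hq
      refine ⟨s ∪ t, fun u hu => ?_⟩
      rw [map_add, derivative_add, eval_add, hs u (Finset.union_subset_left hu),
        ht u (Finset.union_subset_right hu), ← Finset.sum_add_distrib]
      refine Finset.sum_congr rfl fun l _ => ?_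
      rw [map_add, mEval, mEval, mEval, map_add, add_mul]
    | mul_X p l₀ hp =>
      obtain ⟨s, hs⟩ := hp
      refine ⟨insert l₀ s, fun u hu => ?_⟩
      rw [map_mul, derivative_mul, eval_add, eval_mul, eval_mul, MvPolynomial.aeval_X, h0, h1,
        hev, hs u ((Finset.subset_insert _ _).trans hu), Finset.sum_mul]
      have h2 : mEval k x p * l₀ y = ∑ l ∈ u, if l = l₀ then mEval k x p * l₀ y else 0 := by
        rw [Finset.sum_ite_eq' u l₀, if_pos (hu (Finset.mem_insert_self _ _))]
      rw [h2, ← Finset.sum_add_distrib]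
      refine Finset.sum_congr rfl fun l _ => ?_
      rw [MvPolynomial.pderiv_mul, MvPolynomial.pderiv_X]
      simp only [mEval, map_add, map_mul, MvPolynomial.eval_X]
      by_cases hl : l = l₀
      · subst hl
        simp only [if_true, Pi.single_eq_same, map_one]
        ring
      · rw [if_neg hl, Pi.single_eq_of_ne (Ne.symm hl)]
        simp only [map_zero]
        ring
  obtain ⟨s₀, hs₀⟩ := key p
  rw [hs₀ (s₀ ∪ p.vars) Finset.subset_union_left, LinearMap.sum_apply]
  refine (Finset.sum_subset Finset.subset_union_right fun l _ hl => ?_).symm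
  rw [MvPolynomial.pderiv_eq_zero_of_notMem_vars hl]
  simp [mEval]

theorem mem_mTangent_iff {A : Set D} {x y : D} : y ∈ mTangent k A x ↔
    ∀ p : MvPolynomial (Dual k D) k, (∀ a ∈ A, mEval k a p = 0) →
      (∑ l ∈ p.vars, mEval k x (MvPolynomial.pderiv l p) • (l : Dual k D)) y = 0 := by
  simp only [mTangent, mem_iInf, LinearMap.mem_ker]
  rfl

end Derivative

section Tangent
open Polynomial
variable {k W : Type} [Field k] [AddCommGroup W] [Module k W] {n r : ℕ}

/-- The basis of a coordinate subspace. -/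
def coordBasis (v : Basis (Fin n) k W) {i : Fin r → Fin n} (hi : StrictMono i) :
    Basis (Fin r) k (span k (Set.range (v ∘ i))) :=
  Basis.span (v.linearIndependent.comp i hi.injective)

theorem coe_coordBasis (v : Basis (Fin n) k W) {i : Fin r → Fin n} (hi : StrictMono i)
    (a : Fin r) : (coordBasis v hi a : W) = v (i a) := by
  rw [coordBasis, Basis.span_apply]
  rfl

theorem finrank_graphMap_inf_le (v : Basis (Fin n) k W) {i : Fin r → Fin n} (hi : StrictMono i)
    {C : Submodule k W} (χ : span k (Set.range (v ∘ i)) →ₗ[k] C) (a : Fin r)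
    (lam : {b : Fin r // a ≤ b} → W →ₗ[k] k)
    (hlam : ∀ c, spanFlag k v (i a + 1) ≤ LinearMap.ker (lam c))
    (hr : finrank k (graphMap _ C χ) = r)
    (hdet : Matrix.det (Matrix.of fun b c : {b : Fin r // a ≤ b} =>
      lam c (coordBasis v hi b + χ (coordBasis v hi b))) ≠ 0) :
    finrank k ↥(graphMap _ C χ ⊓ spanFlag k v (i a + 1)) ≤ a := by
  have : FiniteDimensional k W := v.finiteDimensional_of_finite
  let G := graphMap _ C χ
  let L : W →ₗ[k] ({b : Fin r // a ≤ b} → k) := LinearMap.pi lam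
  have hli : LinearIndependent k (Matrix.of fun b c : {b : Fin r // a ≤ b} =>
      lam c (coordBasis v hi b + χ (coordBasis v hi b))).row := by
    rw [Matrix.linearIndependent_rows_iff_isUnit, Matrix.isUnit_iff_isUnit_det]
    exact hdet.isUnit
  have h1 : Fintype.card {b : Fin r // a ≤ b} ≤ finrank k (LinearMap.range (L.domRestrict G)) := by
    rw [← finrank_span_eq_card hli]
    refine finrank_mono (span_le.2 ?_)
    rintro _ ⟨b, rfl⟩
    refine ⟨⟨coordBasis v hi b + χ (coordBasis v hi b), ⟨coordBasis v hi b, rfl⟩⟩, ?_⟩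
    rfl
  have h2 := LinearMap.finrank_range_add_finrank_ker (L.domRestrict G)
  have h3 : finrank k ↥(G ⊓ spanFlag k v (i a + 1))
      ≤ finrank k (LinearMap.ker (L.domRestrict G)) := by
    have h4 : G ⊓ spanFlag k v (i a + 1) ≤ (LinearMap.ker (L.domRestrict G)).map G.subtype := by
      rintro x ⟨hx, hx'⟩
      refine ⟨⟨x, hx⟩, ?_, rfl⟩
      rw [SetLike.mem_coe, LinearMap.mem_ker]
      funext c
      exact hlam c hx'
    refine (finrank_mono h4).trans (le_of_eq ?_)
    exact finrank_map_subtype_eq _ _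
  have h5 : Fintype.card {b : Fin r // a ≤ b} = r - a := by
    rw [Fintype.card_subtype]
    have := Fin.card_Ici a
    rw [← this]
    congr 1
    ext b
    simp
  rw [hr] at h2
  have := a.2
  change finrank k ↥(G ⊓ spanFlag k v (i a + 1)) ≤ a
  lia

theorem card_filter_le_strictMono {i : Fin r → Fin n} (hi : StrictMono i) (a : Fin r) :
    (Finset.univ.filter fun b : Fin r => (i b : ℕ) + 1 ≤ i a + 1).card = a + 1 := by
  rw [← Fin.card_Iic a]
  congr 1
  ext b
  simp only [Finset.mem_filter, Finset.mem_univ, true_and, Finset.mem_Iic,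
    Nat.add_le_add_iff_right]
  exact hi.le_iff_le

theorem mem_sup_of_mem_mTangent [Infinite k] (v : Basis (Fin n) k W) {i : Fin r → Fin n}
    (hi : StrictMono i) {C : Submodule k W} {ψ : span k (Set.range (v ∘ i)) →ₗ[k] C}
    (hψ : ψ ∈ mTangent k {χ | graphMap _ C χ ∈ {V' | cellMem i (spanFlag k v) V'}} 0)
    (a : Fin r) :
    (ψ (coordBasis v hi a) : W) ∈ spanFlag k v (i a + 1) ⊔ span k (Set.range (v ∘ i)) := by
  classical
  by_contra hnot
  obtain ⟨ℓ, hℓ, hker⟩ := Submodule.exists_le_ker_of_notMem hnot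
  let a' : {b : Fin r // a ≤ b} := ⟨a, le_rfl⟩
  let lam : {b : Fin r // a ≤ b} → W →ₗ[k] k := fun c => if c = a' then ℓ else v.coord (i c)
  have hlam : ∀ c, spanFlag k v (i a + 1) ≤ LinearMap.ker (lam c) := by
    intro c
    by_cases hc : c = a'
    · simp only [lam, hc, if_true]
      exact le_sup_left.trans hker
    · simp only [lam, hc, if_false]
      intro x hx
      have h1 : i a < i c := hi (lt_of_le_of_ne c.2 fun h => hc (Subtype.ext h.symm))
      exact (mem_spanFlag_iff v _ x).1 hx (i c) (Fin.lt_def.1 h1)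
  let F : (span k (Set.range (v ∘ i)) →ₗ[k] C) → k := fun χ =>
    Matrix.det (Matrix.of fun b c : {b : Fin r // a ≤ b} =>
      lam c (coordBasis v hi b + χ (coordBasis v hi b)))
  have hF : F ∈ polyFun k (span k (Set.range (v ∘ i)) →ₗ[k] C) := by
    refine det_mem_polyFun fun b c => ?_
    simp only [Matrix.of_apply, map_add]
    exact Subalgebra.add_mem _ (const_mem_polyFun (lam c (coordBasis v hi b)))
      (dual_mem_polyFun (lam c ∘ₗ C.subtype ∘ₗ LinearMap.applyₗ (coordBasis v hi (b : Fin r))))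
  obtain ⟨p, hp⟩ := mem_polyFun.1 hF
  have hvan : ∀ χ ∈ {χ | graphMap _ C χ ∈ {V' | cellMem i (spanFlag k v) V'}},
      mEval k χ p = 0 := by
    intro χ hχ
    rw [← hp]
    by_contra h0
    have h1 := finrank_graphMap_inf_le v hi χ a lam hlam hχ.1 h0
    rw [hχ.2 _ (i a).2, card_filter_le_strictMono hi] at h1
    lia
  have hder := mem_mTangent_iff.1 hψ p hvan
  let γ : Dual k (span k (Set.range (v ∘ i)) →ₗ[k] C) → k[X] := fun l => X * Polynomial.C (l ψ)
  rw [← derivative_curve p γ 0 ψ (by simp [γ]) (by simp [γ])] at hder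
  let R : Matrix {b : Fin r // a ≤ b} {b : Fin r // a ≤ b} k[X] := Matrix.of fun b c =>
    if c = a' then Polynomial.C (ℓ (ψ (coordBasis v hi b)))
    else Polynomial.C (if b = c then 1 else 0) + X * Polynomial.C (lam c (ψ (coordBasis v hi b)))
  have hP : MvPolynomial.aeval γ p = X * R.det := by
    refine Polynomial.funext fun t => ?_
    rw [eval_aeval_curve p γ (x := t • ψ) (fun l => by
      simp only [γ, map_smul, eval_mul, eval_X, eval_C, smul_eq_mul]), ← hp, eval_mul, eval_X,
      ← Polynomial.coe_evalRingHom, RingHom.map_det]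
    have h1 : (∏ c : {b : Fin r // a ≤ b}, if c = a' then t else 1) = t := by
      rw [Finset.prod_ite_eq']
      simp
    conv_rhs => rw [← h1, ← Matrix.det_mul_row]
    refine congrArg Matrix.det (Matrix.ext fun b c => ?_)
    simp only [Matrix.of_apply, RingHom.mapMatrix_apply, Matrix.map_apply, R]
    have hb : (coordBasis v hi b : W) = v (i b) := coe_coordBasis v hi b
    by_cases hc : c = a'
    · simp only [hc, if_true, lam, map_add, LinearMap.smul_apply]
      have h2 : ℓ (coordBasis v hi b : W) = 0 := hker (mem_sup_right (coordBasis v hi b).2)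
      simp [h2]
    · simp only [hc, if_false, lam, map_add, LinearMap.smul_apply, hb]
      have h2 : v.coord (i c) (v (i b)) = if b = c then 1 else 0 := by
        rw [Basis.coord_apply, Basis.repr_self, Finsupp.single_apply]
        simp only [hi.injective.eq_iff, Subtype.ext_iff]
      rw [h2]
      simp [mul_comm t]
  rw [hP] at hder
  simp only [derivative_mul, derivative_X, one_mul, eval_add, eval_mul, eval_X, zero_mul,
    add_zero] at hder
  rw [← Polynomial.coe_evalRingHom, RingHom.map_det] at hder
  have hM : (Polynomial.evalRingHom (0 : k)).mapMatrix R
      = (1 : Matrix {b : Fin r // a ≤ b} {b : Fin r // a ≤ b} k).updateCol a'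
        fun b : {b : Fin r // a ≤ b} => ℓ (ψ (coordBasis v hi (b : Fin r))) := by
    ext b c
    by_cases hc : c = a'
    · subst hc
      simp [R]
    · by_cases hbc : b = c <;> simp [R, hc, hbc]
  rw [hM, ← Matrix.cramer_apply, Matrix.cramer_one] at hder
  exact hℓ hder

/-- A line of rank-one homomorphisms in a chart is, away from a point, the orbit of a coordinate
subspace under automorphisms that fix the flag. -/
theorem graphMap_smul_smulRight_mem_cell (v : Basis (Fin n) k W) {i : Fin r → Fin n}
    (hi : StrictMono i) {C : Submodule k W} (a : Fin r) {e : W}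
    (he : e ∈ spanFlag k v (i a + 1)) {τ : span k (Set.range (v ∘ i))} {c : C}
    (hc : (c : W) = e - τ) {t : k}
    (ht : 1 + t * (v.coord (i a) e - (coordBasis v hi).coord a τ) ≠ 0) :
    cellMem i (spanFlag k v)
      (graphMap _ C (t • ((coordBasis v hi).coord a).smulRight c)) := by
  have : FiniteDimensional k W := v.finiteDimensional_of_finite
  set x := coordBasis v hi with hx
  set w : W := e - x.coord a τ • v (i a) with hw
  let g₀ : W →ₗ[k] W := LinearMap.id + t • (v.coord (i a)).smulRight w
  have hg₀ : ∀ y, g₀ y = y + t • v.coord (i a) y • w := fun y => rfl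
  have hcw : v.coord (i a) w = v.coord (i a) e - x.coord a τ := by
    simp [hw]
  have hinj : Function.Injective g₀ := by
    rw [injective_iff_map_eq_zero]
    intro y hy
    rw [hg₀] at hy
    have h1 := congrArg (v.coord (i a)) hy
    rw [map_add, map_smul, map_smul, hcw, map_zero] at h1
    have h2 : v.coord (i a) y = 0 := by
      have h3 : (1 + t * (v.coord (i a) e - x.coord a τ)) * v.coord (i a) y = 0 := by
        rw [← h1, smul_eq_mul, smul_eq_mul]
        ring
      exact (mul_eq_zero.1 h3).resolve_left ht
    simpa [h2] using hy
  let g : W ≃ₗ[k] W := LinearEquiv.ofInjectiveEndo g₀ hinj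
  have hgc : (g : W →ₗ[k] W) = g₀ := LinearMap.ext fun _ => rfl
  have hg : ∀ u, (spanFlag k v u).map (g : W →ₗ[k] W) = spanFlag k v u := by
    intro u
    refine eq_of_le_of_finrank_eq ?_ (LinearEquiv.finrank_map_eq g _)
    rintro _ ⟨y, hy, rfl⟩
    rw [hgc, hg₀]
    refine add_mem hy (smul_mem _ _ ?_)
    by_cases hu : u ≤ i a
    · rw [Basis.coord_apply, ← Basis.coord_apply, (mem_spanFlag_iff v u y).1 hy (i a) hu, zero_smul]
      exact zero_mem _
    · push Not at hu
      refine smul_mem _ _ (sub_mem (spanFlag_mono v hu he) (smul_mem _ _ ?_))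
      exact subset_span ⟨i a, hu, rfl⟩
  have hle : (span k (Set.range (v ∘ i))).map (g : W →ₗ[k] W)
      ≤ graphMap _ C (t • (x.coord a).smulRight c) := by
    rw [map_span_le]
    rintro _ ⟨b, rfl⟩
    rw [hgc, hg₀, Function.comp_apply]
    by_cases hb : b = a
    · subst hb
      refine ⟨x b + t • (τ - x.coord b τ • x b), ?_⟩
      simp only [LinearMap.add_apply, LinearMap.comp_apply, subtype_apply, LinearMap.smul_apply,
        LinearMap.smulRight_apply, map_add, map_smul, map_sub, Basis.coord_apply,
        Basis.repr_self, Finsupp.single_eq_same, one_smul, hc, hw]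
      rw [hx, coe_coordBasis]
      module
    · refine ⟨x b, ?_⟩
      have h1 : i b ≠ i a := fun h => hb (hi.injective h)
      simp [hb, h1, hx, coe_coordBasis]
  have hcell := cellMem_map (cellMem_spanFlag v hi) g hg
  rwa [← eq_of_le_of_finrank_le hle ?_]
  refine (LinearMap.finrank_range_le _).trans ?_
  rw [hcell.1, (cellMem_spanFlag v hi).1]

theorem mem_mTangent_of_line [Infinite k] {D : Type} [AddCommGroup D] [Module k D] {A : Set D}
    {y : D} (d : k) (h : ∀ t : k, 1 + t * d ≠ 0 → t • y ∈ A) : y ∈ mTangent k A 0 := by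
  rw [mem_mTangent_iff]
  intro p hp
  let γ : Dual k D → k[X] := fun l => X * Polynomial.C (l y)
  rw [← derivative_curve p γ 0 y (by simp [γ]) (by simp [γ])]
  have h1 : MvPolynomial.aeval γ p * (1 + X * Polynomial.C d) = 0 := by
    refine Polynomial.funext fun t => ?_
    rw [eval_mul, eval_aeval_curve p γ (x := t • y) (fun l => by
      simp only [γ, map_smul, eval_mul, eval_X, eval_C, smul_eq_mul])]
    by_cases ht : 1 + t * d = 0
    · have h2 : eval t (1 + X * Polynomial.C d) = 0 := by simpa [mul_comm d] using ht
      rw [h2, mul_zero, eval_zero]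
    · rw [hp _ (h t ht)]
      simp
  have h2 : (1 + X * Polynomial.C d : k[X]) ≠ 0 := fun h0 => by
    have := congrArg (Polynomial.eval 0) h0
    simp at this
  rw [(mul_eq_zero.1 h1).resolve_right h2]
  simp

theorem mem_grTangent_iff [Infinite k] (v : Basis (Fin n) k W) {i : Fin r → Fin n}
    (hi : StrictMono i) {C : Submodule k W} (hTC : IsCompl (span k (Set.range (v ∘ i))) C)
    (φ : span k (Set.range (v ∘ i)) →ₗ[k] W ⧸ span k (Set.range (v ∘ i))) :
    φ ∈ grTangent {V' | cellMem i (spanFlag k v) V'} (span k (Set.range (v ∘ i))) C ↔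
      ∀ a, φ (coordBasis v hi a) ∈
        (spanFlag k v (i a + 1)).map (span k (Set.range (v ∘ i))).mkQ := by
  set T := span k (Set.range (v ∘ i)) with hT
  constructor
  · rintro ⟨ψ, hψ, rfl⟩ a
    obtain ⟨y, hy, z, hz, hyz⟩ := mem_sup.1 (mem_sup_of_mem_mTangent v hi hψ a)
    refine ⟨y, hy, ?_⟩
    change T.mkQ y = T.mkQ (ψ (coordBasis v hi a) : W)
    rw [← hyz, map_add, (Submodule.Quotient.mk_eq_zero T).2 hz |> fun h => (h : T.mkQ z = 0),
      add_zero]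
  · intro h
    choose e he hφ using h
    have hdec : ∀ a, ∃ τ : T, ∃ c : C, (c : W) = e a - τ := by
      intro a
      obtain ⟨y, hy, z, hz, hyz⟩ := mem_sup.1 (hTC.sup_eq_top ▸ mem_top : e a ∈ T ⊔ C)
      exact ⟨⟨y, hy⟩, ⟨z, hz⟩, by simp [← hyz]⟩
    choose τ c hc using hdec
    refine ⟨∑ a, ((coordBasis v hi).coord a).smulRight (c a), ?_, ?_⟩
    · refine sum_mem fun a _ => mem_mTangent_of_line
        (v.coord (i a) (e a) - (coordBasis v hi).coord a (τ a)) fun t ht => ?_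
      exact graphMap_smul_smulRight_mem_cell v hi a (he a) (hc a) ht
    · refine (coordBasis v hi).ext fun a => ?_
      rw [← hφ a]
      change T.mkQ
          (((∑ b, ((coordBasis v hi).coord b).smulRight (c b)) (coordBasis v hi a) : C) : W)
        = T.mkQ (e a)
      rw [LinearMap.sum_apply, Finset.sum_eq_single a]
      · rw [LinearMap.smulRight_apply, Basis.coord_apply, Basis.repr_self,
          Finsupp.single_eq_same, one_smul, hc, map_sub,
          (Submodule.Quotient.mk_eq_zero T).2 (τ a).2 |> fun h => (h : T.mkQ (τ a) = 0), sub_zero]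
      · intro b _ hb
        simp [hb.symm]
      · simp

end Tangent

section Complement
variable {n r : ℕ}

theorem exists_sumEquiv_compl {i : Fin r → Fin n} (hi : StrictMono i) :
    ∃ σ : Fin r ⊕ Fin (n - r) ≃ Fin n, (∀ a, σ (Sum.inl a) = i a) ∧
      ∀ a b, σ (Sum.inr b) < i a ↔ (b : ℕ) < i a - a := by
  classical
  have hcard : (Finset.univ.image i)ᶜ.card = n - r := by
    rw [Finset.card_compl, Finset.card_image_of_injective _ hi.injective, Fintype.card_fin,
      Finset.card_univ, Fintype.card_fin]
  let c := (Finset.univ.image i)ᶜ.orderEmbOfFin hcard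
  have hc : ∀ b a, i a ≠ c b := fun b a h => by
    have := Finset.orderEmbOfFin_mem _ hcard b
    rw [Finset.mem_compl, Finset.mem_image] at this
    exact this ⟨a, Finset.mem_univ _, h⟩
  have hbij : Function.Bijective (Sum.elim i c) := by
    constructor
    · exact hi.injective.sumElim c.injective fun a b => hc b a
    · intro u
      by_cases hu : ∃ a, i a = u
      · obtain ⟨a, rfl⟩ := hu
        exact ⟨Sum.inl a, rfl⟩
      · have : u ∈ Set.range c := by
          rw [Finset.range_orderEmbOfFin]
          simpa using hu
        obtain ⟨b, rfl⟩ := this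
        exact ⟨Sum.inr b, rfl⟩
  refine ⟨Equiv.ofBijective _ hbij, fun a => rfl, fun a b => ?_⟩
  change c b < i a ↔ _
  have hcount : (Finset.univ.filter fun b => c b < i a).card = i a - a := by
    have h1 : (Finset.univ.filter fun u : Fin n => u < i a).card = i a := by
      rw [← Fin.card_Iio (i a)]
      congr 1
      ext u
      simp
    have h2 : (Finset.univ.filter fun u : Fin n => u < i a)
        = (Finset.univ.filter fun b : Fin r => b < a).map ⟨i, hi.injective⟩
          ∪ (Finset.univ.filter fun b => c b < i a).map c.toEmbedding := by
      ext u
      obtain ⟨x, rfl⟩ := hbij.2 u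
      rcases x with x | x
      · simp only [Sum.elim_inl, Finset.mem_filter, Finset.mem_univ, true_and, Finset.mem_union,
          Finset.mem_map, Function.Embedding.coeFn_mk, hi.lt_iff_lt]
        constructor
        · exact fun h => Or.inl ⟨x, h, rfl⟩
        · rintro (⟨y, hy, h⟩ | ⟨y, hy, h⟩)
          · exact hi.injective h ▸ hy
          · exact absurd h.symm (hc y x)
      · simp only [Sum.elim_inr, Finset.mem_filter, Finset.mem_univ, true_and, Finset.mem_union,
          Finset.mem_map, Function.Embedding.coeFn_mk]
        constructor
        · exact fun h => Or.inr ⟨x, h, rfl⟩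
        · rintro (⟨y, hy, h⟩ | ⟨y, hy, h⟩)
          · exact absurd h (hc x y)
          · exact c.injective h ▸ hy
    rw [h2, Finset.card_union_of_disjoint, Finset.card_map, Finset.card_map] at h1
    · have h3 : (Finset.univ.filter fun b : Fin r => b < a).card = a := by
        rw [← Fin.card_Iio a]
        congr 1
        ext u
        simp
      lia
    · rw [Finset.disjoint_left]
      intro u hu hu'
      obtain ⟨y, -, rfl⟩ := Finset.mem_map.1 hu
      obtain ⟨z, -, hz⟩ := Finset.mem_map.1 hu'
      exact hc z y hz.symm
  rw [← hcount]
  constructor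
  · intro h
    have h1 : Finset.Iic b ⊆ Finset.univ.filter fun b => c b < i a := fun x hx => by
      simpa using lt_of_le_of_lt (c.monotone (Finset.mem_Iic.1 hx)) h
    have := Finset.card_le_card h1
    rw [Fin.card_Iic] at this
    lia
  · intro h
    by_contra hn
    have h1 : (Finset.univ.filter fun b => c b < i a) ⊆ Finset.Iio b := fun x hx => by
      rw [Finset.mem_Iio]
      by_contra hx'
      exact hn (lt_of_le_of_lt (c.monotone (not_lt.1 hx')) (Finset.mem_filter.1 hx).2)
    have := Finset.card_le_card h1
    rw [Fin.card_Iio] at this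
    lia

end Complement

section Transversal
variable {k W : Type} [Field k] [AddCommGroup W] [Module k W] {n r : ℕ}

theorem exists_basis_quotient (v : Basis (Fin n) k W) {T : Submodule k W}
    {σ : Fin r ⊕ Fin (n - r) ≃ Fin n} (hT : T = span k (Set.range fun a => v (σ (Sum.inl a)))) :
    ∃ g : Basis (Fin (n - r)) k (W ⧸ T), ∀ b, g b = T.mkQ (v (σ (Sum.inr b))) := by
  have : FiniteDimensional k W := v.finiteDimensional_of_finite
  have hr : r ≤ n := by
    have := Fintype.card_congr σ
    simp only [Fintype.card_sum, Fintype.card_fin] at this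
    lia
  have hker : ∀ a, T.mkQ (v (σ (Sum.inl a))) = 0 := fun a => by
    have : v (σ (Sum.inl a)) ∈ T := hT ▸ subset_span ⟨a, rfl⟩
    simpa using this
  have hrank : finrank k (W ⧸ T) = n - r := by
    have h1 := T.finrank_quotient_add_finrank
    have h2 : finrank k T = r := by
      have hli : LinearIndependent k fun a => v (σ (Sum.inl a)) :=
        v.linearIndependent.comp _ (σ.injective.comp Sum.inl_injective)
      rw [hT, finrank_span_eq_card hli, Fintype.card_fin]
    rw [finrank_eq_card_basis v, Fintype.card_fin, h2] at h1
    lia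
  have hspan : ⊤ ≤ span k (Set.range fun b => T.mkQ (v (σ (Sum.inr b)))) := by
    rw [← T.range_mkQ, LinearMap.range_eq_map, ← v.span_eq, map_span, span_le]
    rintro _ ⟨_, ⟨u, rfl⟩, rfl⟩
    obtain ⟨x, rfl⟩ := σ.surjective u
    rcases x with a | b
    · rw [hker]
      exact zero_mem _
    · exact subset_span ⟨b, rfl⟩
  refine ⟨basisOfTopLeSpanOfCardEqFinrank _ hspan (by rw [hrank, Fintype.card_fin]), fun b => ?_⟩
  rw [coe_basisOfTopLeSpanOfCardEqFinrank]

theorem map_mkQ_spanFlag (v : Basis (Fin n) k W) {i : Fin r → Fin n} {T : Submodule k W}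
    {σ : Fin r ⊕ Fin (n - r) ≃ Fin n} (hσ : ∀ a, σ (Sum.inl a) = i a)
    (hσ' : ∀ a b, σ (Sum.inr b) < i a ↔ (b : ℕ) < i a - a)
    (hT : T = span k (Set.range fun a => v (σ (Sum.inl a))))
    {g : Fin (n - r) → W ⧸ T} (hg : ∀ b, g b = T.mkQ (v (σ (Sum.inr b)))) (a : Fin r) :
    (spanFlag k v (i a + 1)).map T.mkQ = spanFlag k g (i a - a) := by
  rw [spanFlag, spanFlag, map_span]
  refine le_antisymm (span_le.2 ?_) (span_le.2 ?_)
  · rintro _ ⟨_, ⟨u, hu, rfl⟩, rfl⟩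
    obtain ⟨x, rfl⟩ := σ.surjective u
    rcases x with b | b
    · have : v (σ (Sum.inl b)) ∈ T := hT ▸ subset_span ⟨b, rfl⟩
      have h0 : T.mkQ (v (σ (Sum.inl b))) = 0 := by simpa using this
      rw [h0]
      exact zero_mem _
    · refine subset_span ⟨b, (hσ' a b).1 (lt_of_le_of_ne (Nat.lt_succ_iff.1 hu) fun h => ?_), hg b⟩
      rw [← hσ a] at h
      exact absurd (σ.injective h) (by simp)
  · rintro _ ⟨b, hb, rfl⟩
    refine subset_span ⟨_, ⟨σ (Sum.inr b), ?_, rfl⟩, (hg b).symm⟩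
    exact Nat.lt_succ_of_lt (Fin.lt_def.1 ((hσ' a b).2 hb))

theorem mem_grTangent_iff_of_eq [Infinite k] (v : Basis (Fin n) k W) {i : Fin r → Fin n}
    (hi : StrictMono i) {T C : Submodule k W} (hT : T = span k (Set.range (v ∘ i)))
    (hTC : IsCompl T C) {f : Fin r → T} (hf : ∀ a, (f a : W) = v (i a))
    (φ : T →ₗ[k] W ⧸ T) :
    φ ∈ grTangent {V' | cellMem i (spanFlag k v) V'} T C ↔
      ∀ a, φ (f a) ∈ (spanFlag k v (i a + 1)).map T.mkQ := by
  subst hT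
  rw [mem_grTangent_iff v hi hTC]
  have h : ∀ a, f a = coordBasis v hi a := fun a => Subtype.ext (by rw [hf, coe_coordBasis])
  simp only [h]

theorem iInf_grTangent_eq_homSpace [Infinite k] {s : ℕ} {I : Fin s → Fin r → Fin n}
    (hI : ∀ j, StrictMono (I j)) (v : Fin s → Basis (Fin n) k W) {T C : Submodule k W}
    (hTC : IsCompl T C) {σ : Fin s → (Fin r ⊕ Fin (n - r) ≃ Fin n)}
    (hσ : ∀ j a, σ j (Sum.inl a) = I j a)
    (hσ' : ∀ j a b, σ j (Sum.inr b) < I j a ↔ (b : ℕ) < I j a - a)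
    (hT : ∀ j, T = span k (Set.range (v j ∘ I j)))
    {f : Fin s → Fin r → T} (hf : ∀ j a, (f j a : W) = v j (I j a))
    {g : Fin s → Fin (n - r) → W ⧸ T} (hg : ∀ j b, g j b = T.mkQ (v j (σ j (Sum.inr b)))) :
    ⨅ j, grTangent {V' | cellMem (I j) (spanFlag k (v j)) V'} T C
      = homSpace I (fun j => spanFlag k (f j)) (fun j => spanFlag k (g j)) := by
  ext φ
  rw [mem_homSpace_spanFlag_iff hI f (fun j => spanFlag k (g j)) fun j m m' h =>
    span_mono (Set.image_mono fun _ hx => lt_of_lt_of_le hx h), mem_iInf]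
  refine forall_congr' fun j => ?_
  rw [mem_grTangent_iff_of_eq (v j) (hI j) (hT j) hTC (hf j)]
  refine forall_congr' fun a => ?_
  rw [map_mkQ_spanFlag (v j) (hσ j) (hσ' j) ?_ (hg j)]
  simp only [hσ]
  exact hT j

/-- Transversality of Schubert cells at one point forces the product of the Schubert classes to be
nonzero. -/
theorem prod_omegaCls_ne_zero_of_transversal [Infinite k] [FiniteDimensional k W] {s : ℕ}
    (hrn : r ≤ n) (hW : finrank k W = n) {I : Fin s → Fin r → Fin n}
    (hI : ∀ j, StrictMono (I j)) {E : Fin s → ℕ → Submodule k W} (hE : ∀ j, IsFlag (E j))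
    {T C : Submodule k W} (hT : ∀ j, cellMem (I j) (E j) T) (hTC : IsCompl T C)
    (hTr : finrank k T = r)
    (h : (finrank k ↥(⨅ j : Fin s, grTangent {V' | cellMem (I j) (E j) V'} T C) : ℤ)
      = (r : ℤ) * ((n : ℤ) - (r : ℤ)) - ∑ j : Fin s, codimZ n r (I j)) :
    ∏ j : Fin s, omegaCls (I j) ≠ 0 := by
  choose v hv hvT using fun j => exists_adapted_basis hW (hI j) (hE j) (hT j)
  obtain rfl : E = fun j => spanFlag k (v j) := funext hv
  choose σ hσ hσ' using fun j => exists_sumEquiv_compl (hI j)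
  have hTσ : ∀ j, T = span k (Set.range fun a => v j (σ j (Sum.inl a))) := fun j => by
    simp only [hσ]
    exact hvT j
  choose g hg using fun j => exists_basis_quotient (v j) (hTσ j)
  have hmem : ∀ j a, v j (I j a) ∈ T := fun j a => by
    rw [hvT j]
    exact subset_span ⟨a, rfl⟩
  have hrank : finrank k (W ⧸ T) = n - r := by
    rw [← hW, ← hTr]
    have := T.finrank_quotient_add_finrank
    lia
  rw [iInf_grTangent_eq_homSpace hI v hTC hσ hσ' hvT (f := fun j a => ⟨_, hmem j a⟩)
    (fun _ _ => rfl) hg,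
    finrank_homSpace_eq_iff hrn hI (finBasisOfFinrankEq k T hTr)
      (finBasisOfFinrankEq k (W ⧸ T) hrank)] at h
  exact (prod_omegaCls_ne_zero_iff hrn hI).2 (minorPoly_ne_zero_of_linearIndependent h)

/-- A point of transversality of Schubert cells constructed from flags on a subspace and on the
corresponding quotient. -/
theorem exists_transversal_of_finrank_homSpace [Infinite k] {s : ℕ} (hrn : r ≤ n)
    {I : Fin s → Fin r → Fin n} (hI : ∀ j, StrictMono (I j))
    (F : Fin s → Basis (Fin r) k (Fin r → k))
    (G : Fin s → Basis (Fin (n - r)) k (Fin (n - r) → k))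
    (h : (finrank k (homSpace I (fun j => spanFlag k (F j)) (fun j => spanFlag k (G j))) : ℤ)
      = (r : ℤ) * ((n : ℤ) - (r : ℤ)) - ∑ j : Fin s, codimZ n r (I j)) :
    ∃ E : Fin s → ℕ → Submodule k (Fin n → k), (∀ j, IsFlag (E j)) ∧
      ∃ T : Submodule k (Fin n → k), (∀ j, cellMem (I j) (E j) T) ∧
        ∀ C : Submodule k (Fin n → k), IsCompl T C →
          (finrank k ↥(⨅ j : Fin s, grTangent {V' | cellMem (I j) (E j) V'} T C) : ℤ)
            = (r : ℤ) * ((n : ℤ) - (r : ℤ)) - ∑ j : Fin s, codimZ n r (I j) := by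
  choose σ hσ hσ' using fun j => exists_sumEquiv_compl (hI j)
  let e : ((Fin r → k) × (Fin (n - r) → k)) ≃ₗ[k] (Fin n → k) :=
    LinearEquiv.ofFinrankEq _ _ (by simp [Nat.add_sub_cancel' hrn])
  let v : Fin s → Basis (Fin n) k (Fin n → k) := fun j =>
    (((F j).prod (G j)).reindex (σ j)).map e
  have hvl : ∀ j a, v j (I j a) = e (F j a, 0) := fun j a => by
    rw [← hσ]
    simp [v]
  have hvr : ∀ j b, v j (σ j (Sum.inr b)) = e (0, G j b) := fun j b => by
    simp [v]
  let ι : (Fin r → k) →ₗ[k] (Fin n → k) := e.toLinearMap ∘ₗ LinearMap.inl k _ _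
  have hι : Function.Injective ι := e.injective.comp LinearMap.inl_injective
  let T : Submodule k (Fin n → k) := LinearMap.range ι
  have hvT : ∀ j, T = span k (Set.range (v j ∘ I j)) := fun j => by
    change LinearMap.range ι = _
    rw [LinearMap.range_eq_map, ← (F j).span_eq, map_span, ← Set.range_comp]
    congr 2
    funext a
    exact (hvl j a).symm
  let θ : (Fin r → k) ≃ₗ[k] T := LinearEquiv.ofInjective ι hι
  let η₀ : (Fin (n - r) → k) →ₗ[k] (Fin n → k) ⧸ T :=
    T.mkQ ∘ₗ e.toLinearMap ∘ₗ LinearMap.inr k _ _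
  have hη : Function.Bijective η₀ := by
    constructor
    · rw [injective_iff_map_eq_zero]
      intro y hy
      have h1 : e (0, y) ∈ T := (Submodule.Quotient.mk_eq_zero T).1 hy
      obtain ⟨x, hx⟩ := h1
      exact (congrArg Prod.snd (e.injective hx)).symm
    · intro z
      obtain ⟨w, rfl⟩ := T.mkQ_surjective z
      obtain ⟨⟨x, y⟩, rfl⟩ := e.surjective w
      refine ⟨y, ?_⟩
      change T.mkQ (e (0, y)) = T.mkQ (e (x, y))
      rw [← sub_eq_zero, ← map_sub, ← map_sub]
      refine (Submodule.Quotient.mk_eq_zero T).2 ⟨-x, ?_⟩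
      change e (-x, 0) = _
      congr 1
      simp
  let η : (Fin (n - r) → k) ≃ₗ[k] (Fin n → k) ⧸ T := LinearEquiv.ofBijective η₀ hη
  refine ⟨fun j => spanFlag k (v j), fun j => isFlag_spanFlag _, T, fun j => ?_, fun C hTC => ?_⟩
  · have := cellMem_spanFlag (v j) (hI j)
    rwa [← hvT j] at this
  · rw [iInf_grTangent_eq_homSpace hI v hTC hσ hσ' hvT (f := fun j a => θ (F j a))
      (fun j a => (hvl j a).symm) (g := fun j => (G j).map η) fun j b => by rw [hvr]; rfl,
      finrank_homSpace_eq_iff hrn hI ((Pi.basisFun k (Fin r)).map θ)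
        ((Pi.basisFun k (Fin (n - r))).map η)]
    rw [finrank_homSpace_eq_iff hrn hI (Pi.basisFun k (Fin r)) (Pi.basisFun k (Fin (n - r)))] at h
    convert h using 2
    · funext x c
      simp [rowCoord]
    · funext x c
      simp [colCoord]

end Transversal

end

/-- Proposition `april2`.  For `V = κ^r`, `Q = κ^{n-r}` and an
`s`-tuple `𝓘` of subsets of `[n]` of cardinality `r`, consider:
(α) `∏_j ω_{I^j} ≠ 0` in `H^*(Gr(r,n))`;
(β) there exist `𝓔 ∈ Fl(κ^n)^s` and `T ∈ ∩_j Ω°_{I^j}(E^j_•)` at which the cells meet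
transversally (the intersection of their tangent spaces, computed in any chart at `T`,
has dimension `dim Gr(r,n) - ∑_j codim ω_{I^j}`);
(γ) for generic `(𝓕,𝓖) ∈ Fl(V)^s × Fl(Q)^s` the space `Hom_𝓘(V,Q,𝓕,𝓖)` has dimension
`dim Gr(r,n) - ∑_j codim ω_{I^j}`.
Then `(γ) ⇒ (β) ⇒ (α)` in any characteristic, and `(α) ⇒ (γ)` in characteristic zero. -/
theorem stmt9 (k : Type) [Field k] [IsAlgClosed k]
    (n r s : ℕ) (hs : 0 < s) (hrn : r ≤ n)
    (I : Fin s → Fin r → Fin n) (hI : ∀ j, StrictMono (I j)) :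
    ((GenericFlagPairs k (M := Fin r → k) (Q := Fin (n - r) → k) s r (n - r)
        (fun F G => (Module.finrank k ↥(homSpace I F G) : ℤ)
          = (r : ℤ) * ((n : ℤ) - (r : ℤ)) - ∑ j : Fin s, codimZ n r (I j)) →
      (∃ E : Fin s → ℕ → Submodule k (Fin n → k), (∀ j, IsFlag (E j)) ∧
        ∃ T : Submodule k (Fin n → k), (∀ j, cellMem (I j) (E j) T) ∧
          ∀ C : Submodule k (Fin n → k), IsCompl T C →
            (Module.finrank k
                ↥(⨅ j : Fin s, grTangent {V' : Submodule k (Fin n → k) |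
                    cellMem (I j) (E j) V'} T C) : ℤ)
              = (r : ℤ) * ((n : ℤ) - (r : ℤ)) - ∑ j : Fin s, codimZ n r (I j)))) ∧
    ((∃ E : Fin s → ℕ → Submodule k (Fin n → k), (∀ j, IsFlag (E j)) ∧
        ∃ T : Submodule k (Fin n → k), (∀ j, cellMem (I j) (E j) T) ∧
          ∀ C : Submodule k (Fin n → k), IsCompl T C →
            (Module.finrank k
                ↥(⨅ j : Fin s, grTangent {V' : Submodule k (Fin n → k) |
                    cellMem (I j) (E j) V'} T C) : ℤ)
              = (r : ℤ) * ((n : ℤ) - (r : ℤ)) - ∑ j : Fin s, codimZ n r (I j)) →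
      (∏ j : Fin s, omegaCls (I j)) ≠ 0) ∧
    (CharZero k →
      (∏ j : Fin s, omegaCls (I j)) ≠ 0 →
      GenericFlagPairs k (M := Fin r → k) (Q := Fin (n - r) → k) s r (n - r)
        (fun F G => (Module.finrank k ↥(homSpace I F G) : ℤ)
          = (r : ℤ) * ((n : ℤ) - (r : ℤ)) - ∑ j : Fin s, codimZ n r (I j))) := by
  have : Infinite k := IsAlgClosed.instInfinite
  refine ⟨?_, ?_, fun _ h => genericFlagPairs_of_prod_omegaCls_ne_zero hrn hI h⟩
  · rintro ⟨U, -, ⟨b, hb, hb1, hb2⟩, hU⟩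
    have h1 : (fun j => spanFlag k ⇑(basisOfLI (hb1 j))) = fun j => spanFlag k (b.1 j) :=
      funext fun j => congrArg _ (coe_basisOfLI (hb1 j))
    have h2 : (fun j => spanFlag k ⇑(basisOfLI (hb2 j))) = fun j => spanFlag k (b.2 j) :=
      funext fun j => congrArg _ (coe_basisOfLI (hb2 j))
    refine exists_transversal_of_finrank_homSpace hrn hI (fun j => basisOfLI (hb1 j))
      (fun j => basisOfLI (hb2 j)) ?_
    rw [h1, h2]
    exact hU b hb ⟨hb1, hb2⟩
  · rintro ⟨E, hE, T, hT, h⟩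
    obtain ⟨C, hC⟩ := T.exists_isCompl
    exact prod_omegaCls_ne_zero_of_transversal hrn (by simp) hI hE hT hC (hT ⟨0, hs⟩).1 (h C hC)

end
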